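/- arXiv:math/0606225 — 2 statements merged into one kernel-verified Lean document; each statement's English description precedes it below -/
import Mathlib

section
/- Let M be a II₁ factor with faithful tracial state τ, let A ⊆ M be a MASA, and set N := N_M(A)''. Assume the τ-preserving conditional expectations E_A and E_N onto A and N exist. Then the triple A ⊆ N ⊆ M satisfies the relative weak asymptotic homomorphism property: for all x₁,…,xₙ ∈ M and every ε > 0 there exists a unitary u ∈ A such that ‖E_A(x_i u x_j) − E_A(E_N(x_i) u E_N(x_j))‖₂ < ε for all i, j = 1,…,n. -/
open scoped ComplexOrder

noncomputable section

variable {H : Type*} [NormedAddCommGroup H] [InnerProductSpace ℂ H] [CompleteSpace H]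

/-- The von Neumann algebra generated by a set of bounded operators `S`:
the double commutant of `S ∪ S*`. -/
def vNgen (S : Set (H →L[ℂ] H)) : Set (H →L[ℂ] H) :=
  Set.centralizer (Set.centralizer (S ∪ star '' S))

/-- `M` is a von Neumann algebra acting on `H`: a unital *-subalgebra of `B(H)`
equal to its double commutant. -/
structure IsVonNeumannAlgebra (M : Set (H →L[ℂ] H)) : Prop where
  one_mem : (1 : H →L[ℂ] H) ∈ M
  add_mem : ∀ x ∈ M, ∀ y ∈ M, x + y ∈ M
  mul_mem : ∀ x ∈ M, ∀ y ∈ M, x * y ∈ M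
  smul_mem : ∀ (c : ℂ), ∀ x ∈ M, c • x ∈ M
  star_mem : ∀ x ∈ M, star x ∈ M
  double_commutant : Set.centralizer (Set.centralizer M) = M

/-- `τ` is a faithful tracial state on `M`. -/
structure IsFaithfulTracialState (M : Set (H →L[ℂ] H)) (τ : (H →L[ℂ] H) → ℂ) : Prop where
  map_add : ∀ x ∈ M, ∀ y ∈ M, τ (x + y) = τ x + τ y
  map_smul : ∀ (c : ℂ), ∀ x ∈ M, τ (c • x) = c * τ x
  map_one : τ 1 = 1
  nonneg : ∀ x ∈ M, 0 ≤ τ (star x * x)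
  tracial : ∀ x ∈ M, ∀ y ∈ M, τ (x * y) = τ (y * x)
  faithful : ∀ x ∈ M, τ (star x * x) = 0 → x = 0

/-- `M` is infinite dimensional: it is not contained in the span of finitely many operators. -/
def IsInfiniteDimensionalSet (M : Set (H →L[ℂ] H)) : Prop :=
  ∀ s : Finset (H →L[ℂ] H),
    ¬ (M ⊆ (Submodule.span ℂ (s : Set (H →L[ℂ] H)) : Set (H →L[ℂ] H)))

/-- `M` is a factor: its center consists of scalar multiples of the identity. -/
def IsFactor (M : Set (H →L[ℂ] H)) : Prop :=
  ∀ x ∈ M, (∀ y ∈ M, x * y = y * x) → ∃ c : ℂ, x = c • (1 : H →L[ℂ] H)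

/-- `M` is a II₁ factor with faithful tracial state `τ`. -/
structure IsII1Factor (M : Set (H →L[ℂ] H)) (τ : (H →L[ℂ] H) → ℂ) : Prop where
  vna : IsVonNeumannAlgebra M
  factor : IsFactor M
  infdim : IsInfiniteDimensionalSet M
  trace : IsFaithfulTracialState M τ

/-- The 2-norm `‖x‖₂ = τ(x*x)^{1/2}` associated to the trace `τ`. -/
def norm2 (τ : (H →L[ℂ] H) → ℂ) (x : H →L[ℂ] H) : ℝ :=
  Real.sqrt (τ (star x * x)).re

/-- `E` is the `τ`-preserving conditional expectation of `M` onto `B`. -/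
def IsCondExp (M B : Set (H →L[ℂ] H)) (τ : (H →L[ℂ] H) → ℂ)
    (E : (H →L[ℂ] H) → (H →L[ℂ] H)) : Prop :=
  (∀ x ∈ M, E x ∈ B) ∧ (∀ x ∈ M, ∀ b ∈ B, τ ((x - E x) * b) = 0)

/-- `A` is a maximal abelian *-subalgebra (MASA) of `M`. -/
def IsMasa (M A : Set (H →L[ℂ] H)) : Prop :=
  A ⊆ M ∧ (∀ a ∈ A, star a ∈ A) ∧ {x ∈ M | ∀ a ∈ A, x * a = a * x} = A

/-- `u` is a unitary operator. -/
def IsUnitary (u : H →L[ℂ] H) : Prop :=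
  star u * u = 1 ∧ u * star u = 1

/-- The set of normalizing unitaries of `A` in `M`: unitaries `u ∈ M` with `uAu* = A`. -/
def normalizerSet (M A : Set (H →L[ℂ] H)) : Set (H →L[ℂ] H) :=
  {u | u ∈ M ∧ IsUnitary u ∧ (fun a => u * a * star u) '' A = A}

/-- The normalizing algebra `N_M(A)''` of `A` in `M`. -/
def normAlg (M A : Set (H →L[ℂ] H)) : Set (H →L[ℂ] H) :=
  vNgen (normalizerSet M A)

/-- The triple `B ⊆ N ⊆ M` satisfies the relative weak asymptotic homomorphism property
relative to the trace `τ` and the conditional expectations `EB` and `EN`. -/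
def RelWAHP (M N B : Set (H →L[ℂ] H)) (τ : (H →L[ℂ] H) → ℂ)
    (EB EN : (H →L[ℂ] H) → (H →L[ℂ] H)) : Prop :=
  ∀ (n : ℕ) (x : Fin n → (H →L[ℂ] H)), (∀ i, x i ∈ M) →
    ∀ ε : ℝ, 0 < ε → ∃ u ∈ B, IsUnitary u ∧
      ∀ i j, norm2 τ (EB (x i * u * x j) - EB (EN (x i) * u * EN (x j))) < ε

section Auxiliary

open Filter Topology

/-- Convergence in the weak operator topology along a filter. -/
def WTends {ι : Type*} (l : Filter ι) (y : ι → H →L[ℂ] H) (z : H →L[ℂ] H) : Prop :=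
  ∀ ξ η : H, Tendsto (fun i => inner ℂ (y i ξ) η) l (𝓝 (inner ℂ (z ξ) η))

theorem exists_wTends {ι : Type*} (l : Ultrafilter ι) (y : ι → H →L[ℂ] H) (C : ℝ)
    (h : ∀ i, ‖y i‖ ≤ C) : ∃ z, WTends (l : Filter ι) y z := by
  have hb : ∀ i ξ η, ‖inner ℂ (y i ξ) η‖ ≤ C * ‖ξ‖ * ‖η‖ := fun i ξ η =>
    (norm_inner_le_norm _ _).trans (mul_le_mul_of_nonneg_right
      (((y i).le_opNorm ξ).trans (mul_le_mul_of_nonneg_right (h i) (norm_nonneg _)))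
      (norm_nonneg _))
  have key : ∀ ξ η : H, ∃ b : ℂ, ‖b‖ ≤ C * ‖ξ‖ * ‖η‖ ∧
      Tendsto (fun i => inner ℂ (y i ξ) η) l (𝓝 b) := by
    intro ξ η
    have hc : IsCompact (Metric.closedBall (0 : ℂ) (C * ‖ξ‖ * ‖η‖)) :=
      isCompact_closedBall _ _
    obtain ⟨b, hb1, hb2⟩ := hc.ultrafilter_le_nhds (l.map (fun i => inner ℂ (y i ξ) η)) (by
      rw [le_principal_iff]
      exact Filter.Eventually.of_forall (f := (l : Filter ι)) (fun i => by
        simpa using hb i ξ η))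
    exact ⟨b, by simpa using hb1, hb2⟩
  choose b hbn hbt using key
  let B : H →ₗ⋆[ℂ] H →ₗ[ℂ] ℂ := LinearMap.mk₂'ₛₗ (starRingEnd ℂ) (RingHom.id ℂ) b
    (fun ξ ξ' η => tendsto_nhds_unique (hbt (ξ + ξ') η) (by
      simpa [inner_add_left] using (hbt ξ η).add (hbt ξ' η)))
    (fun c ξ η => tendsto_nhds_unique (hbt (c • ξ) η) (by
      simpa [inner_smul_left, mul_comm] using (hbt ξ η).const_mul (starRingEnd ℂ c)))
    (fun ξ η η' => tendsto_nhds_unique (hbt ξ (η + η')) (by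
      simpa [inner_add_right] using (hbt ξ η).add (hbt ξ η')))
    (fun c ξ η => tendsto_nhds_unique (hbt ξ (c • η)) (by
      simpa [inner_smul_right] using (hbt ξ η).const_mul c))
  let B' : H →L⋆[ℂ] H →L[ℂ] ℂ := B.mkContinuous₂ C (fun ξ η => hbn ξ η)
  refine ⟨InnerProductSpace.continuousLinearMapOfBilin B', fun ξ η => ?_⟩
  rw [InnerProductSpace.continuousLinearMapOfBilin_apply]
  exact hbt ξ η

namespace WTends
variable {ι : Type*} {l : Filter ι} {y y' : ι → H →L[ℂ] H} {z z' : H →L[ℂ] H}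

theorem unique [l.NeBot] (h : WTends l y z) (h' : WTends l y z') : z = z' :=
  ContinuousLinearMap.ext fun ξ => ext_inner_right ℂ fun η =>
    tendsto_nhds_unique (h ξ η) (h' ξ η)

theorem const (z : H →L[ℂ] H) : WTends l (fun _ => z) z := fun _ _ => tendsto_const_nhds

theorem congr' (h : WTends l y z) (e : ∀ᶠ i in l, y i = y' i) : WTends l y' z := fun ξ η =>
  (h ξ η).congr' (e.mono fun i hi => by rw [hi])

theorem mul_right (h : WTends l y z) (b : H →L[ℂ] H) :
    WTends l (fun i => y i * b) (z * b) := fun ξ η => h (b ξ) η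

theorem mul_left (h : WTends l y z) (b : H →L[ℂ] H) :
    WTends l (fun i => b * y i) (b * z) := fun ξ η => by
  have := h ξ (star b η)
  simp only [ContinuousLinearMap.star_eq_adjoint, ContinuousLinearMap.adjoint_inner_right] at this
  exact this

theorem star (h : WTends l y z) : WTends l (fun i => star (y i)) (star z) := fun ξ η => by
  have := (Complex.continuous_conj.tendsto _).comp (h η ξ)
  simpa [ContinuousLinearMap.star_eq_adjoint, ContinuousLinearMap.adjoint_inner_left,
    Function.comp_def, inner_conj_symm] using this

theorem unique_of_eventually [l.NeBot] (h : WTends l y z) (e : ∀ᶠ i in l, y i = z') : z = z' :=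
  h.unique ((WTends.const z').congr' (e.mono fun _ hi => hi.symm))

theorem mem (R : VonNeumannAlgebra H) [l.NeBot] (h : WTends l y z) (hy : ∀ i, y i ∈ R) :
    z ∈ R := by
  rw [← R.commutant_commutant, VonNeumannAlgebra.mem_commutant_iff]
  intro g hg
  rw [VonNeumannAlgebra.mem_commutant_iff] at hg
  exact ((h.mul_left g).congr' (Eventually.of_forall fun i => (hg _ (hy i)).symm)).unique
    (h.mul_right g)

end WTends

theorem VonNeumannAlgebra.mem_of_commute (R : VonNeumannAlgebra H) {z : H →L[ℂ] H}
    (h : ∀ g ∈ R.commutant, Commute g z) : z ∈ R := by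
  rw [← R.commutant_commutant, VonNeumannAlgebra.mem_commutant_iff]
  exact fun g hg => h g hg

theorem VonNeumannAlgebra.commute_of_mem_commutant {R : VonNeumannAlgebra H} {z g : H →L[ℂ] H}
    (hg : g ∈ R.commutant) (hz : z ∈ R) : Commute g z :=
  ((VonNeumannAlgebra.mem_commutant_iff.1 hg) z hz).symm

instance : SMulMemClass (VonNeumannAlgebra H) ℂ (H →L[ℂ] H) where
  smul_mem {R} c x hx := by
    have := (algebraMap_mem R.toStarSubalgebra c : algebraMap ℂ (H →L[ℂ] H) c ∈ R)
    rw [Algebra.smul_def]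
    exact mul_mem this hx

theorem VonNeumannAlgebra.real_smul_mem (R : VonNeumannAlgebra H) (c : ℝ) {x : H →L[ℂ] H}
    (hx : x ∈ R) : c • x ∈ R := by
  have : c • x = (c : ℂ) • x := by ext; simp
  rw [this]
  exact SMulMemClass.smul_mem _ hx

theorem VonNeumannAlgebra.cfc_mem (R : VonNeumannAlgebra H) {a : H →L[ℂ] H} (ha : a ∈ R)
    (f : ℝ → ℝ) : cfc f a ∈ R :=
  R.mem_of_commute fun _ hg =>
    ((VonNeumannAlgebra.commute_of_mem_commutant hg ha).symm.cfc_real f).symm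

theorem VonNeumannAlgebra.posPart_mem (R : VonNeumannAlgebra H) {a : H →L[ℂ] H} (ha : a ∈ R) :
    a⁺ ∈ R :=
  R.mem_of_commute fun _ hg => by
    rw [CFC.posPart_def]
    exact ((VonNeumannAlgebra.commute_of_mem_commutant hg ha).symm.cfcₙ_real _).symm

/-- The projection onto the closure of the range of an operator. -/
def rangeProj (a : H →L[ℂ] H) : H →L[ℂ] H :=
  (LinearMap.range a.toLinearMap).topologicalClosure.starProjection

theorem isStarProjection_rangeProj (a : H →L[ℂ] H) : IsStarProjection (rangeProj a) :=
  isStarProjection_starProjection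

theorem rangeProj_mul_self (a : H →L[ℂ] H) : rangeProj a * a = a := by
  ext ξ
  exact Submodule.starProjection_eq_self_iff.2
    (Submodule.le_topologicalClosure _ (LinearMap.mem_range_self _ ξ))

theorem mul_rangeProj_eq_zero {a b : H →L[ℂ] H} (h : b * a = 0) : b * rangeProj a = 0 := by
  have hle : (LinearMap.range a.toLinearMap).topologicalClosure ≤ LinearMap.ker b.toLinearMap := by
    refine Submodule.topologicalClosure_minimal _ ?_ b.isClosed_ker
    rintro _ ⟨ξ, rfl⟩
    exact DFunLike.congr_fun h ξ
  ext ξ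
  exact hle (Submodule.starProjection_apply_mem _ ξ)

theorem IsStarProjection.star_eq {p : H →L[ℂ] H} (h : IsStarProjection p) : star p = p :=
  h.isSelfAdjoint

theorem IsStarProjection.mul_self {p : H →L[ℂ] H} (h : IsStarProjection p) : p * p = p :=
  h.isIdempotentElem

theorem IsStarProjection.commute_of {p T : H →L[ℂ] H} (hp : IsStarProjection p)
    (h : (1 - p) * T * p = 0) (h' : (1 - p) * star T * p = 0) : Commute T p := by
  have h2 := congrArg star h'
  simp only [star_mul, star_sub, star_one, hp.star_eq, star_star, star_zero] at h2
  have e1 : T * p = p * T * p := by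
    have : (1 - p) * T * p = T * p - p * T * p := by noncomm_ring
    rw [this] at h; exact sub_eq_zero.1 h
  have e2 : p * T = p * T * p := by
    have : p * (T * (1 - p)) = p * T - p * T * p := by noncomm_ring
    rw [this] at h2; exact sub_eq_zero.1 h2
  exact e1.trans e2.symm

theorem rangeProj_commute {a T : H →L[ℂ] H} (h : Commute T a) (h' : Commute (star T) a) :
    Commute T (rangeProj a) := by
  refine (isStarProjection_rangeProj a).commute_of ?_ ?_ <;> apply mul_rangeProj_eq_zero
  · rw [mul_assoc, h.eq, ← mul_assoc, sub_mul, one_mul, rangeProj_mul_self, sub_self, zero_mul]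
  · rw [mul_assoc, h'.eq, ← mul_assoc, sub_mul, one_mul, rangeProj_mul_self, sub_self, zero_mul]

theorem VonNeumannAlgebra.rangeProj_mem (R : VonNeumannAlgebra H) {a : H →L[ℂ] H} (ha : a ∈ R) :
    rangeProj a ∈ R :=
  R.mem_of_commute fun _ hg =>
    rangeProj_commute (VonNeumannAlgebra.commute_of_mem_commutant hg ha)
      (VonNeumannAlgebra.commute_of_mem_commutant (star_mem hg) ha)

theorem conj_nonneg_of_isSelfAdjoint {a p : H →L[ℂ] H} (ha : 0 ≤ a) (hp : IsSelfAdjoint p) :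
    0 ≤ p * a * p := by
  simpa [hp.star_eq] using star_left_conjugate_nonneg ha p

set_option maxHeartbeats 800000 in
theorem VonNeumannAlgebra.exists_dyadic_step (R : VonNeumannAlgebra H) {a : H →L[ℂ] H} (ha : a ∈ R)
    (h0 : 0 ≤ a) (h1 : a ≤ 1) : ∃ p ∈ R, IsStarProjection p ∧ ∃ b ∈ R, 0 ≤ b ∧ b ≤ 1 ∧
      a = (2⁻¹ : ℝ) • (p + b) := by
  set c : H →L[ℂ] H := a - (2⁻¹ : ℝ) • 1 with hc
  have hasa : IsSelfAdjoint a := .of_nonneg h0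
  have hcsa : IsSelfAdjoint c := hasa.sub (IsSelfAdjoint.smul (by simp [IsSelfAdjoint]) (.one _))
  have hcR : c ∈ R := sub_mem ha (R.real_smul_mem _ (one_mem _))
  set p := rangeProj c⁺ with hp
  have hpp : IsStarProjection p := isStarProjection_rangeProj _
  have hpsa : IsSelfAdjoint p := hpp.isSelfAdjoint
  have e1 : p * c⁺ = c⁺ := rangeProj_mul_self _
  have e2 : c⁺ * p = c⁺ := by
    have := congrArg star e1
    rwa [star_mul, hpsa.star_eq, (IsSelfAdjoint.of_nonneg (CFC.posPart_nonneg c)).star_eq] at this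
  have e3 : c⁻ * p = 0 := by
    apply mul_rangeProj_eq_zero
    have := congrArg star (CFC.posPart_mul_negPart c)
    rwa [star_mul, star_zero, (IsSelfAdjoint.of_nonneg (CFC.posPart_nonneg c)).star_eq,
      (IsSelfAdjoint.of_nonneg (CFC.negPart_nonneg c)).star_eq] at this
  have e4 : p * c⁻ = 0 := by
    have := congrArg star e3
    rwa [star_mul, hpsa.star_eq, star_zero,
      (IsSelfAdjoint.of_nonneg (CFC.negPart_nonneg c)).star_eq] at this
  have hcc : c⁺ - c⁻ = c := CFC.posPart_sub_negPart c hcsa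
  have ha2 : (2 : ℝ) • a = 1 + (2 : ℝ) • (c⁺ - c⁻) := by
    rw [hcc, hc]; module
  have hpos := CFC.posPart_nonneg c
  have hneg := CFC.negPart_nonneg c
  have hb0 : (2 : ℝ) • a - p = (2 : ℝ) • c⁺ + (1 - p) * ((2 : ℝ) • a) * (1 - p) := by
    rw [ha2]
    simp only [mul_sub, sub_mul, mul_add, add_mul, mul_one, one_mul, mul_smul_comm, smul_mul_assoc,
      hpp.mul_self, e1, e2, e3, e4, zero_mul]
    module
  have hb1 : 1 - ((2 : ℝ) • a - p) = (2 : ℝ) • c⁻ + p * ((2 : ℝ) • (1 - a)) * p := by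
    rw [smul_sub, ha2]
    simp only [mul_sub, sub_mul, mul_add, add_mul, mul_one, mul_smul_comm, smul_mul_assoc,
      hpp.mul_self, e1, e2, e4, zero_mul]
    module
  refine ⟨p, R.rangeProj_mem (R.posPart_mem hcR), hpp, (2 : ℝ) • a - p,
    sub_mem (R.real_smul_mem _ ha) (R.rangeProj_mem (R.posPart_mem hcR)), ?_, ?_, ?_⟩
  · rw [hb0]
    exact add_nonneg (smul_nonneg zero_le_two hpos)
      (conj_nonneg_of_isSelfAdjoint (smul_nonneg zero_le_two h0) ((IsSelfAdjoint.one _).sub hpsa))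
  · rw [← sub_nonneg, hb1]
    exact add_nonneg (smul_nonneg zero_le_two hneg)
      (conj_nonneg_of_isSelfAdjoint (smul_nonneg zero_le_two (sub_nonneg.2 h1)) hpsa)
  · rw [add_sub_cancel, smul_smul]; norm_num

theorem VonNeumannAlgebra.exists_dyadic (R : VonNeumannAlgebra H) (n : ℕ) {a : H →L[ℂ] H}
    (ha : a ∈ R) (h0 : 0 ≤ a) (h1 : a ≤ 1) :
    ∃ p : ℕ → H →L[ℂ] H, (∀ k, p k ∈ R ∧ IsStarProjection (p k)) ∧
      ∃ b ∈ R, 0 ≤ b ∧ b ≤ 1 ∧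
        a = (∑ k ∈ Finset.range n, (2⁻¹ : ℝ) ^ (k + 1) • p k) + (2⁻¹ : ℝ) ^ n • b := by
  induction n generalizing a with
  | zero => exact ⟨fun _ => 0, fun k => ⟨zero_mem _, .zero _⟩, a, ha, h0, h1, by simp⟩
  | succ n ih =>
    obtain ⟨p, hpR, hp, b, hb, hb0, hb1, e⟩ := R.exists_dyadic_step ha h0 h1
    obtain ⟨q, hq, d, hd, hd0, hd1, e'⟩ := ih hb hb0 hb1
    obtain ⟨P, hP0, hPs⟩ : ∃ P : ℕ → H →L[ℂ] H, P 0 = p ∧ ∀ k, P (k + 1) = q k :=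
      ⟨fun k => Nat.casesOn k p q, rfl, fun _ => rfl⟩
    refine ⟨P, fun k => ?_, d, hd, hd0, hd1, ?_⟩
    · cases k with
      | zero => exact hP0 ▸ ⟨hpR, hp⟩
      | succ k => exact hPs k ▸ hq k
    · rw [Finset.sum_range_succ', e, e', smul_add, smul_add, Finset.smul_sum]
      simp only [smul_smul, pow_succ']
      simp only [mul_one, pow_zero, hP0, hPs]
      abel

theorem VonNeumannAlgebra.commute_of_projections (R : VonNeumannAlgebra H) {T : H →L[ℂ] H}
    (h : ∀ p ∈ R, IsStarProjection p → Commute T p) {x : H →L[ℂ] H} (hx : x ∈ R) :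
    Commute T x := by
  have h01 : ∀ a ∈ R, 0 ≤ a → a ≤ 1 → Commute T a := by
    intro a ha h0 h1
    have key : ∀ n : ℕ, ‖T * a - a * T‖ ≤ (2⁻¹ : ℝ) ^ n * (2 * ‖T‖) := by
      intro n
      obtain ⟨p, hp, b, hb, hb0, hb1, e⟩ := R.exists_dyadic n ha h0 h1
      have hs : Commute T (∑ k ∈ Finset.range n, (2⁻¹ : ℝ) ^ (k + 1) • p k) :=
        Commute.sum_right _ _ _ fun k _ => (h _ (hp k).1 (hp k).2).smul_right _
      have : T * a - a * T = (2⁻¹ : ℝ) ^ n • (T * b - b * T) := by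
        rw [e, mul_add, add_mul, hs.eq, mul_smul_comm, smul_mul_assoc, smul_sub]
        abel
      rw [this, norm_smul, Real.norm_of_nonneg (by positivity)]
      have hbn : ‖b‖ ≤ 1 := (CStarAlgebra.norm_le_one_iff_of_nonneg b hb0).2 hb1
      gcongr
      calc ‖T * b - b * T‖ ≤ ‖T‖ * ‖b‖ + ‖b‖ * ‖T‖ :=
            (norm_sub_le _ _).trans (add_le_add (norm_mul_le _ _) (norm_mul_le _ _))
        _ ≤ ‖T‖ * 1 + 1 * ‖T‖ := by gcongr
        _ = 2 * ‖T‖ := by ring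
    have ht : Tendsto (fun n : ℕ => (2⁻¹ : ℝ) ^ n * (2 * ‖T‖)) atTop (𝓝 (0 * (2 * ‖T‖))) :=
      (tendsto_pow_atTop_nhds_zero_of_lt_one (by norm_num) (by norm_num)).mul_const _
    rw [zero_mul] at ht
    have := ge_of_tendsto' ht key
    exact sub_eq_zero.1 (norm_le_zero_iff.1 this)
  have h0 : ∀ a ∈ R, 0 ≤ a → Commute T a := by
    intro a ha h0
    have hn : (0 : ℝ) < ‖a‖ + 1 := by positivity
    have e : a = (‖a‖ + 1) • ((‖a‖ + 1)⁻¹ • a) := by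
      rw [smul_smul, mul_inv_cancel₀ hn.ne', one_smul]
    rw [e]
    refine Commute.smul_right (h01 _ (R.real_smul_mem _ ha)
      (smul_nonneg (inv_nonneg.2 hn.le) h0) ?_) _
    rw [← CStarAlgebra.norm_le_one_iff_of_nonneg _ (smul_nonneg (inv_nonneg.2 hn.le) h0), norm_smul,
      Real.norm_of_nonneg (inv_nonneg.2 hn.le), inv_mul_le_one₀ hn]
    linarith
  have hsa : ∀ a ∈ R, IsSelfAdjoint a → Commute T a := by
    intro a ha hs
    rw [← CFC.posPart_sub_negPart a hs]
    refine (h0 _ (R.posPart_mem ha) (CFC.posPart_nonneg a)).sub_right (h0 _ ?_ (CFC.negPart_nonneg a))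
    have : a⁻ = a⁺ - a := by rw [eq_sub_iff_add_eq]; nth_rw 2 [← CFC.posPart_sub_negPart a hs]; abel
    rw [this]
    exact sub_mem (R.posPart_mem ha) ha
  have e : x = (2⁻¹ : ℂ) • (x + star x) + (2⁻¹ * Complex.I) • ((-Complex.I) • (x - star x)) := by
    rw [smul_smul]
    have : 2⁻¹ * Complex.I * -Complex.I = (2⁻¹ : ℂ) := by
      rw [mul_neg, mul_assoc, Complex.I_mul_I]; ring
    rw [this]; module
  rw [e]
  refine Commute.add_right (Commute.smul_right (hsa _ (add_mem hx (star_mem hx)) ?_) _)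
    (Commute.smul_right (hsa _ (SMulMemClass.smul_mem _ (sub_mem hx (star_mem hx))) ?_) _)
  · simp [IsSelfAdjoint, add_comm]
  · simp [IsSelfAdjoint, smul_sub, neg_add_eq_sub]

theorem VonNeumannAlgebra.exists_star_mul_self (R : VonNeumannAlgebra H) {a : H →L[ℂ] H}
    (ha : a ∈ R) (h0 : 0 ≤ a) : ∃ s ∈ R, IsSelfAdjoint s ∧ a = s * s := by
  refine ⟨cfc Real.sqrt a, R.cfc_mem ha _, cfc_predicate _ _, ?_⟩
  rw [← cfc_mul Real.sqrt Real.sqrt a]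
  conv_lhs => rw [← cfc_id ℝ a (.of_nonneg h0)]
  exact cfc_congr fun t ht => (Real.mul_self_sqrt (spectrum_nonneg_of_nonneg h0 ht)).symm

/-- A faithful tracial state on a von Neumann algebra, extended to a linear functional
on all bounded operators. -/
structure FTrace (M : VonNeumannAlgebra H) where
  φ : (H →L[ℂ] H) →ₗ[ℂ] ℂ
  φ_one : φ 1 = 1
  nonneg' : ∀ x ∈ M, 0 ≤ φ (star x * x)
  tracial : ∀ x ∈ M, ∀ y ∈ M, φ (x * y) = φ (y * x)
  faithful : ∀ x ∈ M, φ (star x * x) = 0 → x = 0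

namespace FTrace
variable {M : VonNeumannAlgebra H} (τ : FTrace M)

/-- The square of the 2-norm. -/
def n2 (x : H →L[ℂ] H) : ℝ := (τ.φ (star x * x)).re

theorem n2_nonneg {x} (hx : x ∈ M) : 0 ≤ τ.n2 x := (Complex.nonneg_iff.1 (τ.nonneg' x hx)).1

theorem ofReal_n2 {x} (hx : x ∈ M) : (τ.n2 x : ℂ) = τ.φ (star x * x) :=
  (Complex.ext rfl (Complex.nonneg_iff.1 (τ.nonneg' x hx)).2)

theorem eq_zero_of_n2 {x} (hx : x ∈ M) (h : τ.n2 x = 0) : x = 0 :=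
  τ.faithful x hx (by rw [← τ.ofReal_n2 hx, h, Complex.ofReal_zero])

theorem eq_zero_of_n2_le {x} (hx : x ∈ M) (h : τ.n2 x ≤ 0) : x = 0 :=
  τ.eq_zero_of_n2 hx (le_antisymm h (τ.n2_nonneg hx))

@[simp] theorem n2_zero : τ.n2 0 = 0 := by simp [n2]

theorem map_star {x} (hx : x ∈ M) : τ.φ (star x) = starRingEnd ℂ (τ.φ x) := by
  have h0 := (Complex.nonneg_iff.1 (τ.nonneg' x hx)).2
  have h1 := (Complex.nonneg_iff.1 (τ.nonneg' (1 + x) (add_mem (one_mem _) hx))).2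
  have h2 := (Complex.nonneg_iff.1 (τ.nonneg' (1 + Complex.I • x)
    (add_mem (one_mem _) (SMulMemClass.smul_mem _ hx)))).2
  have e1 : star (1 + x) * (1 + x) = 1 + x + star x + star x * x := by
    rw [star_add, star_one]; noncomm_ring
  have e2 : star (1 + Complex.I • x) * (1 + Complex.I • x)
      = 1 + Complex.I • x - Complex.I • star x + star x * x := by
    have e0 : star (1 + Complex.I • x) = 1 - Complex.I • star x := by
      simp [star_add, star_smul, sub_eq_add_neg]
    rw [e0, sub_mul, mul_add, smul_mul_assoc, mul_add, mul_smul_comm Complex.I (star x), smul_add,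
      smul_smul,      Complex.I_mul_I]
    simp only [one_mul, mul_one, neg_smul, one_smul]
    abel
  rw [e1] at h1
  rw [e2] at h2
  simp only [map_add, map_sub, map_smul, τ.φ_one, Complex.add_im, Complex.sub_im, Complex.one_im,
    ← h0, smul_eq_mul, Complex.I_mul_im] at h1 h2
  apply Complex.ext
  · simp; linarith
  · simp; linarith

theorem nonneg {a} (ha : a ∈ M) (h : 0 ≤ a) : 0 ≤ τ.φ a := by
  obtain ⟨s, hs, hsa, rfl⟩ := M.exists_star_mul_self ha h
  simpa [hsa.star_eq] using τ.nonneg' s hs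

theorem re_nonneg {a} (ha : a ∈ M) (h : 0 ≤ a) : 0 ≤ (τ.φ a).re :=
  (Complex.nonneg_iff.1 (τ.nonneg ha h)).1

theorem re_mono {a b} (ha : a ∈ M) (hb : b ∈ M) (h : a ≤ b) : (τ.φ a).re ≤ (τ.φ b).re := by
  have := τ.re_nonneg (sub_mem hb ha) (sub_nonneg.2 h)
  rw [map_sub, Complex.sub_re] at this
  linarith

theorem re_mul_nonneg {a b} (ha : a ∈ M) (hb : b ∈ M) (h : 0 ≤ a) (h' : 0 ≤ b) :
    0 ≤ (τ.φ (a * b)).re := by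
  obtain ⟨s, hs, hsa, rfl⟩ := M.exists_star_mul_self ha h
  rw [mul_assoc, τ.tracial _ hs _ (mul_mem hs hb)]
  exact τ.re_nonneg (mul_mem (mul_mem hs hb) hs) (conj_nonneg_of_isSelfAdjoint h' hsa)

theorem re_mul_mono_right {a b c} (ha : a ∈ M) (hb : b ∈ M) (hc : c ∈ M) (h : 0 ≤ a) (h' : b ≤ c) :
    (τ.φ (a * b)).re ≤ (τ.φ (a * c)).re := by
  have := τ.re_mul_nonneg ha (sub_mem hc hb) h (sub_nonneg.2 h')
  rw [mul_sub, map_sub, Complex.sub_re] at this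
  linarith

theorem re_mul_mono_left {a b c} (ha : a ∈ M) (hb : b ∈ M) (hc : c ∈ M) (h : 0 ≤ a) (h' : b ≤ c) :
    (τ.φ (b * a)).re ≤ (τ.φ (c * a)).re := by
  rw [τ.tracial _ hb _ ha, τ.tracial _ hc _ ha]
  exact τ.re_mul_mono_right ha hb hc h h'

theorem n2_star {x} (hx : x ∈ M) : τ.n2 (star x) = τ.n2 x := by
  rw [n2, n2, star_star, τ.tracial _ hx _ (star_mem hx)]

theorem n2_smul (c : ℂ) (x) : τ.n2 (c • x) = ‖c‖ ^ 2 * τ.n2 x := by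
  have h : star c * c = ((‖c‖ ^ 2 : ℝ) : ℂ) := by
    rw [Complex.star_def, Complex.conj_mul']; norm_cast
  rw [n2, star_smul, smul_mul_smul_comm, map_smul, smul_eq_mul, h, Complex.re_ofReal_mul]; rfl

theorem n2_neg (x) : τ.n2 (-x) = τ.n2 x := by simp [n2]

theorem n2_add_add_n2_sub (x y) : τ.n2 (x + y) + τ.n2 (x - y) = 2 * τ.n2 x + 2 * τ.n2 y := by
  simp only [n2, star_add, star_sub, mul_add, add_mul, mul_sub, sub_mul, map_add, map_sub,
    Complex.add_re, Complex.sub_re]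
  ring

theorem n2_add_le {x y} (hx : x ∈ M) (hy : y ∈ M) :
    τ.n2 (x + y) ≤ 2 * τ.n2 x + 2 * τ.n2 y := by
  have := τ.n2_add_add_n2_sub x y
  have := τ.n2_nonneg (sub_mem hx hy)
  linarith

theorem norm_sq_le {x y} (hx : x ∈ M) (hy : y ∈ M) :
    ‖τ.φ (star x * y)‖ ^ 2 ≤ τ.n2 x * τ.n2 y := by
  rcases eq_or_ne (τ.n2 x) 0 with h | h
  · rw [τ.eq_zero_of_n2 hx h]; simp
  have hp : 0 < τ.n2 x := lt_of_le_of_ne (τ.n2_nonneg hx) h.symm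
  set c := τ.φ (star x * y) with hc
  have hc' : τ.φ (star y * x) = starRingEnd ℂ c := by
    rw [hc, ← τ.map_star (mul_mem (star_mem hx) hy), star_mul, star_star]
  have h0 := τ.n2_nonneg (sub_mem hy (SMulMemClass.smul_mem (c / τ.n2 x) hx))
  have e : τ.n2 (y - (c / τ.n2 x) • x) = τ.n2 y - ‖c‖ ^ 2 / τ.n2 x := by
    rw [n2]
    simp only [star_sub, star_smul, mul_sub, sub_mul, smul_mul_assoc, mul_smul_comm, map_sub,
      map_smul, smul_eq_mul, ← hc, hc', ← τ.ofReal_n2 hx, ← τ.ofReal_n2 hy]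
    have e2 : (‖c‖ ^ 2 : ℝ) = (c * starRingEnd ℂ c) := by
      rw [Complex.mul_conj']; norm_cast
    rw [← Complex.ofReal_re (τ.n2 y - ‖c‖ ^ 2 / τ.n2 x)]
    congr 1
    push_cast
    push_cast at e2
    have hne : (τ.n2 x : ℂ) ≠ 0 := by exact_mod_cast h
    rw [e2, star_div₀]
    simp only [Complex.star_def, Complex.conj_ofReal]
    field_simp
    ring
  rw [e] at h0
  have := sub_nonneg.1 h0
  rw [div_le_iff₀ hp] at this
  linarith

theorem real_smul (c : ℝ) (x) : τ.φ (c • x) = c * τ.φ x := by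
  rw [← smul_eq_mul, ← τ.φ.map_smul]; congr 1

theorem n2_mul_le {a x} (ha : a ∈ M) (hx : x ∈ M) : τ.n2 (a * x) ≤ ‖a‖ ^ 2 * τ.n2 x := by
  have h : star a * a ≤ algebraMap ℝ (H →L[ℂ] H) (‖a‖ ^ 2) := by
    have := IsSelfAdjoint.le_algebraMap_norm_self (a := star a * a) (by simp [IsSelfAdjoint])
    rwa [CStarRing.norm_star_mul_self, ← sq] at this
  have h2 := star_left_conjugate_le_conjugate h x
  have h3 := τ.re_mono (mul_mem (mul_mem (star_mem hx) (mul_mem (star_mem ha) ha)) hx)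
    (by
      rw [Algebra.algebraMap_eq_smul_one]
      exact mul_mem (mul_mem (star_mem hx) (M.real_smul_mem _ (one_mem _))) hx) h2
  rw [Algebra.algebraMap_eq_smul_one, mul_smul_comm, mul_one, smul_mul_assoc] at h3
  rw [τ.real_smul, Complex.re_ofReal_mul] at h3
  rw [n2, n2, star_mul]
  simpa only [mul_assoc] using h3

theorem n2_proj {p} (hp : IsStarProjection p) : τ.n2 p = (τ.φ p).re := by
  rw [n2, hp.star_eq, hp.mul_self]

end FTrace

theorem IsStarProjection.norm_le_one {p : H →L[ℂ] H} (h : IsStarProjection p) : ‖p‖ ≤ 1 :=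
  (CStarAlgebra.norm_le_one_iff_of_nonneg p h.nonneg).2 h.le_one

theorem exists_directed_projection {ι : Type*} [Preorder ι] [IsDirectedOrder ι] [Nonempty ι]
    (R : VonNeumannAlgebra H) (y : ι → H →L[ℂ] H) (hy : ∀ i, IsStarProjection (y i))
    (hR : ∀ i, y i ∈ R) (mono : ∀ i j, i ≤ j → y j * y i = y i) :
    ∃ p ∈ R, IsStarProjection p ∧ (∀ i, p * y i = y i) ∧
      WTends (Ultrafilter.of (atTop : Filter ι) : Filter ι) y p := by
  obtain ⟨p, hp⟩ := exists_wTends (Ultrafilter.of (atTop : Filter ι)) y 1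
    (fun i => (hy i).norm_le_one)
  have h1 : ∀ i, p * y i = y i := fun i => (hp.mul_right (y i)).unique_of_eventually
    (Ultrafilter.of_le _ ((eventually_ge_atTop i).mono fun j hj => mono i j hj))
  refine ⟨p, hp.mem R hR, ⟨?_, ?_⟩, h1, hp⟩
  · exact ((hp.mul_left p).congr' (Eventually.of_forall h1)).unique hp
  · exact (hp.star.congr' (Eventually.of_forall fun i => (hy i).star_eq)).unique hp

theorem exists_mul_partialIsometry (y : H →L[ℂ] H) (hy : y ≠ 0) :
    ∃ h k : H →L[ℂ] H, (∀ R : VonNeumannAlgebra H, star y * y ∈ R → h ∈ R) ∧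
      h = star y * y * k ∧ IsSelfAdjoint h ∧ IsStarProjection (star (y * h) * (y * h)) ∧
      y * h ≠ 0 := by
  set a := star y * y with ha
  have ha0 : 0 ≤ a := star_mul_self_nonneg y
  have hsa : IsSelfAdjoint a := .of_nonneg ha0
  have hne : a ≠ 0 := fun h => hy ((CStarRing.star_mul_self_eq_zero_iff y).1 h)
  set δ := ‖a‖ / 2 with hδ
  have hδ0 : 0 < δ := half_pos (norm_pos_iff.2 hne)
  have hmax : ∀ s : ℝ, max s δ ≠ 0 := fun s => (lt_max_of_lt_right hδ0).ne'
  have hsq : ∀ s : ℝ, √(max s δ) ≠ 0 := fun s =>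
    (Real.sqrt_pos.2 (lt_max_of_lt_right hδ0)).ne'
  have hgc : Continuous fun s : ℝ => (√(max s δ))⁻¹ :=
    Continuous.inv₀ (by fun_prop) hsq
  have hjc : Continuous fun s : ℝ => (max s δ)⁻¹ := Continuous.inv₀ (by fun_prop) hmax
  set g := cfc (fun s : ℝ => (√(max s δ))⁻¹) a with hg
  set j := cfc (fun s : ℝ => (max s δ)⁻¹) a with hj
  set b := cfc (fun s : ℝ => max (s - δ) 0) a with hb
  set r := rangeProj b with hr
  have hrp : IsStarProjection r := isStarProjection_rangeProj b
  have hgg : g * g = j := by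
    rw [hg, hj, ← cfc_mul _ _ a hgc.continuousOn hgc.continuousOn]
    congr 1; ext s
    rw [← mul_inv, Real.mul_self_sqrt (lt_max_of_lt_right hδ0).le]
  have haj : a * j = cfc (fun s : ℝ => s * (max s δ)⁻¹) a := by
    rw [cfc_mul (fun s : ℝ => s) _ a (by fun_prop) hjc.continuousOn, cfc_id' ℝ a]
  have hcomm : ∀ f : ℝ → ℝ, Commute a (cfc f a) := fun f => ((Commute.refl a).cfc_real f).symm
  have hra : Commute a r := rangeProj_commute (hcomm _) (by rw [hsa.star_eq]; exact hcomm _)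
  have hrj : Commute r (cfc (fun s : ℝ => (max s δ)⁻¹) a) := (hra.cfc_real _).symm
  have hrg : Commute r g := (hra.cfc_real _).symm
  have hajr : a * j * r = r := by
    have : (a * j - 1) * r = 0 := by
      apply mul_rangeProj_eq_zero
      have e1 : a * j - 1 = cfc (fun s : ℝ => s * (max s δ)⁻¹ - 1) a := by
        rw [cfc_sub _ _ a (Continuous.continuousOn (by fun_prop)) (by fun_prop),
          cfc_const_one ℝ a, haj]
      rw [e1, hb, ← cfc_mul _ _ a (Continuous.continuousOn (by fun_prop)) (by fun_prop)]
      convert cfc_const_zero ℝ a using 2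
      ext s
      rcases le_total s δ with h | h
      · simp [max_eq_right (sub_nonpos.2 h)]
      · rw [max_eq_left h, mul_inv_cancel₀ (hδ0.trans_le h).ne', sub_self, zero_mul]
    rwa [sub_mul, one_mul, sub_eq_zero] at this
  have hgsa : IsSelfAdjoint g := cfc_predicate _ _
  have hag : Commute a g := hcomm _
  have htt : star (y * (g * r)) * (y * (g * r)) = r := by
    have : star (y * (g * r)) * (y * (g * r)) = r * (g * a * g) * r := by
      simp only [star_mul, hrp.star_eq, hgsa.star_eq, ha, mul_assoc]
    rw [this, ← hag.eq, mul_assoc a, hgg, mul_assoc, hajr, hrp.mul_self]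
  refine ⟨g * r, g * j * r, fun R haR => ?_, ?_, ?_, ?_, ?_⟩
  · exact mul_mem (R.cfc_mem haR _) (R.rangeProj_mem (R.cfc_mem haR _))
  · calc g * r = g * (a * j * r) := by rw [hajr]
      _ = (a * g) * j * r := by rw [hag.eq]; simp only [mul_assoc]
      _ = _ := by simp only [mul_assoc]
  · change star (g * r) = g * r
    rw [star_mul, hrp.star_eq, hgsa.star_eq]; exact hrg.eq
  · rw [htt]; exact hrp
  · intro h0
    rw [h0, mul_zero] at htt
    have hb0 : b = 0 := by
      have := rangeProj_mul_self b
      rw [← hr, ← htt, zero_mul] at this; exact this.symm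
    have hle : a ≤ algebraMap ℝ (H →L[ℂ] H) δ := by
      have e2 : a ≤ b + algebraMap ℝ (H →L[ℂ] H) δ := by
        have e3 : b + algebraMap ℝ (H →L[ℂ] H) δ = cfc (fun s : ℝ => max (s - δ) 0 + δ) a := by
          rw [cfc_add (a := a) _ _ (by fun_prop) (by fun_prop), cfc_const δ a]
        rw [e3]
        conv_lhs => rw [← cfc_id' ℝ a]
        refine cfc_mono (fun s _ => ?_) (by fun_prop) (by fun_prop)
        have := le_max_left (s - δ) 0
        linarith
      rwa [hb0, zero_add] at e2
    have := CStarAlgebra.norm_le_norm_of_nonneg_of_le ha0 hle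
    rw [Algebra.algebraMap_eq_smul_one, norm_smul, Real.norm_of_nonneg hδ0.le] at this
    have h1 : ‖(1 : H →L[ℂ] H)‖ ≤ 1 := IsStarProjection.norm_le_one (.one _)
    nlinarith [norm_pos_iff.2 hne]

theorem IsFactor.exists_mul_mul_ne_zero {M : VonNeumannAlgebra H} (hf : IsFactor (M : Set (H →L[ℂ] H)))
    {e f : H →L[ℂ] H} (he : e ≠ 0) (hfM : f ∈ M) (hfne : f ≠ 0) :
    ∃ x ∈ M, e * x * f ≠ 0 := by
  by_contra! hcon
  set S : Set H := {v | ∃ x ∈ M, ∃ ξ, v = (x * f) ξ} with hS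
  set K := (Submodule.span ℂ S).topologicalClosure with hK
  set z := K.starProjection with hz
  have hzp : IsStarProjection z := isStarProjection_starProjection
  have hmin : ∀ T : H →L[ℂ] H, ∀ N : Submodule ℂ H, IsClosed (N : Set H) →
      (∀ v ∈ S, T v ∈ N) → ∀ v ∈ K, T v ∈ N := by
    intro T N hN h v hv
    have : K ≤ N.comap T.toLinearMap := by
      refine Submodule.topologicalClosure_minimal _ (Submodule.span_le.2 h) ?_
      exact hN.preimage T.continuous
    exact this hv
  have hSK : ∀ v ∈ S, v ∈ K := fun v hv =>
    Submodule.le_topologicalClosure _ (Submodule.subset_span hv)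
  have hKc : IsClosed (K : Set H) := Submodule.isClosed_topologicalClosure _
  have hinv : ∀ T : H →L[ℂ] H, (∀ v ∈ S, T v ∈ S) → (1 - z) * T * z = 0 := by
    intro T hT
    ext ξ
    have h1 : T (z ξ) ∈ K := hmin T K hKc (fun v hv => hSK _ (hT v hv)) _
      (Submodule.starProjection_apply_mem _ ξ)
    change T (z ξ) - z (T (z ξ)) = 0
    rw [hz, Submodule.starProjection_eq_self_iff.2 h1, sub_self]
  have hMS : ∀ T ∈ M, ∀ v ∈ S, T v ∈ S := by
    rintro T hT _ ⟨x, hx, ξ, rfl⟩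
    exact ⟨T * x, mul_mem hT hx, ξ, rfl⟩
  have hM'S : ∀ T ∈ M.commutant, ∀ v ∈ S, T v ∈ S := by
    rintro T hT _ ⟨x, hx, ξ, rfl⟩
    refine ⟨x, hx, T ξ, ?_⟩
    exact DFunLike.congr_fun
      (VonNeumannAlgebra.commute_of_mem_commutant hT (mul_mem hx hfM)).eq ξ
  have hzM : z ∈ M := M.mem_of_commute fun T hT =>
    hzp.commute_of (hinv T (hM'S T hT)) (hinv _ (hM'S _ (star_mem hT)))
  obtain ⟨c, hc⟩ := hf z hzM fun T hT =>
    (hzp.commute_of (hinv T (hMS T hT)) (hinv _ (hMS _ (star_mem hT)))).symm.eq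
  have hez : e * z = 0 := by
    ext ξ
    have := hmin e ⊥ (by simp) (by
      rintro _ ⟨x, hx, ξ, rfl⟩
      have := DFunLike.congr_fun (hcon x hx) ξ
      simpa using this) (z ξ) (Submodule.starProjection_apply_mem _ ξ)
    simpa using this
  have hzf : z * f = f := by
    ext ξ
    exact Submodule.starProjection_eq_self_iff.2 (hSK _ ⟨1, one_mem _, ξ, by simp⟩)
  rw [hc, mul_smul_comm, mul_one] at hez
  rcases smul_eq_zero.1 hez with h | h
  · rw [hc, h, zero_smul, zero_mul] at hzf
    exact hfne hzf.symm
  · exact he h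

theorem IsFactor.exists_partialIsometry {M : VonNeumannAlgebra H}
    (hf : IsFactor (M : Set (H →L[ℂ] H))) {e f : H →L[ℂ] H} (heM : e ∈ M)
    (hep : IsStarProjection e) (he : e ≠ 0) (hfM : f ∈ M) (hfp : IsStarProjection f)
    (hfne : f ≠ 0) : ∃ t ∈ M, t ≠ 0 ∧ IsStarProjection (star t * t) ∧ e * t = t ∧ t * f = t := by
  obtain ⟨x, hx, hne⟩ := hf.exists_mul_mul_ne_zero he hfM hfne
  have hyM : e * x * f ∈ M := mul_mem (mul_mem heM hx) hfM
  obtain ⟨h, k, hhR, hk, hsa, hp, ht⟩ := exists_mul_partialIsometry (e * x * f) hne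
  have hfh : f * h = h := by
    rw [hk]
    simp only [star_mul, ← mul_assoc, hfp.star_eq, hfp.mul_self]
  have hhf : h * f = h := by
    have := congrArg star hfh
    rwa [star_mul, hsa.star_eq, hfp.star_eq] at this
  refine ⟨e * x * f * h, mul_mem hyM (hhR M (mul_mem (star_mem hyM) hyM)), ht, hp, ?_, ?_⟩
  · simp only [← mul_assoc, hep.mul_self]
  · rw [mul_assoc, hhf]

theorem isStarProjection_of_mul_star_mul {v : H →L[ℂ] H} (h : v * star v * v = v) :
    IsStarProjection (star v * v) :=
  ⟨by change star v * v * (star v * v) = _; rw [mul_assoc, ← mul_assoc v, h], by simp [IsSelfAdjoint]⟩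

theorem mul_star_mul_of_isStarProjection {v : H →L[ℂ] H} (h : IsStarProjection (star v * v)) :
    v * star v * v = v := by
  have : star (v - v * star v * v) * (v - v * star v * v) = 0 := by
    have e := h.mul_self
    simp only [star_sub, star_mul, star_star, sub_mul, mul_sub]
    simp only [mul_assoc] at e ⊢
    simp only [e]; simp
  have := (CStarRing.star_mul_self_eq_zero_iff _).1 this
  exact (sub_eq_zero.1 this).symm

theorem star_mul_self_mul_star {v : H →L[ℂ] H} (h : v * star v * v = v) :
    star v * v * star v = star v := by
  have := congrArg star h
  simpa [mul_assoc] using this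

theorem norm_le_one_of_isStarProjection {v : H →L[ℂ] H} (h : IsStarProjection (star v * v)) :
    ‖v‖ ≤ 1 := by
  have h1 := h.norm_le_one
  rw [CStarRing.norm_star_mul_self] at h1
  nlinarith [norm_nonneg v]

theorem IsStarProjection.mul_eq_of_mul_mul_eq {p q : H →L[ℂ] H} (hp : IsStarProjection p)
    (hq : IsStarProjection q) (h : p * q * p = p) : q * p = p := by
  have : star (p - q * p) * (p - q * p) = 0 := by
    simp only [star_sub, star_mul, hp.star_eq, hq.star_eq]
    have e1 : (p - p * q) * (p - q * p) = p * p - p * q * p - p * q * p + p * (q * q) * p := by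
      noncomm_ring
    rw [e1, hq.mul_self, h, hp.mul_self]; abel
  exact (sub_eq_zero.1 ((CStarRing.star_mul_self_eq_zero_iff _).1 this)).symm

theorem star_mul_mul_star_mul_of_extends {u v : H →L[ℂ] H} (hu : u * star u * u = u)
    (hv : v * star v * v = v) (huv : v * (star u * u) = u) :
    star v * v * (star u * u) = star u * u := by
  have hp := isStarProjection_of_mul_star_mul hu
  refine hp.mul_eq_of_mul_mul_eq (isStarProjection_of_mul_star_mul hv) ?_
  have h1 := congrArg star huv
  rw [star_mul, hp.star_eq] at h1
  rw [← mul_assoc (star u * u), h1, mul_assoc, huv]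

theorem exists_ultrafilter_of_directed {ι : Type*} [Nonempty ι] (r : ι → ι → Prop)
    (hrefl : ∀ i, r i i) (htrans : ∀ {i j k}, r i j → r j k → r i k)
    (hdir : ∀ i j, ∃ k, r i k ∧ r j k) : ∃ l : Ultrafilter ι, ∀ i, ∀ᶠ j in (l : Filter ι), r i j := by
  let pre : Preorder ι := { le := r, le_refl := hrefl, le_trans := fun _ _ _ => htrans }
  have hd : IsDirectedOrder ι := ⟨hdir⟩
  exact ⟨Ultrafilter.of atTop, fun i => Ultrafilter.of_le _ (eventually_ge_atTop i)⟩

/-- Comparison of projections in a factor. -/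
theorem IsFactor.exists_comparison {M : VonNeumannAlgebra H}
    (hf : IsFactor (M : Set (H →L[ℂ] H))) {e f : H →L[ℂ] H} (heM : e ∈ M)
    (hep : IsStarProjection e) (hfM : f ∈ M) (hfp : IsStarProjection f) :
    ∃ v ∈ M, v * star v * v = v ∧ e * v = v ∧ v * f = v ∧ (star v * v = f ∨ v * star v = e) := by
  let α := {v : H →L[ℂ] H // v ∈ M ∧ v * star v * v = v ∧ e * v = v ∧ v * f = v}
  let r : α → α → Prop := fun v w => w.1 * (star v.1 * v.1) = v.1
  have hrefl : ∀ v, r v v := fun v => by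
    change _ = _
    rw [← mul_assoc]; exact v.2.2.1
  have htrans : ∀ {u v w}, r u v → r v w → r u w := fun {u v w} huv hvw => by
    have e2 := star_mul_mul_star_mul_of_extends u.2.2.1 v.2.2.1 huv
    change _ = _ at hvw huv ⊢
    rw [← e2, ← mul_assoc, hvw, huv]
  obtain ⟨v, hv⟩ := exists_maximal_of_chains_bounded (r := r) (by
    intro c hc
    rcases c.eq_empty_or_nonempty with rfl | hcne
    · exact ⟨⟨0, zero_mem _, by simp, by simp, by simp⟩, by simp⟩
    have hne : Nonempty c := hcne.to_subtype
    obtain ⟨l, hev⟩ := exists_ultrafilter_of_directed (ι := c) (fun v w => r v.1 w.1)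
      (fun _ => hrefl _) htrans (fun v w => by
        by_cases h : v.1 = w.1
        · exact ⟨w, by rw [h]; exact hrefl _, hrefl _⟩
        · rcases hc v.2 w.2 h with h | h
          · exact ⟨w, h, hrefl _⟩
          · exact ⟨v, hrefl _, h⟩)
    obtain ⟨w, hw⟩ := exists_wTends l (fun i : c => i.1.1) 1
      (fun i => norm_le_one_of_isStarProjection (isStarProjection_of_mul_star_mul i.1.2.2.1))
    have h1 : ∀ i : c, w * (star i.1.1 * i.1.1) = i.1.1 := fun i =>
      (hw.mul_right _).unique_of_eventually ((hev i).mono fun j hj => hj)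
    have h2 : ∀ i : c, star i.1.1 * w = star i.1.1 * i.1.1 := fun i =>
      (hw.mul_left _).unique_of_eventually ((hev i).mono fun j hj => by
        have hp := isStarProjection_of_mul_star_mul i.1.2.2.1
        have e2 := star_mul_mul_star_mul_of_extends i.1.2.2.1 j.1.2.2.1 hj
        have e3 := congrArg star e2
        rw [star_mul, hp.star_eq, (isStarProjection_of_mul_star_mul j.1.2.2.1).star_eq] at e3
        have e4 := congrArg star hj
        rw [star_mul, hp.star_eq] at e4
        rw [← e4, mul_assoc, e3, e4])
    have h3 : w * star w * w = w := by
      rw [mul_assoc]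
      refine (((hw.star.mul_right w).mul_left w).congr' (Eventually.of_forall fun i => ?_)).unique hw
      rw [h2, h1]
    refine ⟨⟨w, hw.mem M fun i => i.1.2.1, h3, ?_, ?_⟩, fun a ha => h1 ⟨a, ha⟩⟩
    · exact ((hw.mul_left e).congr' (Eventually.of_forall fun i => i.1.2.2.2.1)).unique hw
    · exact ((hw.mul_right f).congr' (Eventually.of_forall fun i => i.1.2.2.2.2)).unique hw)
    htrans
  obtain ⟨v, hvM, hvv, hev, hvf⟩ := v
  refine ⟨v, hvM, hvv, hev, hvf, ?_⟩
  by_contra! hcon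
  have hvs := isStarProjection_of_mul_star_mul hvv
  have hvs' : IsStarProjection (v * star v) := by
    simpa using isStarProjection_of_mul_star_mul (v := star v)
      (by simpa using star_mul_self_mul_star hvv)
  have hse : star v * e = star v := by simpa [hep.star_eq] using congrArg star hev
  have hfs : f * star v = star v := by simpa [hfp.star_eq] using congrArg star hvf
  have hss := star_mul_self_mul_star hvv
  have he' : IsStarProjection (e - v * star v) := by
    refine ⟨?_, hep.isSelfAdjoint.sub hvs'.isSelfAdjoint⟩
    change _ * _ = _
    rw [sub_mul, mul_sub, mul_sub, hep.mul_self, hvs'.mul_self, ← mul_assoc, hev, mul_assoc, hse]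
    abel
  have hf' : IsStarProjection (f - star v * v) := by
    refine ⟨?_, hfp.isSelfAdjoint.sub hvs.isSelfAdjoint⟩
    change _ * _ = _
    rw [sub_mul, mul_sub, mul_sub, hfp.mul_self, hvs.mul_self, ← mul_assoc, hfs, mul_assoc, hvf]
    abel
  obtain ⟨t, htM, htne, htp, het, htf⟩ := hf.exists_partialIsometry
    (sub_mem heM (mul_mem hvM (star_mem hvM))) he' (sub_ne_zero.2 hcon.2.symm)
    (sub_mem hfM (mul_mem (star_mem hvM) hvM)) hf' (sub_ne_zero.2 hcon.1.symm)
  have ht3 := mul_star_mul_of_isStarProjection htp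
  have k1 : star v * t = 0 := by
    rw [← het, ← mul_assoc, mul_sub, hse, ← mul_assoc, hss, sub_self, zero_mul]
  have k2 : star t * v = 0 := by simpa using congrArg star k1
  have k3 : v * star t = 0 := by
    have : (f - star v * v) * star t = star t := by simpa [hf'.star_eq] using congrArg star htf
    rw [← this, ← mul_assoc, mul_sub, hvf, ← mul_assoc, hvv, sub_self, zero_mul]
  have k4 : t * star v = 0 := by simpa using congrArg star k3
  have hsum : star (v + t) * (v + t) = star v * v + star t * t := by
    rw [star_add, add_mul, mul_add, mul_add, k1, k2]; abel
  have hvt : (v + t) * star (v + t) * (v + t) = v + t := by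
    rw [mul_assoc, hsum, add_mul, mul_add, mul_add, ← mul_assoc, hvv, ← mul_assoc, ← mul_assoc,
      ← mul_assoc, k3, k4, ht3]
    simp
  have het' : e * t = t := by
    rw [← het, ← mul_assoc, mul_sub, hep.mul_self, ← mul_assoc, hev]
  have htf' : t * f = t := by
    rw [← htf, mul_assoc, sub_mul, hfp.mul_self, mul_assoc, hvf]
  have := hv ⟨v + t, add_mem hvM htM, hvt, by rw [mul_add, hev, het'], by rw [add_mul, hvf, htf']⟩
    (by
      change (v + t) * (star v * v) = v
      rw [add_mul, ← mul_assoc, hvv, ← mul_assoc, k4]; simp)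
  change v * (star (v + t) * (v + t)) = v + t at this
  rw [hsum, mul_add, ← mul_assoc, hvv, ← mul_assoc, k3, zero_mul] at this
  exact htne (add_left_cancel this).symm

theorem re_inner_nonneg_of_nonneg {a : H →L[ℂ] H} (h : 0 ≤ a) (ξ : H) :
    0 ≤ (inner ℂ (a ξ) ξ).re :=
  ((ContinuousLinearMap.nonneg_iff_isPositive a).1 h).re_inner_nonneg_left ξ

theorem re_inner_star_mul_self (y : H →L[ℂ] H) (ξ : H) :
    (inner ℂ ((star y * y) ξ) ξ).re = ‖y ξ‖ ^ 2 := by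
  have : inner ℂ ((star y * y) ξ) ξ = inner ℂ (y ξ) (y ξ) := by
    change inner ℂ ((ContinuousLinearMap.adjoint y) (y ξ)) ξ = _
    rw [ContinuousLinearMap.adjoint_inner_left]
  rw [this, inner_self_eq_norm_sq_to_K]
  norm_cast

theorem real_inner_smul_left_complex (c : ℝ) (ξ η : H) :
    inner ℂ (c • ξ) η = (c : ℂ) * inner ℂ ξ η := by
  rw [RCLike.real_smul_eq_coe_smul (K := ℂ) c ξ, inner_smul_left]
  simp

theorem IsStarProjection.add_of_mul_eq_zero {p q : H →L[ℂ] H} (hp : IsStarProjection p)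
    (hq : IsStarProjection q) (h : p * q = 0) : IsStarProjection (p + q) := by
  have h' : q * p = 0 := by simpa [hp.star_eq, hq.star_eq] using congrArg star h
  refine ⟨?_, hp.isSelfAdjoint.add hq.isSelfAdjoint⟩
  change _ * _ = _
  rw [add_mul, mul_add, mul_add, hp.mul_self, hq.mul_self, h, h']; abel

/-- A projection scaled to lie below `a` is supported where `a` is. -/
theorem IsStarProjection.mul_eq_of_smul_le {p e a : H →L[ℂ] H} (hp : IsStarProjection p)
    (he : IsStarProjection e) {c : ℝ} (hc : 0 < c) (h : c • p ≤ a) (ha : a * e = a) :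
    p * e = p := by
  have he1 := he.one_sub
  have h1 := star_left_conjugate_le_conjugate h (1 - e)
  have hz : a * (1 - e) = 0 := by rw [mul_sub, mul_one, ha, sub_self]
  rw [he1.star_eq, mul_assoc _ a, hz, mul_zero, mul_smul_comm, smul_mul_assoc] at h1
  have h2 : (1 - e) * p * (1 - e) ≤ 0 := by
    have := smul_le_smul_of_nonneg_left h1 (inv_nonneg.2 hc.le)
    rwa [smul_smul, inv_mul_cancel₀ hc.ne', one_smul, smul_zero] at this
  have h3 : (1 - e) * p * (1 - e) = star (p * (1 - e)) * (p * (1 - e)) := by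
    rw [star_mul, hp.star_eq, he1.star_eq, mul_assoc, mul_assoc, ← mul_assoc p p, hp.mul_self]
  rw [h3] at h2
  have h4 := (CStarRing.star_mul_self_eq_zero_iff _).1 (le_antisymm h2 (star_mul_self_nonneg _))
  rw [mul_sub, mul_one, sub_eq_zero] at h4
  exact h4.symm

namespace FTrace
variable {M : VonNeumannAlgebra H} (τ : FTrace M)

theorem nontrivial (τ : FTrace M) : Nontrivial H := by
  by_contra h
  rw [not_nontrivial_iff_subsingleton] at h
  have h1 := τ.φ_one
  have : (1 : H →L[ℂ] H) = 0 := by ext ξ; exact Subsingleton.elim _ _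
  rw [this, map_zero] at h1
  exact zero_ne_one h1

theorem re_pos {p} (hp : p ∈ M) (hpp : IsStarProjection p) (hne : p ≠ 0) : 0 < (τ.φ p).re := by
  rw [← τ.n2_proj hpp]
  exact lt_of_le_of_ne (τ.n2_nonneg hp) fun h => hne (τ.eq_zero_of_n2 hp h.symm)

theorem exists_local_bound : ∃ e ∈ M, IsStarProjection e ∧ e ≠ 0 ∧ ∃ ξ : H,
    ∀ g ∈ M, IsStarProjection g → g * e = g → (τ.φ g).re ≤ 2 * (inner ℂ (g ξ) ξ).re := by
  have := τ.nontrivial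
  obtain ⟨ξ, hξ⟩ := exists_norm_eq H zero_le_one
  let α := {p : H →L[ℂ] H // p ∈ M ∧ IsStarProjection p ∧ 2 * (inner ℂ (p ξ) ξ).re ≤ (τ.φ p).re}
  let r : α → α → Prop := fun p q => q.1 * p.1 = p.1
  have hrefl : ∀ p, r p p := fun p => p.2.2.1.mul_self
  have htrans : ∀ {p q s}, r p q → r q s → r p s := fun {p q s} h h' => by
    change _ = _ at h h' ⊢
    rw [← h, ← mul_assoc, h']
  obtain ⟨f, hmax⟩ := exists_maximal_of_chains_bounded (r := r) (by
    intro c hc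
    rcases c.eq_empty_or_nonempty with rfl | hcne
    · exact ⟨⟨0, zero_mem _, .zero _, by simp⟩, by simp⟩
    have hne : Nonempty c := hcne.to_subtype
    obtain ⟨l, hev⟩ := exists_ultrafilter_of_directed (ι := c) (fun v w => r v.1 w.1)
      (fun _ => hrefl _) htrans (fun v w => by
        by_cases h : v.1 = w.1
        · exact ⟨w, by rw [h]; exact hrefl _, hrefl _⟩
        · rcases hc v.2 w.2 h with h | h
          · exact ⟨w, h, hrefl _⟩
          · exact ⟨v, hrefl _, h⟩)
    obtain ⟨p, hp⟩ := exists_wTends l (fun i : c => i.1.1) 1 (fun i => i.1.2.2.1.norm_le_one)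
    have h1 : ∀ i : c, p * i.1.1 = i.1.1 := fun i =>
      (hp.mul_right _).unique_of_eventually ((hev i).mono fun j hj => hj)
    have hpM : p ∈ M := hp.mem M fun i => i.1.2.1
    have hpp : IsStarProjection p := by
      refine ⟨((hp.mul_left p).congr' (Eventually.of_forall h1)).unique hp, ?_⟩
      exact (hp.star.congr' (Eventually.of_forall fun i => i.1.2.2.1.star_eq)).unique hp
    refine ⟨⟨p, hpM, hpp, ?_⟩, fun a ha => h1 ⟨a, ha⟩⟩
    have ht : Tendsto (fun i : c => 2 * (inner ℂ (i.1.1 ξ) ξ).re) l (𝓝 (2 * (inner ℂ (p ξ) ξ).re)) :=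
      ((Complex.continuous_re.tendsto _).comp (hp ξ ξ)).const_mul 2
    refine le_of_tendsto' ht fun i => i.1.2.2.2.trans (τ.re_mono i.1.2.1 hpM ?_)
    exact (i.1.2.2.1.le_iff_mul_eq_right hpp).2 (h1 i))
    htrans
  obtain ⟨f, hfM, hfp, hf⟩ := f
  refine ⟨1 - f, sub_mem (one_mem _) hfM, hfp.one_sub, ?_, ξ, ?_⟩
  · intro h
    rw [← sub_eq_zero.1 h, τ.φ_one] at hf
    simp [hξ] at hf
  · intro g hgM hgp hge
    by_contra! hlt
    have hgf : g * f = 0 := by simpa [mul_sub] using hge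
    have hfg : f * g = 0 := by simpa [hgp.star_eq, hfp.star_eq] using congrArg star hgf
    have := hmax ⟨f + g, add_mem hfM hgM, hfp.add_of_mul_eq_zero hgp hfg, by
      rw [map_add, Complex.add_re, _root_.add_apply, inner_add_left, Complex.add_re]
      linarith⟩ (by
        change (f + g) * f = f
        rw [add_mul, hfp.mul_self, hgf, add_zero])
    change f * (f + g) = f + g at this
    rw [mul_add, hfp.mul_self, hfg] at this
    have hg0 : g = 0 := (add_left_cancel this).symm
    rw [hg0] at hlt
    simp at hlt

theorem exists_local_dominated : ∃ e ∈ M, IsStarProjection e ∧ e ≠ 0 ∧ ∃ ξ : H,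
    ∀ y ∈ M, τ.n2 (y * e) ≤ ‖y ξ‖ ^ 2 := by
  obtain ⟨e, heM, hep, hne, ξ, hξ⟩ := τ.exists_local_bound
  have key : ∀ a ∈ M, 0 ≤ a → a ≤ 1 → a * e = a → (τ.φ a).re ≤ 2 * (inner ℂ (a ξ) ξ).re := by
    intro a ha h0 h1 hae
    have hn : ∀ n : ℕ, (τ.φ a).re ≤ 2 * (inner ℂ (a ξ) ξ).re + (2⁻¹ : ℝ) ^ n * 1 := by
      intro n
      obtain ⟨p, hp, b, hb, hb0, hb1, eq⟩ := M.exists_dyadic n ha h0 h1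
      have hbp : 0 ≤ (2⁻¹ : ℝ) ^ n • b := smul_nonneg (by positivity) hb0
      have hpe : ∀ k ∈ Finset.range n, p k * e = p k := by
        intro k hk
        refine (hp k).2.mul_eq_of_smul_le hep (c := (2⁻¹ : ℝ) ^ (k + 1)) (by positivity) ?_ hae
        rw [eq]
        refine (Finset.single_le_sum (f := fun k => (2⁻¹ : ℝ) ^ (k + 1) • p k)
          (fun i _ => smul_nonneg (by positivity) (hp i).2.nonneg) hk).trans ?_
        exact le_add_of_nonneg_right hbp
      have h2 : (τ.φ ((2⁻¹ : ℝ) ^ n • b)).re ≤ (2⁻¹ : ℝ) ^ n * 1 := by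
        rw [τ.real_smul, Complex.re_ofReal_mul]
        refine mul_le_mul_of_nonneg_left ?_ (by positivity)
        have := τ.re_mono hb (one_mem _) hb1
        rwa [τ.φ_one] at this
      have h3 : (τ.φ (∑ k ∈ Finset.range n, (2⁻¹ : ℝ) ^ (k + 1) • p k)).re
          ≤ 2 * (inner ℂ ((∑ k ∈ Finset.range n, (2⁻¹ : ℝ) ^ (k + 1) • p k) ξ) ξ).re := by
        rw [map_sum, Complex.re_sum, _root_.sum_apply, sum_inner, Complex.re_sum,
          Finset.mul_sum]
        refine Finset.sum_le_sum fun k hk => ?_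
        rw [τ.real_smul, Complex.re_ofReal_mul, _root_.smul_apply,
          real_inner_smul_left_complex, Complex.re_ofReal_mul]
        have := hξ (p k) (hp k).1 (hp k).2 (hpe k hk)
        have h5 : (0 : ℝ) ≤ 2⁻¹ ^ (k + 1) := by positivity
        nlinarith
      have h4 := re_inner_nonneg_of_nonneg hbp ξ
      rw [eq, map_add, Complex.add_re, _root_.add_apply, inner_add_left,
        Complex.add_re]
      linarith
    have ht : Tendsto (fun n : ℕ => 2 * (inner ℂ (a ξ) ξ).re + (2⁻¹ : ℝ) ^ n * 1) atTop
        (𝓝 (2 * (inner ℂ (a ξ) ξ).re + 0 * 1)) :=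
      ((tendsto_pow_atTop_nhds_zero_of_lt_one (by norm_num) (by norm_num)).mul_const _).const_add _
    have := ge_of_tendsto' ht hn
    simpa using this
  refine ⟨e, heM, hep, hne, ((√2 : ℝ) : ℂ) • e ξ, fun y hy => ?_⟩
  set a := star (y * e) * (y * e) with ha
  have hyM : y * e ∈ M := mul_mem hy heM
  have haM : a ∈ M := mul_mem (star_mem hyM) hyM
  have hae : a * e = a := by rw [ha, mul_assoc, mul_assoc, hep.mul_self]
  have h0 : 0 ≤ a := star_mul_self_nonneg _
  have hn : (0 : ℝ) < ‖a‖ + 1 := by positivity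
  have hc : (0 : ℝ) ≤ (‖a‖ + 1)⁻¹ := inv_nonneg.2 hn.le
  have h1 := key ((‖a‖ + 1)⁻¹ • a) (M.real_smul_mem _ haM) (smul_nonneg hc h0) (by
    rw [← CStarAlgebra.norm_le_one_iff_of_nonneg _ (smul_nonneg hc h0), norm_smul,
      Real.norm_of_nonneg hc, inv_mul_le_one₀ hn]
    linarith) (by rw [smul_mul_assoc, hae])
  rw [τ.real_smul, Complex.re_ofReal_mul, _root_.smul_apply,
    real_inner_smul_left_complex, Complex.re_ofReal_mul, ha, re_inner_star_mul_self] at h1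
  have h2 : τ.n2 (y * e) ≤ 2 * ‖(y * e) ξ‖ ^ 2 := by
    have : (‖a‖ + 1)⁻¹ * τ.n2 (y * e) ≤ (‖a‖ + 1)⁻¹ * (2 * ‖(y * e) ξ‖ ^ 2) := by
      rw [n2, ← ha]; linarith
    exact le_of_mul_le_mul_left this (inv_pos.2 hn)
  refine h2.trans_eq ?_
  rw [map_smul, norm_smul, mul_pow]
  simp

end FTrace

namespace FTrace
variable {M : VonNeumannAlgebra H} (τ : FTrace M)

/-- The elements `x` of `M` such that `y ↦ ‖y x‖₂²` is dominated by finitely many vector states. -/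
def Dominated (x : H →L[ℂ] H) : Prop :=
  x ∈ M ∧ ∃ L : List H, ∀ y ∈ M, τ.n2 (y * x) ≤ (L.map fun ξ => ‖y ξ‖ ^ 2).sum

variable {τ}

theorem Dominated.mul_left {x m} (h : τ.Dominated x) (hm : m ∈ M) : τ.Dominated (m * x) := by
  obtain ⟨hx, L, hL⟩ := h
  refine ⟨mul_mem hm hx, L.map m, fun y hy => ?_⟩
  have := hL (y * m) (mul_mem hy hm)
  rw [mul_assoc] at this
  simpa [List.map_map, Function.comp_def] using this

theorem sum_map_smul (c : ℝ) (L : List H) (y : H →L[ℂ] H) :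
    ((L.map fun ξ => c • ξ).map fun ξ => ‖y ξ‖ ^ 2).sum
      = c ^ 2 * (L.map fun ξ => ‖y ξ‖ ^ 2).sum := by
  rw [List.map_map, ← List.sum_map_mul_left]
  congr 1
  refine List.map_congr_left fun ξ _ => ?_
  have : y (c • ξ) = c • y ξ := ContinuousLinearMap.map_smul_of_tower y c ξ
  simp [this, norm_smul, mul_pow]

theorem Dominated.mul_right {x m} (h : τ.Dominated x) (hm : m ∈ M) : τ.Dominated (x * m) := by
  obtain ⟨hx, L, hL⟩ := h
  refine ⟨mul_mem hx hm, L.map fun ξ => ‖m‖ • ξ, fun y hy => ?_⟩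
  rw [sum_map_smul]
  have hyx := mul_mem hy hx
  have h1 : τ.n2 (y * (x * m)) ≤ ‖m‖ ^ 2 * τ.n2 (y * x) := by
    rw [← mul_assoc, ← τ.n2_star (mul_mem hyx hm), star_mul, ← τ.n2_star hyx, ← norm_star m]
    exact τ.n2_mul_le (star_mem hm) (star_mem hyx)
  exact h1.trans (mul_le_mul_of_nonneg_left (hL y hy) (sq_nonneg _))

theorem Dominated.add {x x'} (h : τ.Dominated x) (h' : τ.Dominated x') : τ.Dominated (x + x') := by
  obtain ⟨hx, L, hL⟩ := h
  obtain ⟨hx', L', hL'⟩ := h'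
  refine ⟨add_mem hx hx', (L.map fun ξ => √2 • ξ) ++ (L'.map fun ξ => √2 • ξ), fun y hy => ?_⟩
  rw [List.map_append, List.sum_append, sum_map_smul, sum_map_smul, Real.sq_sqrt zero_le_two,
    mul_add]
  have := τ.n2_add_le (mul_mem hy hx) (mul_mem hy hx')
  have := hL y hy
  have := hL' y hy
  linarith

theorem dominated_one (τ : FTrace M) (hf : IsFactor (M : Set (H →L[ℂ] H))) : τ.Dominated 1 := by
  obtain ⟨e, heM, hep, hne, ξ, hξ⟩ := τ.exists_local_dominated
  have heJ : τ.Dominated e := ⟨heM, [ξ], fun y hy => by simpa using hξ y hy⟩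
  by_contra hcon
  have hpos := τ.re_pos heM hep hne
  have key : ∀ k : ℕ, ∃ p, τ.Dominated p ∧ IsStarProjection p ∧ (τ.φ p).re = k * (τ.φ e).re := by
    intro k
    induction k with
    | zero => exact ⟨0, by simpa using heJ.mul_left (zero_mem M), .zero _, by simp⟩
    | succ k ih =>
      obtain ⟨p, hpJ, hpp, hp⟩ := ih
      obtain ⟨v, hvM, hvv, hev, hvf, h⟩ := hf.exists_comparison heM hep
        (sub_mem (one_mem M) hpJ.1) hpp.one_sub
      have hvJ : τ.Dominated (star v * v) := by
        rw [← hev, ← mul_assoc]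
        refine (Dominated.mul_left heJ (star_mem ?_)).mul_right hvM
        rw [hev]; exact hvM
      rcases h with h | h
      · refine absurd ?_ hcon
        rw [h] at hvJ
        simpa using hpJ.add hvJ
      · refine ⟨p + star v * v, hpJ.add hvJ, hpp.add_of_mul_eq_zero
          (isStarProjection_of_mul_star_mul hvv) ?_, ?_⟩
        · have hvp : v * p = 0 := by simpa [mul_sub] using hvf
          have hpv : p * star v = 0 := by simpa [hpp.star_eq] using congrArg star hvp
          rw [← mul_assoc, hpv, zero_mul]
        · rw [map_add, Complex.add_re, hp, τ.tracial _ (star_mem hvM) _ hvM, h]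
          push_cast; ring
  obtain ⟨k, hk⟩ := exists_nat_gt (1 / (τ.φ e).re)
  obtain ⟨p, hpJ, hpp, hp⟩ := key k
  have := τ.re_mono hpJ.1 (one_mem _) hpp.le_one
  rw [hp, τ.φ_one, Complex.one_re] at this
  rw [div_lt_iff₀ hpos] at hk
  linarith

variable (τ)

/-- A tracial state on a factor is normal. -/
theorem tendsto_mul (hf : IsFactor (M : Set (H →L[ℂ] H))) {ι : Type*} {l : Filter ι}
    {y : ι → H →L[ℂ] H} {z m : H →L[ℂ] H} (h : WTends l y z) (hy : ∀ i, y i ∈ M) (hz : z ∈ M)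
    (hm : m ∈ M) : Tendsto (fun i => τ.φ (m * y i)) l (𝓝 (τ.φ (m * z))) := by
  obtain ⟨-, L, hL⟩ := τ.dominated_one hf
  let W : Submodule ℂ (H →L[ℂ] H) :=
    { carrier := M, zero_mem' := zero_mem M, add_mem' := add_mem,
      smul_mem' := fun c _ hx => SMulMemClass.smul_mem c hx }
  let T0 : (H →L[ℂ] H) →ₗ[ℂ] PiLp 2 (fun _ : Fin L.length => H) :=
    { toFun := fun y => WithLp.toLp 2 fun i => y (L.get i)
      map_add' := fun _ _ => rfl
      map_smul' := fun _ _ => rfl }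
  let T := T0.comp W.subtype
  have hT : ∀ y : W, τ.n2 y.1 ≤ ‖T y‖ ^ 2 := by
    intro y
    have := hL y.1 y.2
    rw [mul_one] at this
    refine this.trans_eq ?_
    rw [PiLp.norm_sq_eq_of_L2]
    change _ = ∑ i : Fin L.length, ‖y.1 (L.get i)‖ ^ 2
    simp only [List.get_eq_getElem, Fin.sum_univ_fun_getElem L (fun ξ => ‖y.1 ξ‖ ^ 2)]
  have hinj : Function.Injective T := by
    rw [injective_iff_map_eq_zero]
    intro y hy
    have := hT y
    rw [hy, norm_zero] at this
    exact Subtype.ext (τ.eq_zero_of_n2_le y.2 (by simpa using this))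
  let F0 : LinearMap.range T →ₗ[ℂ] ℂ :=
    ((τ.φ ∘ₗ LinearMap.mulLeft ℂ m) ∘ₗ W.subtype) ∘ₗ (LinearEquiv.ofInjective T hinj).symm.toLinearMap
  have hF0 : ∀ y : W, F0 ⟨T y, LinearMap.mem_range_self _ y⟩ = τ.φ (m * y.1) := by
    intro y
    have : (LinearEquiv.ofInjective T hinj).symm ⟨T y, LinearMap.mem_range_self _ y⟩ = y := by
      rw [LinearEquiv.symm_apply_eq]; rfl
    simp only [F0, LinearMap.comp_apply, LinearEquiv.coe_coe, this]
    rfl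
  let F : LinearMap.range T →L[ℂ] ℂ := F0.mkContinuous √(τ.n2 m) (by
    rintro ⟨_, y, rfl⟩
    rw [hF0]
    have h1 := τ.norm_sq_le (star_mem hm) y.2
    rw [star_star, τ.n2_star hm] at h1
    have h2 := hT y
    apply le_of_sq_le_sq _ (by positivity)
    rw [mul_pow, Real.sq_sqrt (τ.n2_nonneg hm)]
    exact h1.trans (mul_le_mul_of_nonneg_left h2 (τ.n2_nonneg hm)))
  obtain ⟨G, hG, -⟩ := exists_extension_norm_eq (LinearMap.range T) F
  obtain ⟨η, hη⟩ := (InnerProductSpace.toDual ℂ (PiLp 2 (fun _ : Fin L.length => H))).surjective G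
  have key : ∀ y ∈ M, τ.φ (m * y) = ∑ i, inner ℂ (η i) (y (L.get i)) := by
    intro y hy
    rw [← hF0 ⟨y, hy⟩]
    have h1 := hG ⟨T ⟨y, hy⟩, LinearMap.mem_range_self _ _⟩
    change _ = F0 _ at h1
    rw [← h1, ← hη, InnerProductSpace.toDual_apply_apply, PiLp.inner_apply]
    rfl
  rw [key z hz]
  simp only [fun i => key (y i) (hy i)]
  refine tendsto_finsetSum _ fun i _ => ?_
  have := (Complex.continuous_conj.tendsto _).comp (h (L.get i) (η i))
  simpa [Function.comp_def, inner_conj_symm] using this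

theorem tendsto (hf : IsFactor (M : Set (H →L[ℂ] H))) {ι : Type*} {l : Filter ι}
    {y : ι → H →L[ℂ] H} {z : H →L[ℂ] H} (h : WTends l y z) (hy : ∀ i, y i ∈ M) (hz : z ∈ M) :
    Tendsto (fun i => τ.φ (y i)) l (𝓝 (τ.φ z)) := by
  simpa using τ.tendsto_mul hf h hy hz (one_mem M)

end FTrace

/-- The von Neumann algebra `A` is commutative. -/
class IsCommVN (A : VonNeumannAlgebra H) : Prop where
  comm : ∀ x ∈ A, ∀ y ∈ A, x * y = y * x

section Pr
variable (A : VonNeumannAlgebra H) [hA : IsCommVN A]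

instance : CommRing A :=
  { SubringClass.toRing A with mul_comm := fun x y => Subtype.ext (hA.comm _ x.2 _ y.2) }

/-- The Boolean algebra of projections of a commutative von Neumann algebra. -/
def Pr := {a : A // IsIdempotentElem a}

instance : BooleanAlgebra (Pr A) :=
  inferInstanceAs (BooleanAlgebra {a : A // IsIdempotentElem a})

namespace Pr
variable {A}

/-- The underlying operator of a projection. -/
def op (p : Pr A) : H →L[ℂ] H := p.1.1

theorem op_injective : Function.Injective (op : Pr A → H →L[ℂ] H) :=
  fun _ _ h => Subtype.ext (Subtype.ext h)

theorem mem (p : Pr A) : p.op ∈ A := p.1.2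

theorem comm (p : Pr A) {a} (ha : a ∈ A) : p.op * a = a * p.op := hA.comm _ p.mem _ ha

theorem isStarProjection (p : Pr A) : IsStarProjection p.op :=
  isStarProjection_iff_isIdempotentElem_and_isStarNormal.2
    ⟨congrArg Subtype.val p.2, ⟨hA.comm _ (star_mem p.mem) _ p.mem⟩⟩

/-- The projection with a given underlying operator. -/
def of {a : H →L[ℂ] H} (ha : a ∈ A) (hp : IsStarProjection a) : Pr A :=
  ⟨⟨a, ha⟩, Subtype.ext hp.mul_self⟩

@[simp] theorem op_of {a : H →L[ℂ] H} (ha : a ∈ A) (hp : IsStarProjection a) :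
    (of ha hp).op = a := rfl

theorem op_inf (p q : Pr A) : (p ⊓ q).op = p.op * q.op := rfl

theorem op_compl (p : Pr A) : pᶜ.op = 1 - p.op := rfl

@[simp] theorem op_top : (⊤ : Pr A).op = 1 := rfl

@[simp] theorem op_bot : (⊥ : Pr A).op = 0 := rfl

theorem op_sup (p q : Pr A) : (p ⊔ q).op = p.op + q.op - p.op * q.op := rfl

theorem le_iff {p q : Pr A} : p ≤ q ↔ p.op * q.op = p.op := by
  rw [← inf_eq_left, ← op_inf]
  exact op_injective.eq_iff.symm

theorem le_iff' {p q : Pr A} : p ≤ q ↔ q.op * p.op = p.op := by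
  rw [le_iff, p.comm q.mem]

theorem disjoint_iff {p q : Pr A} : Disjoint p q ↔ p.op * q.op = 0 := by
  rw [disjoint_iff_inf_le, le_bot_iff, ← op_injective.eq_iff, op_inf, op_bot]

theorem op_sup_of_disjoint {p q : Pr A} (h : Disjoint p q) : (p ⊔ q).op = p.op + q.op := by
  rw [op_sup, disjoint_iff.1 h, sub_zero]

theorem op_finset_sup {ι : Type*} (s : Finset ι) (f : ι → Pr A)
    (h : (s : Set ι).PairwiseDisjoint f) : (s.sup f).op = ∑ i ∈ s, (f i).op := by
  classical
  induction s using Finset.induction_on with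
  | empty => simp
  | insert a s ha ih =>
    rw [Finset.coe_insert, Set.pairwiseDisjoint_insert_of_notMem (by simpa using ha)] at h
    rw [Finset.sup_insert, Finset.sum_insert ha, op_sup_of_disjoint, ih h.1]
    exact Finset.disjoint_sup_right.2 fun i hi => h.2 i hi

theorem nonneg (p : Pr A) : 0 ≤ p.op := p.isStarProjection.nonneg

theorem exists_isLUB (S : Set (Pr A)) : ∃ p : Pr A, IsLUB S p ∧
    ∃ l : Filter (Finset S), l.NeBot ∧ WTends l (fun F => (F.sup Subtype.val).op) p.op := by
  classical
  obtain ⟨p, hpA, hpp, hp, hlim⟩ := exists_directed_projection A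
    (fun F : Finset S => (F.sup (Subtype.val : S → Pr A)).op) (fun F => isStarProjection _)
    (fun F => mem _) (fun F G h => le_iff'.1 (Finset.sup_mono h))
  refine ⟨of hpA hpp, ⟨fun q hq => ?_, fun r hr => ?_⟩, _, inferInstance, hlim⟩
  · have := hp {⟨q, hq⟩}
    rw [Finset.sup_singleton] at this
    exact le_iff'.2 this
  · refine le_iff'.2 ((hlim.mul_left r.op).unique (hlim.congr' ?_))
    refine Eventually.of_forall fun F => (le_iff'.1 ?_).symm
    exact Finset.sup_le fun q _ => hr q.2

instance : CompleteBooleanAlgebra (Pr A) :=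
  { (inferInstance : BooleanAlgebra (Pr A)) with
    sSup := fun S => (exists_isLUB S).choose
    isLUB_sSup := fun S => (exists_isLUB S).choose_spec.1
    sInf := fun S => (exists_isLUB (compl '' S)).chooseᶜ
    isGLB_sInf := fun S => by
      have h := (exists_isLUB (compl '' S)).choose_spec.1
      refine ⟨fun q hq => ?_, fun r hr => ?_⟩
      · rw [compl_le_iff_compl_le]
        exact h.1 ⟨q, hq, rfl⟩
      · rw [le_compl_comm]
        refine h.2 ?_
        rintro _ ⟨q, hq, rfl⟩
        exact compl_le_compl (hr hq) }

/-- The trace of a projection. -/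
def tr {M : VonNeumannAlgebra H} (τ : FTrace M) (p : Pr A) : ℝ := (τ.φ p.op).re

theorem exists_tr_sSup_lt {M : VonNeumannAlgebra H} (hAM : A ≤ M) (τ : FTrace M)
    (hf : IsFactor (M : Set (H →L[ℂ] H))) {S : Set (Pr A)} (h0 : ⊥ ∈ S) (hsup : ∀ p ∈ S, ∀ q ∈ S, p ⊔ q ∈ S)
    {ε : ℝ} (hε : 0 < ε) : ∃ r ∈ S, tr τ (sSup S) - ε < tr τ r := by
  obtain ⟨p, hp, l, hl, hlim⟩ := exists_isLUB S
  rw [(isLUB_sSup S).unique hp]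
  have h1 := τ.tendsto hf hlim (fun F => hAM (mem _)) (hAM (mem _))
  have h2 := (Complex.continuous_re.tendsto _).comp h1
  obtain ⟨F, hF⟩ := (h2.eventually (lt_mem_nhds (sub_lt_self _ hε))).exists
  refine ⟨F.sup Subtype.val, ?_, hF⟩
  refine Finset.sup_induction h0 hsup fun q _ => q.2

end Pr
end Pr

section Boolean
variable {α β : Type*} [BooleanAlgebra α] [CompleteBooleanAlgebra β]

/-- Maps between Boolean algebras preserving finite joins. -/
structure IsJoinHom (e : α → β) : Prop where
  bot : e ⊥ = ⊥
  sup : ∀ a b, e (a ⊔ b) = e a ⊔ e b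

theorem IsJoinHom.mono {e : α → β} (h : IsJoinHom e) {a b : α} (hab : a ≤ b) : e a ≤ e b := by
  rw [← sup_eq_right.2 hab, h.sup]; exact le_sup_left

theorem IsJoinHom.split {e : α → β} (h : IsJoinHom e) (a p : α) :
    e (a ⊓ p) ⊔ e (a ⊓ pᶜ) = e a := by
  rw [← h.sup, ← inf_sup_left, sup_compl_eq_top, inf_top_eq]

theorem IsJoinHom.sInf_chain {c : Set (α → β)} (hc : IsChain (· ≤ ·) c) (hne : c.Nonempty)
    (h : ∀ q ∈ c, IsJoinHom q) : IsJoinHom (fun a => ⨅ q ∈ c, q a) := by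
  constructor
  · obtain ⟨q, hq⟩ := hne
    exact le_bot_iff.1 ((iInf₂_le q hq).trans (h q hq).bot.le)
  · intro a b
    apply le_antisymm
    · rw [iInf_sup_eq]
      refine le_iInf fun q => ?_
      rw [iInf_sup_eq]
      refine le_iInf fun hq => ?_
      rw [sup_iInf_eq]
      refine le_iInf fun q' => ?_
      rw [sup_iInf_eq]
      refine le_iInf fun hq' => ?_
      rcases hc.total hq hq' with hh | hh
      · refine (iInf₂_le q hq).trans ?_
        rw [(h q hq).sup]
        exact sup_le_sup le_rfl (hh b)
      · refine (iInf₂_le q' hq').trans ?_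
        rw [(h q' hq').sup]
        exact sup_le_sup (hh a) le_rfl
    · refine le_iInf₂ fun q hq => ?_
      rw [(h q hq).sup]
      exact sup_le_sup (iInf₂_le q hq) (iInf₂_le q hq)

/-- Every join homomorphism into a complete Boolean algebra dominates one which has the same
value at `⊤` and preserves disjointness. -/
theorem IsJoinHom.exists_disjoint {e : α → β} (he : IsJoinHom e) :
    ∃ q : α → β, IsJoinHom q ∧ q ≤ e ∧ q ⊤ = e ⊤ ∧ ∀ a b, Disjoint a b → Disjoint (q a) (q b) := by
  obtain ⟨q, hqe, ⟨⟨hq, hqt⟩, hmin⟩⟩ := zorn_le_nonempty₀ (α := (α → β)ᵒᵈ)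
    {q : (α → β)ᵒᵈ | IsJoinHom (OrderDual.ofDual q) ∧ (OrderDual.ofDual q) ⊤ = e ⊤}
    (fun c hc hch y hy => by
      refine ⟨OrderDual.toDual (fun a => ⨅ q ∈ (OrderDual.toDual ⁻¹' c : Set (α → β)), q a),
        ⟨IsJoinHom.sInf_chain hch.symm ⟨_, hy⟩ fun q hq => (hc hq).1, ?_⟩, ?_⟩
      · apply le_antisymm
        · exact (iInf₂_le _ hy).trans (hc hy).2.le
        · exact le_iInf₂ fun q hq => (hc hq).2.ge
      · intro z hz
        exact fun a => iInf₂_le (OrderDual.ofDual z) hz)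
    (OrderDual.toDual e) ⟨he, rfl⟩
  change α → β at q
  change IsJoinHom q at hq
  change q ⊤ = e ⊤ at hqt
  have key : ∀ p, Disjoint (q pᶜ) (q p) := by
    intro p
    have h1 : IsJoinHom (fun r => q (r ⊓ p) ⊔ (q (r ⊓ pᶜ) \ q p)) := by
      constructor
      · simp [hq.bot]
      · intro a b
        simp only [inf_sup_right, hq.sup, sup_sdiff]
        exact sup_sup_sup_comm _ _ _ _
    have h2 := @hmin (OrderDual.toDual fun r => q (r ⊓ p) ⊔ (q (r ⊓ pᶜ) \ q p))
      ⟨h1, by simp [← hqt, ← hq.split ⊤ p]⟩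
      (fun r => by
        refine le_trans ?_ (hq.split r p).le
        exact sup_le_sup le_rfl sdiff_le)
    have h3 : q pᶜ ≤ q (pᶜ ⊓ p) ⊔ (q (pᶜ ⊓ pᶜ) \ q p) := h2 pᶜ
    rw [compl_inf_eq_bot, hq.bot, bot_sup_eq, inf_idem] at h3
    exact disjoint_sdiff_self_left.mono_left h3
  exact ⟨q, hq, hqe, hqt, fun a b hab =>
    (key b).mono_left (hq.mono hab.le_compl_right)⟩

end Boolean

/-- A trace preserving conditional expectation onto a von Neumann subalgebra. -/
structure CExp {M : VonNeumannAlgebra H} (τ : FTrace M) (A : VonNeumannAlgebra H) where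
  le : A ≤ M
  E : (H →L[ℂ] H) → (H →L[ℂ] H)
  mem : ∀ {x}, x ∈ M → E x ∈ A
  orth : ∀ x ∈ M, ∀ b ∈ A, τ.φ ((x - E x) * b) = 0

namespace CExp
variable {M A : VonNeumannAlgebra H} {τ : FTrace M} (ε : CExp τ A)

theorem mem' {x} (hx : x ∈ M) : ε.E x ∈ M := ε.le (ε.mem hx)

theorem trace_mul {x b} (hx : x ∈ M) (hb : b ∈ A) : τ.φ (ε.E x * b) = τ.φ (x * b) := by
  have := ε.orth x hx b hb
  rw [sub_mul, map_sub, sub_eq_zero] at this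
  exact this.symm

theorem trace_mul' {x b} (hx : x ∈ M) (hb : b ∈ A) : τ.φ (b * ε.E x) = τ.φ (b * x) := by
  rw [τ.tracial _ (ε.le hb) _ (ε.mem' hx), ε.trace_mul hx hb, τ.tracial _ (ε.le hb) _ hx]

theorem eq_of_trace {x y} (hx : x ∈ M) (hy : y ∈ A) (h : ∀ b ∈ A, τ.φ (x * b) = τ.φ (y * b)) :
    ε.E x = y := by
  have hd : ε.E x - y ∈ A := sub_mem (ε.mem hx) hy
  refine sub_eq_zero.1 (τ.faithful _ (ε.le hd) ?_)
  rw [τ.tracial _ (ε.le (star_mem hd)) _ (ε.le hd), sub_mul, map_sub,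
    ε.trace_mul hx (star_mem hd), h _ (star_mem hd), sub_self]

theorem apply_mem {a} (ha : a ∈ A) : ε.E a = a := ε.eq_of_trace (ε.le ha) ha fun _ _ => rfl

theorem add {x y} (hx : x ∈ M) (hy : y ∈ M) : ε.E (x + y) = ε.E x + ε.E y :=
  ε.eq_of_trace (add_mem hx hy) (add_mem (ε.mem hx) (ε.mem hy)) fun b hb => by
    simp only [add_mul, map_add, ε.trace_mul hx hb, ε.trace_mul hy hb]

theorem sub {x y} (hx : x ∈ M) (hy : y ∈ M) : ε.E (x - y) = ε.E x - ε.E y :=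
  ε.eq_of_trace (sub_mem hx hy) (sub_mem (ε.mem hx) (ε.mem hy)) fun b hb => by
    simp only [sub_mul, map_sub, ε.trace_mul hx hb, ε.trace_mul hy hb]

theorem smul (c : ℂ) {x} (hx : x ∈ M) : ε.E (c • x) = c • ε.E x :=
  ε.eq_of_trace (SMulMemClass.smul_mem _ hx) (SMulMemClass.smul_mem _ (ε.mem hx)) fun b hb => by
    simp only [smul_mul_assoc, map_smul, ε.trace_mul hx hb]

theorem sum {ι : Type*} (s : Finset ι) (x : ι → H →L[ℂ] H) (hx : ∀ i, x i ∈ M) :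
    ε.E (∑ i ∈ s, x i) = ∑ i ∈ s, ε.E (x i) :=
  ε.eq_of_trace (sum_mem fun i _ => hx i) (sum_mem fun i _ => ε.mem (hx i)) fun b hb => by
    simp only [Finset.sum_mul, map_sum, ε.trace_mul (hx _) hb]

theorem map_star {x} (hx : x ∈ M) : ε.E (star x) = star (ε.E x) :=
  ε.eq_of_trace (star_mem hx) (star_mem (ε.mem hx)) fun b hb => by
    have h := ε.trace_mul' hx (star_mem hb)
    have h1 := τ.map_star (mul_mem (ε.le (star_mem hb)) (ε.mem' hx))
    have h2 := τ.map_star (mul_mem (ε.le (star_mem hb)) hx)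
    rw [star_mul, star_star] at h1 h2
    rw [h1, h2, h]

theorem isSelfAdjoint {x} (hx : x ∈ M) (h : IsSelfAdjoint x) : IsSelfAdjoint (ε.E x) := by
  rw [IsSelfAdjoint, ← ε.map_star hx, h.star_eq]

theorem nonneg {x} (hx : x ∈ M) (h : 0 ≤ x) : 0 ≤ ε.E x := by
  have hsa := ε.isSelfAdjoint hx (.of_nonneg h)
  set y := ε.E x with hy
  have hn : y⁻ ∈ A := by
    rw [← CFC.posPart_neg]; exact A.posPart_mem (neg_mem (ε.mem hx))
  have h0 : y⁻ = 0 := by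
    have h1 := τ.re_mul_nonneg hx (ε.le hn) h (CFC.negPart_nonneg y)
    rw [← ε.trace_mul hx hn, ← hy] at h1
    have h2 : y * y⁻ = -(star y⁻ * y⁻) := by
      have h3 : (y⁺ - y⁻) * y⁻ = y * y⁻ := congrArg (· * y⁻) (CFC.posPart_sub_negPart y hsa)
      rw [← h3, sub_mul, CFC.posPart_mul_negPart, zero_sub,
        (IsSelfAdjoint.of_nonneg (CFC.negPart_nonneg y)).star_eq]
    rw [h2, map_neg, Complex.neg_re] at h1
    refine τ.eq_zero_of_n2_le (ε.le hn) ?_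
    rw [FTrace.n2]; linarith
  rw [← CFC.posPart_sub_negPart y hsa, h0, sub_zero]
  exact CFC.posPart_nonneg y

theorem mono {x y} (hx : x ∈ M) (hy : y ∈ M) (h : x ≤ y) : ε.E x ≤ ε.E y := by
  rw [← sub_nonneg, ← ε.sub hy hx]
  exact ε.nonneg (sub_mem hy hx) (sub_nonneg.2 h)

variable [hA : IsCommVN A]

/-- The completely positive map `p ↦ E(x* p x)` on projections. -/
def cp (x : H →L[ℂ] H) (p : Pr A) : H →L[ℂ] H := ε.E (star x * p.op * x)

variable {x : H →L[ℂ] H}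

theorem conj_mem (hx : x ∈ M) (ε : CExp τ A) (p : Pr A) : star x * p.op * x ∈ M :=
  mul_mem (mul_mem (star_mem hx) (ε.le p.mem)) hx

theorem cp_mem (hx : x ∈ M) (p : Pr A) : ε.cp x p ∈ A := ε.mem (ε.conj_mem hx p)

theorem cp_mem' (hx : x ∈ M) (p : Pr A) : ε.cp x p ∈ M := ε.le (ε.cp_mem hx p)

theorem cp_nonneg (hx : x ∈ M) (p : Pr A) : 0 ≤ ε.cp x p :=
  ε.nonneg (ε.conj_mem hx p) (star_left_conjugate_nonneg p.nonneg x)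

theorem cp_isSelfAdjoint (hx : x ∈ M) (p : Pr A) : IsSelfAdjoint (ε.cp x p) :=
  .of_nonneg (ε.cp_nonneg hx p)

theorem cp_sup (hx : x ∈ M) {p q : Pr A} (h : Disjoint p q) :
    ε.cp x (p ⊔ q) = ε.cp x p + ε.cp x q := by
  rw [cp, Pr.op_sup_of_disjoint h, mul_add, add_mul, ε.add (ε.conj_mem hx p) (ε.conj_mem hx q)]
  rfl

theorem cp_finset_sup (hx : x ∈ M) {ι : Type*} (s : Finset ι) (f : ι → Pr A)
    (h : (s : Set ι).PairwiseDisjoint f) : ε.cp x (s.sup f) = ∑ i ∈ s, ε.cp x (f i) := by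
  rw [cp, Pr.op_finset_sup s f h, Finset.mul_sum, Finset.sum_mul, ε.sum _ _
    fun i => ε.conj_mem hx _]
  rfl

theorem cp_mono (hx : x ∈ M) {p q : Pr A} (h : p ≤ q) : ε.cp x p ≤ ε.cp x q := by
  have := ε.cp_sup hx (disjoint_sdiff_self_right (x := p) (y := q))
  rw [sup_sdiff_cancel_right h] at this
  rw [this]
  exact le_add_of_nonneg_right (ε.cp_nonneg hx _)

theorem cp_le (hx : x ∈ M) (p : Pr A) : ε.cp x p ≤ (‖x‖ ^ 2 : ℝ) • (1 : H →L[ℂ] H) := by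
  refine (ε.cp_mono hx (le_top : p ≤ ⊤)).trans ?_
  have h : star x * x ≤ algebraMap ℝ (H →L[ℂ] H) (‖x‖ ^ 2) := by
    have := IsSelfAdjoint.le_algebraMap_norm_self (a := star x * x) (by simp [IsSelfAdjoint])
    rwa [CStarRing.norm_star_mul_self, ← sq] at this
  rw [Algebra.algebraMap_eq_smul_one] at h
  have h1 : (‖x‖ ^ 2 : ℝ) • (1 : H →L[ℂ] H) ∈ A := A.real_smul_mem _ (one_mem A)
  have := ε.mono (mul_mem (star_mem hx) hx) (ε.le h1) h
  rw [ε.apply_mem h1] at this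
  simpa [cp] using this

end CExp

theorem exists_finpartition_decides {β : Type*} [BooleanAlgebra β] (s : Finset β) :
    ∃ P : Finpartition (⊤ : β), ∀ q ∈ P.parts, ∀ p ∈ s, q ≤ p ∨ Disjoint q p := by
  classical
  induction s using Finset.induction_on with
  | empty => exact ⟨Classical.choice inferInstance, by simp⟩
  | insert a s _ ih =>
    obtain ⟨P, hP⟩ := ih
    let Q : Finpartition (⊤ : β) := Finpartition.ofErase {a, aᶜ}
      (Finset.supIndep_iff_pairwiseDisjoint.2 (by
        rw [Finset.coe_pair]
        intro b hb c hc hbc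
        rcases hb with rfl | rfl <;> rcases hc with rfl | rfl
        exacts [(hbc rfl).elim, disjoint_compl_right, disjoint_compl_left, (hbc rfl).elim])) (by simp)
    refine ⟨P ⊓ Q, fun q hq p hp => ?_⟩
    obtain ⟨c, hc, hqc⟩ := (inf_le_left : P ⊓ Q ≤ P) hq
    obtain ⟨d, hd, hqd⟩ := (inf_le_right : P ⊓ Q ≤ Q) hq
    rcases Finset.mem_insert.1 hp with rfl | hp
    · have : d = p ∨ d = pᶜ := by
        have := Finset.mem_of_mem_erase hd
        simpa using this
      rcases this with rfl | rfl
      · exact .inl hqd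
      · exact .inr (disjoint_compl_left.mono_left hqd)
    · rcases hP c hc p hp with h | h
      · exact .inl (hqc.trans h)
      · exact .inr (h.mono_left hqc)

variable {M A : VonNeumannAlgebra H} [hA : IsCommVN A]

theorem Pr.exists_sign {a : H →L[ℂ] H} (ha : a ∈ A) (hsa : IsSelfAdjoint a) :
    ∃ s : Pr A, 0 ≤ a * s.op ∧ 0 ≤ (-a) * sᶜ.op := by
  have hp := A.posPart_mem ha
  refine ⟨Pr.of (A.rangeProj_mem hp) (isStarProjection_rangeProj _), ?_, ?_⟩
  all_goals
    have h1 : a * rangeProj a⁺ = a⁺ := by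
      have h2 : a⁺ * rangeProj a⁺ = a⁺ := by
        rw [hA.comm _ hp _ (A.rangeProj_mem hp), rangeProj_mul_self]
      have h3 : a⁻ * rangeProj a⁺ = 0 := mul_rangeProj_eq_zero (CFC.negPart_mul_posPart a)
      have h4 : (a⁺ - a⁻) * rangeProj a⁺ = a * rangeProj a⁺ :=
        congrArg (· * rangeProj a⁺) (CFC.posPart_sub_negPart a hsa)
      rw [← h4, sub_mul, h2, h3, sub_zero]
  · rw [Pr.op_of, h1]; exact CFC.posPart_nonneg a
  · rw [Pr.op_compl, Pr.op_of, mul_sub, mul_one, neg_mul, h1]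
    have h5 : -a - -a⁺ = a⁻ := by
      have := CFC.posPart_sub_negPart a hsa
      rw [sub_eq_iff_eq_add] at this
      rw [this]
      abel
    rw [h5]; exact CFC.negPart_nonneg a

theorem Pr.mul_nonneg_of_le {b : H →L[ℂ] H} (hb : b ∈ A) {r r' : Pr A} (h : r' ≤ r)
    (h0 : 0 ≤ b * r.op) : 0 ≤ b * r'.op := by
  have h1 := conj_nonneg_of_isSelfAdjoint h0 r'.isStarProjection.isSelfAdjoint
  rw [r'.comm (mul_mem hb r.mem), mul_assoc, r'.isStarProjection.mul_self, mul_assoc,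
    le_iff'.1 h] at h1
  exact h1

/-- `a` is bounded by `δ` on the projection `r`. -/
def Below (δ : ℝ) (a : H →L[ℂ] H) (r : Pr A) : Prop := 0 ≤ (δ • (1 : H →L[ℂ] H) - a) * r.op

namespace Below
variable {δ : ℝ} {a a' : H →L[ℂ] H} {r r' : Pr A}

theorem mono_right (ha : a ∈ A) (h : Below δ a r) (hr : r' ≤ r) : Below δ a r' :=
  Pr.mul_nonneg_of_le (sub_mem (A.real_smul_mem _ (one_mem A)) ha) hr h

theorem mul_nonneg (ha : a ∈ A) (h : 0 ≤ a) : 0 ≤ a * r.op := by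
  have := Pr.mul_nonneg_of_le ha (le_top : r ≤ ⊤) (by simpa using h)
  exact this

theorem mono_left (ha : a ∈ A) (ha' : a' ∈ A) (h : Below δ a r) (hr : a' ≤ a) : Below δ a' r := by
  have := add_nonneg h (mul_nonneg (r := r) (sub_mem ha ha') (sub_nonneg.2 hr))
  rw [← add_mul, sub_add_sub_cancel] at this
  exact this

theorem sup (ha : a ∈ A) (h : Below δ a r) (h' : Below δ a r') : Below δ a (r ⊔ r') := by
  have := add_nonneg h (h'.mono_right ha (inf_le_left : r' ⊓ rᶜ ≤ r'))
  rw [← mul_add, ← Pr.op_sup_of_disjoint (disjoint_compl_right.mono_right inf_le_right),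
    sup_inf_left, sup_compl_eq_top, inf_top_eq] at this
  exact this

theorem bot : Below δ a (⊥ : Pr A) := by simp [Below]

end Below

namespace CExp
variable {τ : FTrace M} (ε : CExp τ A)

/-- The sum of the squared 2-norms of `E(x* p x)` over a partition of the unit. -/
def V (x : H →L[ℂ] H) (P : Finpartition (⊤ : Pr A)) : ℝ := ∑ p ∈ P.parts, τ.n2 (ε.cp x p)

/-- `p` has a finite cover by projections `p'` such that `E(x* p' x)` is at most `δ` on `r`. -/
def Light (δ : ℝ) (x : H →L[ℂ] H) (r p : Pr A) : Prop :=
  ∃ s : Finset (Pr A), p ≤ s.sup id ∧ ∀ p' ∈ s, Below δ (ε.cp x p') r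

variable {x : H →L[ℂ] H} {δ : ℝ} {r r' p p' : Pr A}

theorem Light.mono_left {ε : CExp τ A} (hx : x ∈ M) (h : ε.Light δ x r p) (hr : r' ≤ r) :
    ε.Light δ x r' p := by
  obtain ⟨s, hs, h⟩ := h
  exact ⟨s, hs, fun q hq => (h q hq).mono_right (ε.cp_mem hx q) hr⟩

theorem Light.mono_right {ε : CExp τ A} (h : ε.Light δ x r p) (hp : p' ≤ p) :
    ε.Light δ x r p' := by
  obtain ⟨s, hs, h⟩ := h
  exact ⟨s, hp.trans hs, h⟩

theorem Light.sup_right {ε : CExp τ A} (h : ε.Light δ x r p) (h' : ε.Light δ x r p') :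
    ε.Light δ x r (p ⊔ p') := by
  classical
  obtain ⟨s, hs, h⟩ := h
  obtain ⟨s', hs', h'⟩ := h'
  refine ⟨s ∪ s', by rw [Finset.sup_union]; exact sup_le_sup hs hs', fun q hq => ?_⟩
  rcases Finset.mem_union.1 hq with hq | hq
  exacts [h q hq, h' q hq]

theorem Light.sup_left {ε : CExp τ A} (hx : x ∈ M) (h : ε.Light δ x r p)
    (h' : ε.Light δ x r' p) : ε.Light δ x (r ⊔ r') p := by
  classical
  obtain ⟨s, hs, h⟩ := h
  obtain ⟨s', hs', h'⟩ := h'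
  refine ⟨(s ×ˢ s').image fun q => q.1 ⊓ q.2, ?_, fun q hq => ?_⟩
  · refine (le_inf hs hs').trans ?_
    rw [Finset.sup_inf_sup, Finset.sup_image]
    rfl
  · obtain ⟨⟨q1, q2⟩, hq', rfl⟩ := Finset.mem_image.1 hq
    obtain ⟨h1, h2⟩ := Finset.mem_product.1 hq'
    have e1 := ε.cp_mem hx q1
    have e2 := ε.cp_mem hx q2
    have e3 := ε.cp_mem hx (q1 ⊓ q2)
    exact ((h q1 h1).mono_left e1 e3 (ε.cp_mono hx inf_le_left)).sup e3
      ((h' q2 h2).mono_left e2 e3 (ε.cp_mono hx inf_le_right))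

theorem light_bot_right : ε.Light δ x r ⊥ := ⟨∅, bot_le, by simp⟩

theorem light_bot_left : ε.Light δ x ⊥ p := ⟨{p}, by simp, fun _ _ => Below.bot⟩

/-- The part of the unit on which no finite cover of `p` makes `E(x* · x)` small. -/
def heavy (δ : ℝ) (x : H →L[ℂ] H) (p : Pr A) : Pr A := (sSup {r | ε.Light δ x r p})ᶜ

theorem isJoinHom_heavy (hx : x ∈ M) : IsJoinHom (ε.heavy δ x) := by
  constructor
  · rw [heavy, compl_eq_bot]
    exact top_le_iff.1 (le_sSup (ε.light_bot_right))
  · intro a b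
    rw [heavy, heavy, heavy, ← compl_inf, sSup_inf_sSup]
    congr 1
    apply le_antisymm
    · refine sSup_le fun r hr => ?_
      refine le_trans (by rw [inf_idem]) (le_iSup₂ (f := fun (p : Pr A × Pr A) _ => p.1 ⊓ p.2)
        (r, r) ⟨hr.mono_right le_sup_left, hr.mono_right le_sup_right⟩)
    · refine iSup₂_le fun p hp => le_sSup ?_
      exact (Light.mono_left hx hp.1 inf_le_left).sup_right (Light.mono_left hx hp.2 inf_le_right)

theorem heavy_mul_nonneg (hx : x ∈ M) {q : Pr A} (hq : q ≤ ε.heavy δ x p) :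
    0 ≤ (ε.cp x p - δ • (1 : H →L[ℂ] H)) * q.op := by
  have hm : ε.cp x p - δ • (1 : H →L[ℂ] H) ∈ A :=
    sub_mem (ε.cp_mem hx p) (A.real_smul_mem _ (one_mem A))
  obtain ⟨s, h1, h2⟩ := Pr.exists_sign hm
    ((ε.cp_isSelfAdjoint hx p).sub (IsSelfAdjoint.smul (.all _) (.one _)))
  refine Pr.mul_nonneg_of_le hm ?_ h1
  rw [neg_sub] at h2
  have h3 : ε.Light δ x (q ⊓ sᶜ) p := ⟨{p}, by simp, fun p' hp' => by
    rw [Finset.mem_singleton.1 hp']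
    exact Below.mono_right (ε.cp_mem hx p) h2 inf_le_right⟩
  have h4 : q ⊓ sᶜ ≤ (ε.heavy δ x p)ᶜ := by
    rw [heavy, compl_compl]; exact le_sSup h3
  have h5 : q ⊓ sᶜ ≤ ⊥ := by
    rw [← inf_compl_eq_bot (a := ε.heavy δ x p)]
    exact le_inf (inf_le_left.trans hq) h4
  exact disjoint_compl_right_iff.1 (disjoint_iff_inf_le.2 h5)

theorem tr_le_of_heavy (hx : x ∈ M) {q : Pr A} (hq : q ≤ ε.heavy δ x p) :
    δ * Pr.tr τ q ≤ (τ.φ (ε.cp x p * q.op)).re := by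
  have := τ.re_nonneg (mul_mem (sub_mem (ε.cp_mem' hx p) (M.real_smul_mem _ (one_mem M)))
    (ε.le q.mem)) (ε.heavy_mul_nonneg hx hq)
  rw [sub_mul, smul_mul_assoc, one_mul, map_sub, τ.real_smul, Complex.sub_re,
    Complex.re_ofReal_mul] at this
  rw [Pr.tr]; linarith

theorem sum_cp (hx : x ∈ M) (P : Finpartition (⊤ : Pr A)) : ∑ p ∈ P.parts, ε.cp x p = ε.cp x ⊤ := by
  conv_rhs => rw [← P.sup_parts]
  exact (ε.cp_finset_sup hx P.parts id P.disjoint).symm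

theorem V_le (hx : x ∈ M) (hδ : 0 ≤ δ) (P : Finpartition (⊤ : Pr A)) (r : Pr A)
    (h : ∀ p ∈ P.parts, Below δ (ε.cp x p) r) :
    ε.V x P ≤ δ * ‖x‖ ^ 2 + ‖x‖ ^ 2 * (‖x‖ ^ 2 * Pr.tr τ rᶜ) := by
  have hone : ∀ c : ℝ, c • (1 : H →L[ℂ] H) ∈ A := fun c => A.real_smul_mem _ (one_mem A)
  have h1 : ∀ p ∈ P.parts, τ.n2 (ε.cp x p) ≤
      δ * (τ.φ (ε.cp x p)).re + ‖x‖ ^ 2 * (τ.φ (ε.cp x p * rᶜ.op)).re := by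
    intro p hp
    have hm := ε.cp_mem hx p
    have hm' := ε.cp_mem' hx p
    have h0 := ε.cp_nonneg hx p
    set a := ε.cp x p with ha
    have e1 : a * r.op ≤ δ • (1 : H →L[ℂ] H) := by
      have e2 := h p hp
      rw [Below, sub_mul, smul_mul_assoc, one_mul, sub_nonneg] at e2
      exact e2.trans (smul_le_smul_of_nonneg_left r.isStarProjection.le_one hδ)
    have e3 : a * rᶜ.op ≤ (‖x‖ ^ 2 : ℝ) • rᶜ.op := by
      have := Below.mul_nonneg (r := rᶜ) (sub_mem (hone (‖x‖ ^ 2)) hm)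
        (sub_nonneg.2 (ε.cp_le hx p))
      rwa [sub_mul, smul_mul_assoc, one_mul, sub_nonneg] at this
    have f1 := τ.re_mul_mono_right hm' (ε.le (mul_mem hm r.mem)) (ε.le (hone δ)) h0 e1
    have f2 := τ.re_mul_mono_right hm' (ε.le (mul_mem hm rᶜ.mem))
      (M.real_smul_mem _ (ε.le rᶜ.mem)) h0 e3
    rw [mul_smul_comm, mul_one, τ.real_smul, Complex.re_ofReal_mul] at f1
    rw [mul_smul_comm, τ.real_smul, Complex.re_ofReal_mul] at f2
    have f3 : τ.n2 a = (τ.φ (a * (a * r.op))).re + (τ.φ (a * (a * rᶜ.op))).re := by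
      rw [FTrace.n2, (IsSelfAdjoint.of_nonneg h0).star_eq, ← Complex.add_re, ← map_add, ← mul_add,
        ← mul_add, Pr.op_compl, add_sub_cancel, mul_one]
    linarith
  refine (Finset.sum_le_sum h1).trans ?_
  rw [Finset.sum_add_distrib, ← Finset.mul_sum, ← Finset.mul_sum, ← Complex.re_sum,
    ← Complex.re_sum, ← map_sum, ← map_sum, ← Finset.sum_mul, ε.sum_cp hx]
  have hm := ε.cp_mem hx ⊤
  have g1 := τ.re_mono (ε.le hm) (ε.le (hone _)) (ε.cp_le hx ⊤)
  rw [τ.real_smul, τ.φ_one, mul_one, Complex.ofReal_re] at g1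
  have g2 := τ.re_mul_mono_left (ε.le rᶜ.mem) (ε.le hm) (ε.le (hone _)) rᶜ.nonneg (ε.cp_le hx ⊤)
  rw [smul_mul_assoc, one_mul, τ.real_smul, Complex.re_ofReal_mul] at g2
  exact add_le_add (mul_le_mul_of_nonneg_left g1 hδ)
    (mul_le_mul_of_nonneg_left g2 (sq_nonneg _))

theorem heavy_top_ne_bot (hx : x ∈ M) (hf : IsFactor (M : Set (H →L[ℂ] H))) {c : ℝ} (hc : 0 < c)
    (hV : ∀ P : Finpartition (⊤ : Pr A), c ≤ ε.V x P) : ∃ δ : ℝ, 0 < δ ∧ ε.heavy δ x ⊤ ≠ ⊥ := by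
  set K := ‖x‖ ^ 2 with hK
  have hK0 : 0 ≤ K := sq_nonneg _
  refine ⟨c / (2 * (K + 1)), by positivity, fun hbot => ?_⟩
  set δ := c / (2 * (K + 1)) with hδ
  rw [heavy, compl_eq_bot] at hbot
  obtain ⟨r, ⟨s, hs, h⟩, hr⟩ := Pr.exists_tr_sSup_lt ε.le τ hf
    (S := {r | ε.Light δ x r ⊤}) ε.light_bot_left (fun _ h _ h' => Light.sup_left hx h h')
    (ε := c / (2 * (K ^ 2 + 1))) (by positivity)
  obtain ⟨P, hP⟩ := exists_finpartition_decides s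
  have hB : ∀ p ∈ P.parts, Below δ (ε.cp x p) r := by
    intro p hp
    by_contra hcon
    refine P.ne_bot hp ?_
    have : Disjoint p (s.sup id) := by
      rw [Finset.disjoint_sup_right]
      intro p' hp'
      refine (hP p hp p' hp').resolve_left fun hle => hcon ?_
      exact (h p' hp').mono_left (ε.cp_mem hx p') (ε.cp_mem hx p) (ε.cp_mono hx hle)
    rw [top_le_iff.1 hs] at this
    exact disjoint_top.1 this
  have h1 := (hV P).trans (ε.V_le hx (by positivity) P r hB)
  have h2 : Pr.tr τ rᶜ < c / (2 * (K ^ 2 + 1)) := by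
    rw [hbot] at hr
    simp only [Pr.tr, Pr.op_top, Pr.op_compl, map_sub, τ.φ_one, Complex.sub_re,
      Complex.one_re] at hr ⊢
    linarith
  rw [← hK] at h1
  have h3 : δ * K < c / 2 := by
    rw [hδ, div_mul_eq_mul_div, div_lt_div_iff₀ (by positivity) (by positivity)]
    nlinarith
  have h4 : K * (K * Pr.tr τ rᶜ) ≤ c / 2 := by
    rw [← mul_assoc]
    refine (mul_le_mul_of_nonneg_left h2.le (by positivity)).trans ?_
    rw [mul_div_assoc', div_le_div_iff₀ (by positivity) (by positivity)]
    nlinarith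
  linarith

end CExp

theorem norm_le_of_star_mul_self_le {w : H →L[ℂ] H} {C : ℝ} (hC : 0 ≤ C)
    (h : star w * w ≤ (C ^ 2 : ℝ) • (1 : H →L[ℂ] H)) : ‖w‖ ≤ C := by
  refine ContinuousLinearMap.opNorm_le_bound _ hC fun ξ => ?_
  have h1 := re_inner_nonneg_of_nonneg (sub_nonneg.2 h) ξ
  have h2 := re_inner_star_mul_self w ξ
  simp only [_root_.sub_apply, inner_sub_left, Complex.sub_re, h2] at h1
  have h3 : (inner ℂ (((C ^ 2 : ℝ) • (1 : H →L[ℂ] H)) ξ) ξ).re = C ^ 2 * ‖ξ‖ ^ 2 := by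
    rw [_root_.smul_apply, real_inner_smul_left_complex, Complex.re_ofReal_mul]
    congr 1
    exact inner_self_eq_norm_sq (𝕜 := ℂ) ξ
  rw [h3] at h1
  apply le_of_sq_le_sq _ (by positivity)
  rw [mul_pow]; linarith

namespace CExp
variable {M A : VonNeumannAlgebra H} [hA : IsCommVN A] {τ : FTrace M} (ε : CExp τ A)

/-- The sum of the corners of `x` cut out by matching the parts of a partition. -/
def matching (x : H →L[ℂ] H) (q : Pr A → Pr A) (P : Finpartition (⊤ : Pr A)) : H →L[ℂ] H :=
  ∑ p ∈ P.parts, p.op * x * (q p).op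

variable {x : H →L[ℂ] H} {q : Pr A → Pr A} {P : Finpartition (⊤ : Pr A)}

theorem matching_mem (hle : A ≤ M) (hx : x ∈ M) : matching x q P ∈ M :=
  sum_mem fun p _ => mul_mem (mul_mem (hle p.mem) hx) (hle (q p).mem)

theorem norm_matching_le (hd : ∀ a b, Disjoint a b → Disjoint (q a) (q b)) :
    ‖matching x q P‖ ≤ ‖x‖ := by
  refine norm_le_of_star_mul_self_le (norm_nonneg _) ?_
  have h1 : star (matching x q P) * matching x q P
      = ∑ p ∈ P.parts, star (q p).op * (star x * p.op * x) * (q p).op := by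
    rw [matching, star_sum, Finset.sum_mul]
    refine Finset.sum_congr rfl fun p hp => ?_
    rw [Finset.mul_sum, Finset.sum_eq_single p]
    · simp only [star_mul, p.isStarProjection.star_eq]
      calc _ = star (q p).op * (star x * (p.op * p.op) * x) * (q p).op := by noncomm_ring
        _ = _ := by rw [p.isStarProjection.mul_self]
    · intro p' hp' hne
      have : p.op * p'.op = 0 := Pr.disjoint_iff.1 (P.disjoint hp hp' hne.symm)
      simp only [star_mul, p.isStarProjection.star_eq]
      calc _ = star (q p).op * star x * (p.op * p'.op) * x * (q p').op := by noncomm_ring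
        _ = 0 := by rw [this]; simp
    · exact fun h => (h hp).elim
  have hx : star x * x ≤ (‖x‖ ^ 2 : ℝ) • (1 : H →L[ℂ] H) := by
    have := IsSelfAdjoint.le_algebraMap_norm_self (a := star x * x) (by simp [IsSelfAdjoint])
    rwa [CStarRing.norm_star_mul_self, ← sq, Algebra.algebraMap_eq_smul_one] at this
  rw [h1]
  calc _ ≤ ∑ p ∈ P.parts, (‖x‖ ^ 2 : ℝ) • (q p).op := by
        refine Finset.sum_le_sum fun p _ => ?_
        have h2 : star x * p.op * x ≤ (‖x‖ ^ 2 : ℝ) • (1 : H →L[ℂ] H) := by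
          refine le_trans ?_ hx
          simpa using star_left_conjugate_le_conjugate p.isStarProjection.le_one x
        refine (star_left_conjugate_le_conjugate h2 (q p).op).trans_eq ?_
        rw [mul_smul_comm, mul_one, smul_mul_assoc, (q p).isStarProjection.star_eq,
          (q p).isStarProjection.mul_self]
    _ = (‖x‖ ^ 2 : ℝ) • (P.parts.sup q).op := by
        rw [Pr.op_finset_sup, Finset.smul_sum]
        exact fun a ha b hb hab => hd a b (P.disjoint ha hb hab)
    _ ≤ _ := smul_le_smul_of_nonneg_left (Pr.isStarProjection _).le_one (sq_nonneg _)

theorem op_mul_matching (hq : IsJoinHom q) (hd : ∀ a b, Disjoint a b → Disjoint (q a) (q b))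
    {a : Pr A} (h : ∀ p ∈ P.parts, p ≤ a ∨ Disjoint p a) :
    a.op * matching x q P = matching x q P * (q a).op := by
  rw [matching, Finset.mul_sum, Finset.sum_mul]
  refine Finset.sum_congr rfl fun p hp => ?_
  rcases h p hp with h | h
  · rw [mul_assoc _ (q p).op, Pr.le_iff.1 (hq.mono h), ← mul_assoc, ← mul_assoc, Pr.le_iff'.1 h]
  · rw [mul_assoc _ (q p).op, Pr.disjoint_iff.1 (hd _ _ h), ← mul_assoc, ← mul_assoc,
      Pr.disjoint_iff.1 h.symm]
    simp

theorem mul_matching {a b : H →L[ℂ] H} (ha : a ∈ A) (hb : b ∈ A) (h : a * x = x * b) :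
    a * matching x q P = matching x q P * b := by
  rw [matching, Finset.mul_sum, Finset.sum_mul]
  refine Finset.sum_congr rfl fun p _ => ?_
  rw [mul_assoc _ (q p).op, (q p).comm hb, ← mul_assoc _ b, mul_assoc p.op x b, ← h, ← mul_assoc p.op a,
    p.comm ha]
  simp only [mul_assoc]

theorem le_trace_star_mul_matching (hx : x ∈ M) {δ : ℝ} (hq : IsJoinHom q)
    (hd : ∀ a b, Disjoint a b → Disjoint (q a) (q b)) (hle : q ≤ ε.heavy δ x) :
    δ * Pr.tr τ (q ⊤) ≤ (τ.φ (star x * matching x q P)).re := by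
  have h1 : q ⊤ = P.parts.sup q := by
    conv_lhs => rw [← P.sup_parts]
    rw [← Function.comp_id q]
    exact Finset.apply_sup_eq_sup_comp q hq.sup hq.bot
  rw [h1, Pr.tr, Pr.op_finset_sup _ _ fun a ha b hb hab => hd a b (P.disjoint ha hb hab),
    map_sum, Complex.re_sum, Finset.mul_sum, matching, Finset.mul_sum, map_sum, Complex.re_sum]
  refine Finset.sum_le_sum fun p _ => ?_
  have := ε.tr_le_of_heavy hx (hle p)
  rw [cp, ε.trace_mul (ε.conj_mem hx p) (q p).mem] at this
  simpa only [mul_assoc, Pr.tr] using this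

theorem exists_selection (hf : IsFactor (M : Set (H →L[ℂ] H))) (hx : x ∈ M) {c : ℝ} (hc : 0 < c)
    (hV : ∀ P : Finpartition (⊤ : Pr A), c ≤ ε.V x P) : ∃ w ∈ M, w ≠ 0 ∧
      (∀ p : Pr A, ∃ q : Pr A, p.op * w = w * q.op) ∧
      (∀ a ∈ A, ∀ b ∈ A, a * x = x * b → a * w = w * b) ∧
      (∀ m ∈ M, (∀ a ∈ A, ∀ b ∈ A, τ.φ (a * x * b * m) = 0) → τ.φ (w * m) = 0) := by
  classical
  obtain ⟨δ, hδ, hne⟩ := ε.heavy_top_ne_bot hx hf hc hV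
  obtain ⟨q, hq, hle, htop, hd⟩ := (ε.isJoinHom_heavy (δ := δ) hx).exists_disjoint
  obtain ⟨l, hl⟩ := exists_ultrafilter_of_directed
    (fun P Q : Finpartition (⊤ : Pr A) => Q ≤ P) (fun _ => le_rfl) (fun h h' => le_trans h' h)
    (fun P Q => ⟨P ⊓ Q, inf_le_left, inf_le_right⟩)
  obtain ⟨w, hw⟩ := exists_wTends l (matching x q) ‖x‖ fun P => norm_matching_le hd
  have hwm : w ∈ M := hw.mem M fun P => matching_mem ε.le hx
  refine ⟨w, hwm, ?_, fun p => ⟨q p, ?_⟩, fun a ha b hb hab => ?_, fun m hm h => ?_⟩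
  · rintro rfl
    have h1 := τ.tendsto_mul hf hw (fun P => matching_mem ε.le hx) hwm (star_mem hx)
    have h2 := ge_of_tendsto ((Complex.continuous_re.tendsto _).comp h1)
      (Eventually.of_forall fun P => ε.le_trace_star_mul_matching (P := P) hx hq hd hle)
    rw [mul_zero, map_zero, Complex.zero_re, htop] at h2
    have h3 := τ.re_pos (ε.le (ε.heavy δ x ⊤).mem) (Pr.isStarProjection _)
      (fun h => hne (Pr.op_injective h))
    exact absurd h2 (not_le.2 (mul_pos hδ h3))
  · obtain ⟨P, hP⟩ := exists_finpartition_decides {p}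
    refine (hw.mul_left p.op).unique ((hw.mul_right (q p).op).congr' ?_)
    filter_upwards [hl P] with Q hQ
    refine (op_mul_matching hq hd fun r hr => ?_).symm
    obtain ⟨r', hr', hle⟩ := hQ hr
    rcases hP r' hr' p (Finset.mem_singleton_self p) with h | h
    · exact .inl (hle.trans h)
    · exact .inr (h.mono_left hle)
  · exact (hw.mul_left a).unique ((hw.mul_right b).congr'
      (Eventually.of_forall fun P => (mul_matching ha hb hab).symm))
  · have h1 := τ.tendsto_mul hf hw (fun P => matching_mem ε.le hx) hwm hm
    rw [τ.tracial _ hwm _ hm]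
    refine tendsto_nhds_unique h1 ?_
    refine tendsto_const_nhds.congr fun P => ?_
    rw [τ.tracial _ hm _ (matching_mem ε.le hx), matching, Finset.sum_mul, map_sum]
    exact (Finset.sum_eq_zero fun p _ => h _ p.mem _ (q p).mem).symm

end CExp

section Normalizer
variable {M A N : VonNeumannAlgebra H} [hA : IsCommVN A] {τ : FTrace M}

/-- `A` is maximal abelian in `M`. -/
def IsMaxAbelian (M A : VonNeumannAlgebra H) : Prop :=
  A ≤ M ∧ ∀ x ∈ M, (∀ a ∈ A, Commute x a) → x ∈ A

theorem IsMaxAbelian.mem (hm : IsMaxAbelian M A) {x : H →L[ℂ] H} (hx : x ∈ M)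
    (h : ∀ p : Pr A, Commute x p.op) : x ∈ A :=
  hm.2 x hx fun _ ha => A.commute_of_projections (fun _ hp hpp => h (Pr.of hp hpp)) ha

/-- Conjugation by `w` and by its adjoint maps `A` to itself. -/
structure Normalizes (M A : VonNeumannAlgebra H) (w : H →L[ℂ] H) : Prop where
  mem : w ∈ M
  conj : ∀ a ∈ A, w * a * star w ∈ A
  conj' : ∀ a ∈ A, star w * a * w ∈ A

theorem IsMaxAbelian.conj_mem (hm : IsMaxAbelian M A) {w : H →L[ℂ] H} (hw : w ∈ M)
    (h : ∀ p : Pr A, ∃ q : Pr A, p.op * w = w * q.op) {a : H →L[ℂ] H} (ha : a ∈ A) :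
    w * a * star w ∈ A := by
  refine hm.mem (mul_mem (mul_mem hw (hm.1 ha)) (star_mem hw)) fun p => ?_
  obtain ⟨q, hq⟩ := h p
  have hq' : star w * p.op = q.op * star w := by
    simpa [p.isStarProjection.star_eq, q.isStarProjection.star_eq] using congrArg star hq
  change _ * _ = _ * _
  rw [mul_assoc, hq', mul_assoc w, ← mul_assoc a, ← q.comm ha, ← mul_assoc p.op, ← mul_assoc p.op,
    hq]
  simp only [mul_assoc]

theorem IsMaxAbelian.normalizes (hm : IsMaxAbelian M A) {w : H →L[ℂ] H} (hw : w ∈ M)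
    (h : ∀ p : Pr A, ∃ q : Pr A, p.op * w = w * q.op)
    (h' : ∀ p : Pr A, ∃ q : Pr A, p.op * star w = star w * q.op) : Normalizes M A w :=
  ⟨hw, fun _ ha => hm.conj_mem hw h ha, fun _ ha => by
    simpa using hm.conj_mem (star_mem hw) h' ha⟩

theorem Normalizes.mul_right {w h : H →L[ℂ] H} (hw : Normalizes M A w) (hAM : A ≤ M) (hh : h ∈ A) :
    Normalizes M A (w * h) := by
  refine ⟨mul_mem hw.mem (hAM hh), fun a ha => ?_, fun a ha => ?_⟩
  · have := hw.conj _ (mul_mem (mul_mem hh ha) (star_mem hh))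
    simpa only [star_mul, mul_assoc] using this
  · have := mul_mem (mul_mem (star_mem hh) (hw.conj' _ ha)) hh
    simpa only [star_mul, mul_assoc] using this

/-- `x` is orthogonal to `N` with respect to the trace. -/
def Perp (τ : FTrace M) (N : VonNeumannAlgebra H) (x : H →L[ℂ] H) : Prop :=
  ∀ m ∈ N, τ.φ (x * m) = 0

theorem Perp.star {x : H →L[ℂ] H} (h : Perp τ N x) (hx : x ∈ M) (hN : N ≤ M) :
    Perp τ N (star x) := fun m hm => by
  rw [τ.tracial _ (star_mem hx) _ (hN hm)]
  have := τ.map_star (mul_mem hx (hN (star_mem hm)))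
  rwa [h _ (star_mem hm), star_mul, star_star, map_zero] at this

theorem Perp.mul_right {x a : H →L[ℂ] H} (h : Perp τ N x) (ha : a ∈ N) :
    Perp τ N (x * a) := fun m hm => by
  rw [mul_assoc]; exact h _ (mul_mem ha hm)

theorem Perp.eq_zero_of_mem {x : H →L[ℂ] H} (h : Perp τ N x) (hx : x ∈ M) (hxN : x ∈ N) : x = 0 := by
  refine τ.faithful x hx ?_
  rw [τ.tracial _ (star_mem hx) _ hx]
  exact h _ (star_mem hxN)

/-- Symmetries of `M` normalizing `A` belong to `N`. -/
def ContainsSymmetries (M A N : VonNeumannAlgebra H) : Prop :=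
  ∀ n ∈ M, IsSelfAdjoint n → n * n = 1 → (∀ a ∈ A, n * a * n ∈ A) → n ∈ N

theorem ContainsSymmetries.le (h : ContainsSymmetries M A N) (hAM : A ≤ M) : A ≤ N := by
  have hp : ∀ p : Pr A, p.op ∈ N := by
    intro p
    have h2 : (2 : H →L[ℂ] H) * p.op - 1 ∈ A := by
      rw [two_mul]; exact sub_mem (add_mem p.mem p.mem) (one_mem A)
    have h3 : (2 : H →L[ℂ] H) * p.op - 1 ∈ N := by
      refine h _ (hAM h2) ?_ ?_ fun a ha => mul_mem (mul_mem h2 ha) h2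
      · rw [two_mul]
        exact (p.isStarProjection.isSelfAdjoint.add p.isStarProjection.isSelfAdjoint).sub (.one _)
      · have := p.isStarProjection.mul_self
        calc _ = 4 * (p.op * p.op) - 4 * p.op + 1 := by noncomm_ring
          _ = 1 := by rw [this]; simp
    have h4 := N.real_smul_mem (1 / 2) (add_mem h3 (one_mem N))
    rw [sub_add_cancel, two_mul, ← two_smul ℝ, smul_smul] at h4
    simpa using h4
  intro x hx
  refine N.mem_of_commute fun g hg => A.commute_of_projections (fun q hq hqp => ?_) hx
  exact VonNeumannAlgebra.commute_of_mem_commutant hg (hp (Pr.of hq hqp))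

/-- A partial isometry with orthogonal initial and final projections extends to a symmetry. -/
theorem mem_of_orthogonal (hN : ContainsSymmetries M A N) (hAM : A ≤ M) {y : H →L[ℂ] H}
    (hy : Normalizes M A y) (hp : IsStarProjection (star y * y))
    (hz : (y * star y) * (star y * y) = 0) : y ∈ N := by
  have hAN := hN.le hAM
  have heA : star y * y ∈ A := by simpa using hy.conj' 1 (one_mem A)
  have hfA : y * star y ∈ A := by simpa using hy.conj 1 (one_mem A)
  have hye : y * (star y * y) = y := by
    rw [← mul_assoc]; exact mul_star_mul_of_isStarProjection hp
  have hey : (star y * y) * star y = star y := by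
    simpa [hp.star_eq] using congrArg star hye
  have hfy : y * star y * y = y := by rw [mul_assoc]; exact hye
  have hyf : star y * (y * star y) = star y := by rw [← mul_assoc]; exact hey
  set e := star y * y with he
  set f := y * star y with hf
  have hef : e * f = 0 := by rw [hA.comm _ heA _ hfA]; exact hz
  have hee : e * e = e := hp.mul_self
  have hff : f * f = f := by
    rw [hf, mul_assoc, ← mul_assoc (star y), ← he, hey]
  set z := 1 - e - f with hzd
  have hzA : z ∈ A := sub_mem (sub_mem (one_mem A) heA) hfA
  have hez : e * z = 0 := by simp [hzd, mul_sub, hee, hef]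
  have hfz : f * z = 0 := by simp [hzd, mul_sub, hff, hz]
  have hzz : z * z = z := by
    conv_lhs => rw [hzd]
    rw [sub_mul, sub_mul, hez, hfz, one_mul, sub_zero, sub_zero]
  have key : ∀ a ∈ A, y * a * y = 0 ∧ y * a * z = 0 ∧ star y * a * z = 0 := by
    intro a ha
    refine ⟨?_, ?_, ?_⟩
    · calc y * a * y = (y * e) * a * (f * y) := by rw [hye, hfy]
        _ = y * (e * a) * f * y := by simp only [mul_assoc]
        _ = y * a * (e * f) * y := by rw [hA.comm _ heA _ ha]; simp only [mul_assoc]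
        _ = 0 := by rw [hef]; simp
    · calc y * a * z = (y * e) * a * z := by rw [hye]
        _ = y * (e * a) * z := by simp only [mul_assoc]
        _ = y * a * (e * z) := by rw [hA.comm _ heA _ ha]; simp only [mul_assoc]
        _ = 0 := by rw [hez]; simp
    · calc star y * a * z = (star y * f) * a * z := by rw [hyf]
        _ = star y * (f * a) * z := by simp only [mul_assoc]
        _ = star y * a * (f * z) := by rw [hA.comm _ hfA _ ha]; simp only [mul_assoc]
        _ = 0 := by rw [hfz]; simp
  have hzs : star z = z := by
    simp [hzd, he, hf]
  have key' : ∀ a ∈ A, star y * a * star y = 0 ∧ z * a * star y = 0 ∧ z * a * y = 0 := by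
    intro a ha
    obtain ⟨h1, h2, h3⟩ := key _ (star_mem ha)
    refine ⟨?_, ?_, ?_⟩
    · simpa [mul_assoc] using congrArg star h1
    · simpa [mul_assoc, hzs] using congrArg star h2
    · simpa [mul_assoc, hzs] using congrArg star h3
  set n := y + star y + z with hn
  have hna : ∀ a ∈ A, n * a * n = y * a * star y + star y * a * y + z * a * z := by
    intro a ha
    obtain ⟨h1, h2, h3⟩ := key a ha
    obtain ⟨h4, h5, h6⟩ := key' a ha
    simp only [hn, add_mul, mul_add, h1, h2, h3, h4, h5, h6]
    abel
  have hnM : n ∈ M := add_mem (add_mem hy.mem (star_mem hy.mem)) (hAM hzA)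
  have hnN : n ∈ N := by
    refine hN n hnM ?_ ?_ ?_
    · rw [IsSelfAdjoint, hn, star_add, star_add, star_star, hzs, add_comm (star y)]
    · have := hna 1 (one_mem A)
      simp only [mul_one] at this
      rw [this, hzz, ← hf, ← he, hzd]
      abel
    · intro a ha
      rw [hna a ha]
      exact add_mem (add_mem (hy.conj a ha) (hy.conj' a ha)) (mul_mem (mul_mem hzA ha) hzA)
  have hne : n * e = y := by
    have h1 : star y * e = 0 := by
      rw [← hyf, mul_assoc, hz, mul_zero]
    have h2 : z * e = 0 := by rw [hA.comm _ hzA _ heA, hez]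
    rw [hn, add_mul, add_mul, hye, h1, h2, add_zero, add_zero]
  rw [← hne]
  exact mul_mem hnN (hAN heA)

theorem eq_zero_of_normalizes_of_perp (hm : IsMaxAbelian M A) (hN : ContainsSymmetries M A N)
    {w : H →L[ℂ] H} (hw : Normalizes M A w)
    (hp : IsStarProjection (star w * w)) (hperp : Perp τ N w) : w = 0 := by
  have hAN := hN.le hm.1
  have hrA : star w * w ∈ A := by simpa using hw.conj' 1 (one_mem A)
  let r : Pr A := Pr.of hrA hp
  have hr : star w * w = r.op := rfl
  have hwr : w * r.op = w := by
    rw [← hr, ← mul_assoc]; exact mul_star_mul_of_isStarProjection hp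
  have hyy : ∀ e : Pr A, e ≤ r → star (w * e.op) * (w * e.op) = e.op := by
    intro e he
    rw [star_mul, e.isStarProjection.star_eq, mul_assoc, ← mul_assoc (star w), hr,
      Pr.le_iff'.1 he, e.isStarProjection.mul_self]
  have hyy' : ∀ e : Pr A, (w * e.op) * star (w * e.op) = w * e.op * star w := by
    intro e
    rw [star_mul, e.isStarProjection.star_eq, mul_assoc, ← mul_assoc e.op,
      e.isStarProjection.mul_self, mul_assoc]
  have c1 : ∀ e : Pr A, e ≤ r → w * e.op * star w * e.op = 0 → e = ⊥ := by
    intro e he h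
    have hy := hw.mul_right hm.1 e.mem
    have h1 : w * e.op ∈ N := by
      refine mem_of_orthogonal hN hm.1 hy ?_ ?_
      · rw [hyy e he]; exact e.isStarProjection
      · rw [hyy e he, hyy', h]
    have h2 := (hperp.mul_right (hAN e.mem)).eq_zero_of_mem hy.mem h1
    apply Pr.op_injective
    rw [← hyy e he, h2]; simp
  have c2 : ∀ e : Pr A, e ≤ r → w * e.op * star w = e.op := by
    intro e he
    have hfp : IsStarProjection (w * e.op * star w) := by
      rw [← hyy' e]
      have : IsStarProjection (star (star (w * e.op)) * star (w * e.op)) := by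
        apply isStarProjection_of_mul_star_mul
        rw [star_star, hyy e he, star_mul, e.isStarProjection.star_eq, ← mul_assoc,
          e.isStarProjection.mul_self]
      rwa [star_star] at this
    let f : Pr A := Pr.of (hw.conj _ e.mem) hfp
    have hf : f.op = w * e.op * star w := rfl
    have hle : e ≤ f := by
      refine disjoint_compl_right_iff.1 (disjoint_iff_inf_le.2 (c1 _ (inf_le_left.trans he) ?_).le)
      have h1 : w * (e ⊓ fᶜ).op * star w = w * (e ⊓ fᶜ).op * star w * f.op := by
        rw [hf]
        calc _ = w * ((e ⊓ fᶜ).op * (r.op * e.op)) * star w := by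
              rw [Pr.le_iff'.1 he, Pr.le_iff.1 inf_le_left]
          _ = _ := by rw [← hr]; simp only [mul_assoc]
      rw [h1, mul_assoc]
      rw [Pr.disjoint_iff.1 (disjoint_compl_right.mono_right (inf_le_right : e ⊓ fᶜ ≤ fᶜ)),
        mul_zero]
    rw [← hf]
    have h2 : (f \ e).op = f.op - e.op := by
      rw [sdiff_eq, Pr.op_inf, Pr.op_compl, mul_sub, mul_one, Pr.le_iff'.1 hle]
    have h3 : (τ.φ (f \ e).op).re = 0 := by
      rw [h2, map_sub, hf, mul_assoc, τ.tracial _ hw.mem _ (mul_mem (hm.1 e.mem) (star_mem hw.mem)),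
        mul_assoc, hr, Pr.le_iff.1 he, sub_self, Complex.zero_re]
    have h4 := τ.eq_zero_of_n2 (hm.1 (f \ e).mem) (by
      rw [τ.n2_proj (Pr.isStarProjection _), h3])
    rw [h2, sub_eq_zero] at h4
    exact h4
  have c3 : ∀ e : Pr A, e ≤ r → w * e.op = e.op * w := by
    intro e he
    conv_rhs => rw [← c2 e he]
    rw [mul_assoc _ (star w), hr, mul_assoc, Pr.le_iff.1 he]
  have hwA : w ∈ A := by
    refine hm.mem hw.mem fun p => ?_
    have h1 := c3 r le_rfl
    have h2 := c3 (p ⊓ r) inf_le_right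
    rw [Pr.op_inf, mul_assoc p.op, ← h1, hwr, p.comm r.mem, ← mul_assoc, hwr] at h2
    exact h2
  exact hperp.eq_zero_of_mem hw.mem (hAN hwA)

/-- Elements normalizing `A` and orthogonal to `N` vanish. -/
theorem Normalizes.eq_zero (hm : IsMaxAbelian M A) (hN : ContainsSymmetries M A N)
    {w : H →L[ℂ] H} (hw : Normalizes M A w) (hperp : Perp τ N w) : w = 0 := by
  by_contra hne
  obtain ⟨h, k, hR, -, -, hp, hne'⟩ := exists_mul_partialIsometry w hne
  have hh : h ∈ A := hR A (by simpa using hw.conj' 1 (one_mem A))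
  exact hne' (eq_zero_of_normalizes_of_perp hm hN (hw.mul_right hm.1 hh) hp
    (hperp.mul_right (hN.le hm.1 hh)))

end Normalizer

section DoubleSelection
variable {M A N : VonNeumannAlgebra H} [hA : IsCommVN A] {τ : FTrace M}

theorem FTrace.le_n2_compress (hAM : A ≤ M) {f : H →L[ℂ] H} (hf : f ∈ M) (hsa : IsSelfAdjoint f)
    (c : ℝ) (p : Pr A) :
    2 * c * (τ.φ (f * p.op)).re - c ^ 2 * Pr.tr τ p ≤ τ.n2 (p.op * f * p.op) := by
  have hp := p.isStarProjection
  have hpM := hAM p.mem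
  have hg : p.op * f * p.op ∈ M := mul_mem (mul_mem hpM hf) hpM
  have h0 := τ.n2_nonneg (sub_mem hg (M.real_smul_mem c hpM))
  have h1 : (τ.φ (p.op * f * p.op)) = τ.φ (f * p.op) := by
    rw [mul_assoc, τ.tracial _ hpM _ (mul_mem hf hpM), mul_assoc, hp.mul_self]
  have h2 : p.op * (p.op * f * p.op) = p.op * f * p.op := by
    rw [← mul_assoc, ← mul_assoc, hp.mul_self]
  have h3 : p.op * f * p.op * p.op = p.op * f * p.op := by rw [mul_assoc, hp.mul_self]
  have hgs : star (p.op * f * p.op) = p.op * f * p.op := by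
    simp only [star_mul, hp.star_eq, hsa.star_eq, mul_assoc]
  have h4 : star (p.op * f * p.op - c • p.op) * (p.op * f * p.op - c • p.op) =
      star (p.op * f * p.op) * (p.op * f * p.op) - (2 * c) • (p.op * f * p.op)
        + (c ^ 2) • p.op := by
    rw [star_sub, star_smul, hgs, hp.star_eq, star_trivial, sub_mul, mul_sub, mul_sub,
      smul_mul_assoc, mul_smul_comm, smul_mul_smul_comm, hp.mul_self, h2, h3]
    module
  rw [FTrace.n2, h4, map_add, map_sub, τ.real_smul, τ.real_smul, h1, Complex.add_re,
    Complex.sub_re, Complex.re_ofReal_mul, Complex.re_ofReal_mul] at h0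
  rw [FTrace.n2, Pr.tr]
  linarith

theorem Pr.sum_parts (P : Finpartition (⊤ : Pr A)) : ∑ p ∈ P.parts, p.op = 1 := by
  have := Pr.op_finset_sup P.parts id P.disjoint
  rw [P.sup_parts] at this
  exact this.symm

namespace CExp
variable (ε : CExp τ A)

theorem sq_trace_le_V (hm : IsMaxAbelian M A) {w : H →L[ℂ] H} (hw : w ∈ M)
    (h : ∀ p : Pr A, ∃ q : Pr A, p.op * w = w * q.op) (P : Finpartition (⊤ : Pr A)) :
    τ.n2 w ^ 2 ≤ ε.V (star w) P := by
  have hfM : star w * w ∈ M := mul_mem (star_mem hw) hw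
  have h1 : ∀ p : Pr A, τ.n2 (ε.cp (star w) p) = τ.n2 (p.op * (star w * w) * p.op) := by
    intro p
    have hp := p.isStarProjection
    have hpM := hm.1 p.mem
    have hwp : w * p.op ∈ M := mul_mem hw hpM
    rw [cp, star_star, ε.apply_mem (hm.conj_mem hw h p.mem), FTrace.n2, FTrace.n2]
    congr 1
    have hpp : ∀ z, p.op * (p.op * z) = p.op * z := fun z => by rw [← mul_assoc, hp.mul_self]
    have e1 : star (w * p.op * star w) * (w * p.op * star w) =
        w * p.op * (p.op * (star w * w) * (p.op * star w)) := by
      simp only [star_mul, star_star, hp.star_eq, mul_assoc, hpp]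
    rw [e1, τ.tracial _ hwp _
      (mul_mem (mul_mem hpM hfM) (mul_mem hpM (star_mem hw)))]
    simp only [star_mul, star_star, hp.star_eq, mul_assoc, hpp]
  rw [V, Finset.sum_congr rfl fun p _ => h1 p]
  have h2 := Finset.sum_le_sum fun (p : Pr A) (_ : p ∈ P.parts) =>
    τ.le_n2_compress hm.1 hfM (.star_mul_self w) (τ.n2 w) p
  refine le_trans (le_of_eq ?_) h2
  simp only [Pr.tr]
  rw [Finset.sum_sub_distrib, ← Finset.mul_sum, ← Finset.mul_sum, ← Complex.re_sum,
    ← Complex.re_sum, ← map_sum, ← map_sum, ← Finset.mul_sum, Pr.sum_parts, mul_one, τ.φ_one,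
    Complex.one_re, FTrace.n2]
  ring

/-- For `x` orthogonal to `N`, the completely positive map `p ↦ E(x* p x)` has no atomic part. -/
theorem exists_V_lt (hf : IsFactor (M : Set (H →L[ℂ] H))) (hm : IsMaxAbelian M A)
    (hN : ContainsSymmetries M A N) (hNM : N ≤ M) {x : H →L[ℂ] H} (hx : x ∈ M)
    (hperp : Perp τ N x) {c : ℝ} (hc : 0 < c) : ∃ P, ε.V x P < c := by
  have hAN := hN.le hm.1
  have perp_of : ∀ {y z : H →L[ℂ] H}, y ∈ M → Perp τ N y →
      (∀ m ∈ M, (∀ a ∈ A, ∀ b ∈ A, τ.φ (a * y * b * m) = 0) → τ.φ (z * m) = 0) →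
      Perp τ N z := by
    intro y z hy hpy h m hmN
    refine h m (hNM hmN) fun a ha b hb => ?_
    rw [mul_assoc, mul_assoc, τ.tracial _ (hm.1 ha) _
      (mul_mem hy (mul_mem (hm.1 hb) (hNM hmN))), mul_assoc]
    exact hpy _ (mul_mem (mul_mem (hAN hb) hmN) (hAN ha))
  by_contra! hV
  obtain ⟨w, hw, hw0, hwa, -, hwc⟩ := ε.exists_selection hf hx hc hV
  have hwp := perp_of hx hperp hwc
  have hpos : 0 < τ.n2 w :=
    lt_of_le_of_ne (τ.n2_nonneg hw) fun h => hw0 (τ.eq_zero_of_n2 hw h.symm)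
  obtain ⟨v, hv, hv0, hva, hvb, hvc⟩ := ε.exists_selection hf (star_mem hw) (pow_pos hpos 2)
    (ε.sq_trace_le_V hm hw hwa)
  have hvp := perp_of (star_mem hw) (hwp.star hw hNM) hvc
  refine hv0 ?_
  refine Normalizes.eq_zero hm hN (hm.normalizes hv hva fun p => ?_) hvp
  obtain ⟨q, hq⟩ := hwa p
  refine ⟨q, ?_⟩
  have h1 : q.op * star w = star w * p.op := by
    simpa [p.isStarProjection.star_eq, q.isStarProjection.star_eq] using (congrArg star hq).symm
  have h2 := hvb _ q.mem _ p.mem h1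
  simpa [p.isStarProjection.star_eq, q.isStarProjection.star_eq] using (congrArg star h2).symm

end CExp
end DoubleSelection

section FiniteFamilies
variable {M A N : VonNeumannAlgebra H} [hA : IsCommVN A] {τ : FTrace M}

theorem FTrace.exists_signs (τ : FTrace M) {ι κ : Type*} [Fintype ι] (s : Finset κ)
    (f : ι → κ → H →L[ℂ] H) : ∃ σ : κ → ℂ, (∀ k, σ k = 1 ∨ σ k = -1) ∧
      ∑ i, τ.n2 (∑ k ∈ s, σ k • f i k) ≤ ∑ k ∈ s, ∑ i, τ.n2 (f i k) := by
  classical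
  induction s using Finset.induction_on with
  | empty => exact ⟨fun _ => 1, fun _ => .inl rfl, by simp⟩
  | insert a s ha ih =>
    obtain ⟨σ, hσ, h⟩ := ih
    have key : ∀ c : ℂ, (c = 1 ∨ c = -1) →
        (∀ k, Function.update σ a c k = 1 ∨ Function.update σ a c k = -1) ∧
        ∀ i, ∑ k ∈ insert a s, Function.update σ a c k • f i k =
          c • f i a + ∑ k ∈ s, σ k • f i k := by
      intro c hc
      refine ⟨fun k => ?_, fun i => ?_⟩
      · rcases eq_or_ne k a with rfl | hk
        · simpa using hc
        · simpa [hk] using hσ k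
      · rw [Finset.sum_insert ha, Function.update_self]
        congr 1
        refine Finset.sum_congr rfl fun k hk => ?_
        rw [Function.update_of_ne (by rintro rfl; exact ha hk)]
    have hsum : ∑ i, τ.n2 ((1 : ℂ) • f i a + ∑ k ∈ s, σ k • f i k) +
        ∑ i, τ.n2 ((-1 : ℂ) • f i a + ∑ k ∈ s, σ k • f i k) =
        2 * ∑ i, τ.n2 (f i a) + 2 * ∑ i, τ.n2 (∑ k ∈ s, σ k • f i k) := by
      rw [← Finset.sum_add_distrib, Finset.mul_sum, Finset.mul_sum, ← Finset.sum_add_distrib]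
      refine Finset.sum_congr rfl fun i _ => ?_
      rw [← τ.n2_add_add_n2_sub, one_smul, neg_one_smul, ← τ.n2_neg (- f i a + _), neg_add,
        neg_neg, ← sub_eq_add_neg]
    rw [Finset.sum_insert ha]
    rcases le_or_gt (∑ i, τ.n2 ((1 : ℂ) • f i a + ∑ k ∈ s, σ k • f i k))
      (∑ i, τ.n2 (f i a) + ∑ i, τ.n2 (∑ k ∈ s, σ k • f i k)) with h1 | h1
    · obtain ⟨k1, k2⟩ := key 1 (.inl rfl)
      refine ⟨_, k1, ?_⟩
      simp only [k2]
      linarith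
    · obtain ⟨k1, k2⟩ := key (-1) (.inr rfl)
      refine ⟨_, k1, ?_⟩
      simp only [k2]
      linarith

theorem Pr.signs_mul_self (P : Finpartition (⊤ : Pr A)) {σ : Pr A → ℂ}
    (hσ : ∀ p, σ p = 1 ∨ σ p = -1) :
    (∑ p ∈ P.parts, σ p • p.op) * (∑ p ∈ P.parts, σ p • p.op) = 1 := by
  rw [← Pr.sum_parts P, Finset.sum_mul]
  refine Finset.sum_congr rfl fun p hp => ?_
  rw [Finset.mul_sum, Finset.sum_eq_single_of_mem p hp]
  · rw [smul_mul_smul_comm, p.isStarProjection.mul_self]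
    rcases hσ p with h | h <;> simp [h]
  · intro q hq hqp
    rw [smul_mul_smul_comm, show p.op * q.op = 0 from Pr.disjoint_iff.1 (P.disjoint hp hq hqp.symm), smul_zero]

theorem Pr.signs_star (P : Finpartition (⊤ : Pr A)) {σ : Pr A → ℂ}
    (hσ : ∀ p, σ p = 1 ∨ σ p = -1) :
    star (∑ p ∈ P.parts, σ p • p.op) = ∑ p ∈ P.parts, σ p • p.op := by
  rw [star_sum]
  refine Finset.sum_congr rfl fun p _ => ?_
  rw [star_smul, p.isStarProjection.star_eq]
  rcases hσ p with h | h <;> simp [h]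

namespace CExp
variable (ε : CExp τ A)

theorem V_anti {x : H →L[ℂ] H} (hx : x ∈ M) {P Q : Finpartition (⊤ : Pr A)} (h : Q ≤ P) :
    ε.V x Q ≤ ε.V x P := by
  classical
  choose! g hg hle using fun q (hq : q ∈ Q.parts) => h hq
  rw [V, V, ← Finset.sum_fiberwise_of_maps_to (fun q hq => hg q hq)]
  refine Finset.sum_le_sum fun p _ => ?_
  have h1 : ∀ q ∈ Q.parts.filter (fun q => g q = p), τ.n2 (ε.cp x q) ≤ (τ.φ (ε.cp x q * ε.cp x p)).re := by
    intro q hq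
    obtain ⟨hq', rfl⟩ := Finset.mem_filter.1 hq
    rw [FTrace.n2, (ε.cp_isSelfAdjoint hx q).star_eq]
    exact τ.re_mul_mono_right (ε.cp_mem' hx _) (ε.cp_mem' hx _) (ε.cp_mem' hx _)
      (ε.cp_nonneg hx q) (ε.cp_mono hx (hle q hq'))
  refine (Finset.sum_le_sum h1).trans ?_
  have h2 := ε.cp_finset_sup hx (Q.parts.filter fun q => g q = p) id
    (Q.disjoint.subset (Finset.coe_subset.2 (Finset.filter_subset _ _)))
  simp only [id] at h2
  rw [← Complex.re_sum, ← map_sum, ← Finset.sum_mul, ← h2, FTrace.n2,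
    (ε.cp_isSelfAdjoint hx p).star_eq]
  refine τ.re_mul_mono_left (ε.cp_mem' hx _) (ε.cp_mem' hx _) (ε.cp_mem' hx _)
      (ε.cp_nonneg hx p) (ε.cp_mono hx (Finset.sup_le fun q hq => ?_))
  obtain ⟨hq', rfl⟩ := Finset.mem_filter.1 hq
  exact hle q hq'

theorem exists_forall_V_lt (hf : IsFactor (M : Set (H →L[ℂ] H))) (hm : IsMaxAbelian M A)
    (hN : ContainsSymmetries M A N) (hNM : N ≤ M) {ι : Type*} (s : Finset ι) (x : ι → H →L[ℂ] H)
    (hx : ∀ i, x i ∈ M) (hperp : ∀ i, Perp τ N (x i)) {c : ℝ} (hc : 0 < c) :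
    ∃ P, ∀ i ∈ s, ε.V (x i) P < c := by
  classical
  induction s using Finset.induction_on with
  | empty => exact ⟨Classical.choice inferInstance, by simp⟩
  | insert a s _ ih =>
    obtain ⟨P, hP⟩ := ih
    obtain ⟨Q, hQ⟩ := ε.exists_V_lt hf hm hN hNM (hx a) (hperp a) hc
    refine ⟨P ⊓ Q, fun i hi => ?_⟩
    rcases Finset.mem_insert.1 hi with rfl | hi
    · exact (ε.V_anti (hx i) inf_le_right).trans_lt hQ
    · exact (ε.V_anti (hx i) inf_le_left).trans_lt (hP i hi)

/-- The fourth roots of unity. -/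
def root : Fin 4 → ℂ := ![1, -1, Complex.I, -Complex.I]

theorem n2_polarization {y z : H →L[ℂ] H} (hy : y ∈ M) (hz : z ∈ M) (p : Pr A) :
    τ.n2 (ε.E (y * p.op * z)) ≤ 1 / 4 * ∑ k, τ.n2 (ε.cp (star y + root k • z) p) := by
  have hzk : ∀ k, star y + root k • z ∈ M := fun k =>
    add_mem (star_mem hy) (SMulMemClass.smul_mem _ hz)
  have hcp : ∀ k, ε.cp (star y + root k • z) p ∈ M := fun k => ε.cp_mem' (hzk k) p
  have h1 : (4 : ℂ) • ε.E (y * p.op * z) =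
      (ε.cp (star y + root 0 • z) p - ε.cp (star y + root 1 • z) p) +
      ((-Complex.I) • ε.cp (star y + root 2 • z) p +
        Complex.I • ε.cp (star y + root 3 • z) p) := by
    have hc := fun k => ε.conj_mem (hzk k) p
    simp only [cp]
    rw [← ε.smul _ (hc _), ← ε.smul _ (hc _), ← ε.sub (hc _) (hc _),
      ← ε.add (SMulMemClass.smul_mem _ (hc _)) (SMulMemClass.smul_mem _ (hc _)),
      ← ε.add (sub_mem (hc _) (hc _)) (add_mem (SMulMemClass.smul_mem _ (hc _))
        (SMulMemClass.smul_mem _ (hc _))),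
      ← ε.smul _ (mul_mem (mul_mem hy (ε.le p.mem)) hz)]
    congr 1
    simp only [root, Matrix.cons_val, star_add, star_star, star_smul, add_mul, mul_add,
      smul_mul_assoc, mul_smul_comm, smul_add, smul_smul, star_neg, Complex.star_def,
      Complex.conj_I, one_smul, neg_smul, mul_neg, neg_mul, Complex.I_mul_I, neg_neg]
    match_scalars <;> ring_nf <;> simp only [Complex.I_sq] <;> norm_num
  have h2 := τ.n2_add_le (sub_mem (hcp 0) (hcp 1)) (add_mem (SMulMemClass.smul_mem (-Complex.I)
    (hcp 2)) (SMulMemClass.smul_mem Complex.I (hcp 3)))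
  have h3 := τ.n2_add_le (hcp 0) (neg_mem (hcp 1))
  have h4 := τ.n2_add_le (SMulMemClass.smul_mem (-Complex.I)
    (hcp 2)) (SMulMemClass.smul_mem Complex.I (hcp 3))
  rw [← h1, τ.n2_smul] at h2
  rw [← sub_eq_add_neg, τ.n2_neg] at h3
  rw [τ.n2_smul, τ.n2_smul, norm_neg, Complex.norm_I] at h4
  norm_num at h2 h4
  rw [Fin.sum_univ_four]
  linarith

theorem exists_partition_sum_lt (hf : IsFactor (M : Set (H →L[ℂ] H))) (hm : IsMaxAbelian M A)
    (hN : ContainsSymmetries M A N) (hNM : N ≤ M) {n : ℕ} (y : Fin n → H →L[ℂ] H)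
    (hy : ∀ i, y i ∈ M) (hperp : ∀ i, Perp τ N (y i)) {c : ℝ} (hc : 0 < c) :
    ∃ P : Finpartition (⊤ : Pr A), ∀ i : Fin n × Fin n,
      ∑ p ∈ P.parts, τ.n2 (ε.E (y i.1 * p.op * y i.2)) ≤ c := by
  obtain ⟨P, hP⟩ := ε.exists_forall_V_lt hf hm hN hNM (ι := (Fin n × Fin n) × Fin 4) Finset.univ
    (fun i => star (y i.1.1) + root i.2 • y i.1.2)
    (fun i => add_mem (star_mem (hy _)) (SMulMemClass.smul_mem _ (hy _)))
    (fun i m hmN => by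
      rw [add_mul, map_add, (hperp _).star (hy _) hNM m hmN, smul_mul_assoc, map_smul,
        hperp _ m hmN, smul_zero, add_zero]) hc
  refine ⟨P, fun i => ?_⟩
  refine (Finset.sum_le_sum fun p _ => ε.n2_polarization (hy i.1) (hy i.2) p).trans ?_
  rw [← Finset.mul_sum, Finset.sum_comm]
  have h4 : ∑ k : Fin 4, ε.V (star (y i.1) + root k • y i.2) P ≤ ∑ _k : Fin 4, c :=
    Finset.sum_le_sum fun k _ => (hP (i, k) (Finset.mem_univ _)).le
  rw [Finset.sum_const, Finset.card_univ, Fintype.card_fin, nsmul_eq_mul] at h4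
  simp only [V] at h4
  push_cast at h4
  linarith

theorem exists_symmetry (hf : IsFactor (M : Set (H →L[ℂ] H))) (hm : IsMaxAbelian M A)
    (hN : ContainsSymmetries M A N) (hNM : N ≤ M) {n : ℕ} (y : Fin n → H →L[ℂ] H)
    (hy : ∀ i, y i ∈ M) (hperp : ∀ i, Perp τ N (y i)) {c : ℝ} (hc : 0 < c) :
    ∃ u ∈ A, star u = u ∧ u * u = 1 ∧ ∀ i j, τ.n2 (ε.E (y i * u * y j)) < c := by
  have hmem : ∀ (i : Fin n × Fin n) (p : Pr A), y i.1 * p.op * y i.2 ∈ M := fun i p =>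
    mul_mem (mul_mem (hy _) (hm.1 p.mem)) (hy _)
  obtain ⟨P, hP⟩ := ε.exists_partition_sum_lt hf hm hN hNM y hy hperp
    (c := c / (n * n + 1)) (by positivity)
  obtain ⟨σ, hσ, hle⟩ := τ.exists_signs P.parts
    (fun (i : Fin n × Fin n) (p : Pr A) => ε.E (y i.1 * p.op * y i.2))
  refine ⟨∑ p ∈ P.parts, σ p • p.op, sum_mem fun p _ => SMulMemClass.smul_mem _ p.mem,
    Pr.signs_star P hσ, Pr.signs_mul_self P hσ, ?_⟩
  have h1 : ∀ i : Fin n × Fin n, ∑ p ∈ P.parts, σ p • ε.E (y i.1 * p.op * y i.2) =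
      ε.E (y i.1 * (∑ p ∈ P.parts, σ p • p.op) * y i.2) := by
    intro i
    simp only [Finset.mul_sum, Finset.sum_mul, mul_smul_comm, smul_mul_assoc]
    rw [ε.sum _ _ fun p => SMulMemClass.smul_mem _ (hmem i p)]
    exact Finset.sum_congr rfl fun p _ => (ε.smul _ (hmem i p)).symm
  have hu : ∑ p ∈ P.parts, σ p • p.op ∈ A := sum_mem fun p _ => SMulMemClass.smul_mem _ p.mem
  simp only [h1] at hle
  generalize ∑ p ∈ P.parts, σ p • p.op = u at hle hu
  rw [Finset.sum_comm] at hle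
  have h2 := hle.trans (Finset.sum_le_sum fun i _ => hP i)
  rw [Finset.sum_const, Finset.card_univ, Fintype.card_prod, Fintype.card_fin, nsmul_eq_mul,
    Nat.cast_mul, mul_div_assoc', le_div_iff₀ (by positivity)] at h2
  have h3 : ∀ i ∈ (Finset.univ : Finset (Fin n × Fin n)),
      0 ≤ τ.n2 (ε.E (y i.1 * u * y i.2)) := fun i _ =>
    τ.n2_nonneg (ε.mem' (mul_mem (mul_mem (hy _) (hm.1 hu)) (hy _)))
  intro i j
  have h4 := Finset.single_le_sum h3 (Finset.mem_univ (i, j))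
  dsimp only at h4
  nlinarith

end CExp
end FiniteFamilies

section Frozen

/-- The bundled von Neumann algebra attached to a set of operators. -/
def IsVonNeumannAlgebra.toVNA {M : Set (H →L[ℂ] H)} (h : IsVonNeumannAlgebra M) :
    VonNeumannAlgebra H where
  carrier := M
  mul_mem' hx hy := h.mul_mem _ hx _ hy
  one_mem' := h.one_mem
  add_mem' hx hy := h.add_mem _ hx _ hy
  zero_mem' := by simpa using h.smul_mem 0 _ h.one_mem
  algebraMap_mem' c := by
    rw [Algebra.algebraMap_eq_smul_one]; exact h.smul_mem c _ h.one_mem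
  star_mem' hx := h.star_mem _ hx
  centralizer_centralizer' := h.double_commutant

theorem star_mem_centralizer_of_star_mem {T : Set (H →L[ℂ] H)} (hT : ∀ x ∈ T, star x ∈ T)
    {x : H →L[ℂ] H} (hx : x ∈ T.centralizer) : star x ∈ T.centralizer := by
  intro t ht
  simpa using (congrArg star (hx _ (hT t ht))).symm

theorem isVonNeumannAlgebra_centralizer {T : Set (H →L[ℂ] H)} (hT : ∀ x ∈ T, star x ∈ T) :
    IsVonNeumannAlgebra T.centralizer where
  one_mem := Set.one_mem_centralizer
  add_mem _ hx _ hy := Set.add_mem_centralizer hx hy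
  mul_mem _ hx _ hy := Set.mul_mem_centralizer hx hy
  smul_mem c x hx t ht := by rw [mul_smul_comm, smul_mul_assoc, hx t ht]
  star_mem _ hx := star_mem_centralizer_of_star_mem hT hx
  double_commutant := Set.centralizer_centralizer_centralizer T

theorem isVonNeumannAlgebra_vNgen (S : Set (H →L[ℂ] H)) : IsVonNeumannAlgebra (vNgen S) := by
  refine isVonNeumannAlgebra_centralizer fun x hx => star_mem_centralizer_of_star_mem ?_ hx
  rintro y (hy | ⟨z, hz, rfl⟩)
  · exact .inr ⟨y, hy, rfl⟩
  · exact .inl (by simpa using hz)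

theorem subset_vNgen (S : Set (H →L[ℂ] H)) : S ⊆ vNgen S :=
  Set.subset_union_left.trans Set.subset_centralizer_centralizer

theorem IsVonNeumannAlgebra.vNgen_subset {M S : Set (H →L[ℂ] H)} (hM : IsVonNeumannAlgebra M)
    (h : S ⊆ M) : vNgen S ⊆ M := by
  rw [← hM.double_commutant]
  refine Set.centralizer_subset (Set.centralizer_subset ?_)
  rintro y (hy | ⟨z, hz, rfl⟩)
  exacts [h hy, hM.star_mem _ (h hz)]

theorem IsMasa.mem_iff {M A : Set (H →L[ℂ] H)} (hA : IsMasa M A) {x : H →L[ℂ] H} :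
    x ∈ A ↔ x ∈ M ∧ ∀ a ∈ A, x * a = a * x := by
  conv_lhs => rw [← hA.2.2]
  rfl

theorem IsMasa.isVonNeumannAlgebra {M A : Set (H →L[ℂ] H)} (hM : IsVonNeumannAlgebra M)
    (hA : IsMasa M A) : IsVonNeumannAlgebra A where
  one_mem := hA.mem_iff.2 ⟨hM.one_mem, by simp⟩
  add_mem x hx y hy := by
    rw [hA.mem_iff] at hx hy ⊢
    exact ⟨hM.add_mem _ hx.1 _ hy.1, fun a ha => by rw [add_mul, mul_add, hx.2 a ha, hy.2 a ha]⟩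
  mul_mem x hx y hy := by
    rw [hA.mem_iff] at hx hy ⊢
    exact ⟨hM.mul_mem _ hx.1 _ hy.1, fun a ha => by
      rw [mul_assoc, hy.2 a ha, ← mul_assoc, hx.2 a ha, mul_assoc]⟩
  smul_mem c x hx := by
    rw [hA.mem_iff] at hx ⊢
    exact ⟨hM.smul_mem _ _ hx.1, fun a ha => by rw [smul_mul_assoc, mul_smul_comm, hx.2 a ha]⟩
  star_mem := hA.2.1
  double_commutant := by
    refine subset_antisymm (fun x hx => hA.mem_iff.2 ⟨?_, fun a ha => ?_⟩)
      Set.subset_centralizer_centralizer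
    · rw [← hM.double_commutant]
      exact Set.centralizer_subset (Set.centralizer_subset hA.1) hx
    · exact (hx a fun b hb => ((hA.mem_iff.1 ha).2 b hb).symm).symm

theorem IsFaithfulTracialState.exists_fTrace {M : Set (H →L[ℂ] H)} {τ : (H →L[ℂ] H) → ℂ}
    (hM : IsVonNeumannAlgebra M) (h : IsFaithfulTracialState M τ) :
    ∃ t : FTrace hM.toVNA, ∀ x ∈ M, t.φ x = τ x := by
  let S : Submodule ℂ (H →L[ℂ] H) := Subalgebra.toSubmodule hM.toVNA.toSubalgebra
  let f : S →ₗ[ℂ] ℂ :=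
    { toFun := fun x => τ x
      map_add' := fun x y => h.map_add _ x.2 _ y.2
      map_smul' := fun c x => h.map_smul c _ x.2 }
  obtain ⟨φ, hφ⟩ := f.exists_extend
  have hφ' : ∀ x ∈ M, φ x = τ x := fun x hx => LinearMap.congr_fun hφ (⟨x, hx⟩ : S)
  refine ⟨⟨φ, ?_, fun x hx => ?_, fun x hx y hy => ?_, fun x hx h0 => ?_⟩, hφ'⟩
  · rw [hφ' _ hM.one_mem, h.map_one]
  · rw [hφ' _ (hM.mul_mem _ (hM.star_mem _ hx) _ hx)]
    exact h.nonneg x hx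
  · rw [hφ' _ (hM.mul_mem _ hx _ hy), hφ' _ (hM.mul_mem _ hy _ hx)]
    exact h.tracial x hx y hy
  · rw [hφ' _ (hM.mul_mem _ (hM.star_mem _ hx) _ hx)] at h0
    exact h.faithful x hx h0

/-- The bundled form of a trace preserving conditional expectation. -/
def IsCondExp.toCExp {M B : Set (H →L[ℂ] H)} {τ : (H →L[ℂ] H) → ℂ}
    {E : (H →L[ℂ] H) → (H →L[ℂ] H)} (h : IsCondExp M B τ E) (hM : IsVonNeumannAlgebra M)
    (hB : IsVonNeumannAlgebra B) (hBM : B ⊆ M) (t : FTrace hM.toVNA)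
    (ht : ∀ x ∈ M, t.φ x = τ x) : CExp t hB.toVNA where
  le := hBM
  E := E
  mem hx := h.1 _ hx
  orth x hx b hb := by
    rw [ht _ (hM.toVNA.mul_mem (sub_mem (S := VonNeumannAlgebra H) hx (hBM (h.1 x hx))) (hBM hb))]
    exact h.2 x hx b hb

theorem containsSymmetries_normAlg {M A : Set (H →L[ℂ] H)} (hM : IsVonNeumannAlgebra M)
    (hA : IsVonNeumannAlgebra A) : ContainsSymmetries hM.toVNA hA.toVNA
      (isVonNeumannAlgebra_vNgen (normalizerSet M A)).toVNA := by
  intro n hn hsa h1 hconj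
  refine subset_vNgen (normalizerSet M A) ⟨hn, ⟨by rw [hsa.star_eq, h1], by rw [hsa.star_eq, h1]⟩, ?_⟩
  rw [hsa.star_eq]
  refine subset_antisymm ?_ fun a ha => ⟨n * a * n, hconj a ha, ?_⟩
  · rintro _ ⟨a, ha, rfl⟩
    exact hconj a ha
  · calc n * (n * a * n) * n = (n * n) * a * (n * n) := by simp only [mul_assoc]
      _ = a := by rw [h1, one_mul, mul_one]

/-- The difference of expectations only depends on the components orthogonal to `N`. -/
theorem CExp.sub_eq {M A N : VonNeumannAlgebra H} {τ : FTrace M} (ε : CExp τ A) (ν : CExp τ N)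
    (hAN : A ≤ N) {x z u : H →L[ℂ] H} (hx : x ∈ M) (hz : z ∈ M) (hu : u ∈ A) :
    ε.E (x * u * z) - ε.E (ν.E x * u * ν.E z) = ε.E ((x - ν.E x) * u * (z - ν.E z)) := by
  have huM := ε.le hu
  have hnx := ν.mem' hx
  have hnz := ν.mem' hz
  have hyx := sub_mem hx hnx
  have hyz := sub_mem hz hnz
  have h1 := mul_mem (mul_mem hx huM) hz
  have h2 := mul_mem (mul_mem hnx huM) hnz
  have h3 := mul_mem (mul_mem hyx huM) hyz
  rw [← ε.sub h1 h2]
  refine ε.eq_of_trace (sub_mem h1 h2) (ε.mem h3) fun b hb => ?_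
  rw [ε.trace_mul h3 hb]
  have e1 : τ.φ ((x - ν.E x) * (u * ν.E z * b)) = 0 :=
    ν.orth x hx _ (mul_mem (mul_mem (hAN hu) (ν.mem hz)) (hAN hb))
  have e2 : τ.φ (ν.E x * u * ((z - ν.E z) * b)) = 0 := by
    rw [τ.tracial _ (mul_mem hnx huM) _ (mul_mem hyz (ε.le hb)), mul_assoc]
    exact ν.orth z hz _ (mul_mem (hAN hb) (mul_mem (ν.mem hx) (hAN hu)))
  have e3 : (x * u * z - ν.E x * u * ν.E z) * b = (x - ν.E x) * u * (z - ν.E z) * b +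
      (x - ν.E x) * (u * ν.E z * b) + ν.E x * u * ((z - ν.E z) * b) := by
    noncomm_ring
  rw [e3, map_add, map_add, e1, e2, add_zero, add_zero]

end Frozen

end Auxiliary

/-- Let `M` be a II₁ factor with faithful tracial state `τ`, `A ⊆ M` a MASA,
and `N := N_M(A)''`. If the `τ`-preserving conditional expectations onto `A` and `N` exist,
then the triple `A ⊆ N ⊆ M` satisfies the relative WAHP. -/
theorem masa_normalizing_algebra_relative_WAHP
    {H : Type*} [NormedAddCommGroup H] [InnerProductSpace ℂ H] [CompleteSpace H]
    (M A : Set (H →L[ℂ] H)) (τ : (H →L[ℂ] H) → ℂ)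
    (EA EN : (H →L[ℂ] H) → (H →L[ℂ] H))
    (hM : IsII1Factor M τ) (hA : IsMasa M A)
    (hEA : IsCondExp M A τ EA)
    (hEN : IsCondExp M (normAlg M A) τ EN) :
    RelWAHP M (normAlg M A) A τ EA EN := by
  have hAv := hA.isVonNeumannAlgebra hM.vna
  have hNv := isVonNeumannAlgebra_vNgen (normalizerSet M A)
  have hNM : normAlg M A ⊆ M := hM.vna.vNgen_subset fun _ h => h.1
  have hcomm : IsCommVN hAv.toVNA := ⟨fun x hx y hy => (hA.mem_iff.1 hx).2 y hy⟩
  have hmax : IsMaxAbelian hM.vna.toVNA hAv.toVNA :=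
    ⟨hA.1, fun x hx h => hA.mem_iff.2 ⟨hx, fun a ha => h a ha⟩⟩
  have hsym := containsSymmetries_normAlg hM.vna hAv
  obtain ⟨t, ht⟩ := hM.trace.exists_fTrace hM.vna
  let ε := hEA.toCExp hM.vna hAv hA.1 t ht
  let ν := hEN.toCExp hM.vna hNv hNM t ht
  intro n x hx δ hδ
  have hy : ∀ i, x i - EN (x i) ∈ hM.vna.toVNA := fun i => sub_mem (hx i) (ν.mem' (hx i))
  obtain ⟨u, hu, hstar, hsq, h⟩ := ε.exists_symmetry hM.factor hmax hsym hNM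
    (fun i => x i - EN (x i)) hy (fun i m hm => ν.orth _ (hx i) m hm) (pow_pos hδ 2)
  refine ⟨u, hu, ⟨by rw [hstar, hsq], by rw [hstar, hsq]⟩, fun i j => ?_⟩
  have h1 : EA (x i * u * x j) - EA (EN (x i) * u * EN (x j)) =
      EA ((x i - EN (x i)) * u * (x j - EN (x j))) :=
    ε.sub_eq ν (hsym.le hA.1) (hx i) (hx j) hu
  have h2 : EA ((x i - EN (x i)) * u * (x j - EN (x j))) ∈ M :=
    ε.mem' (mul_mem (mul_mem (hy i) (hA.1 hu)) (hy j))
  rw [h1, norm2, ← ht _ (hM.vna.mul_mem _ (hM.vna.star_mem _ h2) _ h2), Real.sqrt_lt' hδ]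
  exact h i j
end
end

section
/- Let M be a II₁ factor with faithful tracial state τ and let A ⊆ N ⊆ M be von Neumann subalgebras whose τ-preserving conditional expectations E_A and E_N exist. For a unitary u ∈ M define E_{uAu*}(x) := u E_A(u* x u) u* (the τ-preserving conditional expectation onto uAu*), and set ‖E_{uAu*} − E_A‖_{∞,2} := sup{‖E_{uAu*}(x) − E_A(x)‖₂ : x ∈ M, ‖x‖ ≤ 1}, where ‖x‖ is the operator norm. If the triple A ⊆ N ⊆ M satisfies the relative weak asymptotic homomorphism property, then for every unitary u ∈ M one has ‖E_{uAu*} − E_A‖_{∞,2} ≥ ‖u − E_N(u)‖₂. -/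
open scoped ComplexOrder

noncomputable section

variable {H : Type*} [NormedAddCommGroup H] [InnerProductSpace ℂ H] [CompleteSpace H]

/-- The conjugated conditional expectation `E_{uAu*}(x) = u E_A(u* x u) u*`. -/
def conjCondExp (EA : (H →L[ℂ] H) → (H →L[ℂ] H)) (u : H →L[ℂ] H)
    (x : H →L[ℂ] H) : H →L[ℂ] H :=
  u * EA (star u * x * u) * star u

/-- `‖Φ‖_{∞,2} = sup {‖Φ(x)‖₂ : x ∈ M, ‖x‖ ≤ 1}` for a map `Φ`, where `‖x‖` is the
operator norm. -/
def normInfty2 (M : Set (H →L[ℂ] H)) (τ : (H →L[ℂ] H) → ℂ)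
    (Φ : (H →L[ℂ] H) → (H →L[ℂ] H)) : ℝ :=
  sSup {r : ℝ | ∃ x ∈ M, ‖x‖ ≤ 1 ∧ r = norm2 τ (Φ x)}

namespace IsVonNeumannAlgebra

variable {M : Set (H →L[ℂ] H)}

lemma neg_mem (hM : IsVonNeumannAlgebra M) {x : H →L[ℂ] H} (hx : x ∈ M) : -x ∈ M := by
  simpa using hM.smul_mem (-1) x hx

lemma sub_mem (hM : IsVonNeumannAlgebra M) {x y : H →L[ℂ] H} (hx : x ∈ M) (hy : y ∈ M) :
    x - y ∈ M := by
  rw [sub_eq_add_neg]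
  exact hM.add_mem _ hx _ (hM.neg_mem hy)

/-- A von Neumann algebra contains a square root of `1 - x* x` for each of its contractions `x`. -/
lemma exists_star_mul_self_eq_one_sub (hM : IsVonNeumannAlgebra M) {x : H →L[ℂ] H} (hx : x ∈ M)
    (hx1 : ‖x‖ ≤ 1) : ∃ y ∈ M, star y * y = 1 - star x * x := by
  set a : H →L[ℂ] H := 1 - star x * x with ha
  have haM : a ∈ M := hM.sub_mem hM.one_mem (hM.mul_mem _ (hM.star_mem _ hx) _ hx)
  have ha0 : 0 ≤ a := by
    rw [ha, sub_nonneg]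
    refine (CStarAlgebra.norm_le_one_iff_of_nonneg _ (star_mul_self_nonneg x)).1 ?_
    rw [CStarRing.norm_star_mul_self]
    exact mul_le_one₀ hx1 (norm_nonneg _) hx1
  refine ⟨CFC.sqrt a, ?_, ?_⟩
  · rw [← hM.double_commutant]
    intro c hc
    have hcomm : Commute a c := hc a haM
    have := hcomm.cfcₙ_nnreal NNReal.sqrt
    exact this.symm
  · rw [(CFC.sqrt_nonneg a).isSelfAdjoint.star_eq, CFC.sqrt_mul_sqrt_self a ha0]

end IsVonNeumannAlgebra

/-- The square of the 2-norm associated to `τ`. -/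
def normSq2 (τ : (H →L[ℂ] H) → ℂ) (x : H →L[ℂ] H) : ℝ :=
  (τ (star x * x)).re

section Trace

variable {M : Set (H →L[ℂ] H)} {τ : (H →L[ℂ] H) → ℂ}

namespace IsFaithfulTracialState

lemma map_sub (hM : IsVonNeumannAlgebra M) (hτ : IsFaithfulTracialState M τ) {x y : H →L[ℂ] H}
    (hx : x ∈ M) (hy : y ∈ M) : τ (x - y) = τ x - τ y := by
  have h : x - y = x + (-1 : ℂ) • y := by rw [neg_one_smul, sub_eq_add_neg]
  rw [h, hτ.map_add _ hx _ (hM.smul_mem _ _ hy), hτ.map_smul _ _ hy]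
  ring

lemma map_star (hM : IsVonNeumannAlgebra M) (hτ : IsFaithfulTracialState M τ) {x : H →L[ℂ] H}
    (hx : x ∈ M) : τ (star x) = star (τ x) := by
  have hsx := hM.star_mem _ hx
  have key : ∀ c : ℂ, (star c * τ (star x) + c * τ x).im = 0 := by
    intro c
    have hcx := hM.smul_mem c x hx
    have hscx := hM.smul_mem (star c) _ hsx
    have h1 := (Complex.nonneg_iff.1 (hτ.nonneg _ (hM.add_mem _ hM.one_mem _ hcx))).2
    have h2 := (Complex.nonneg_iff.1 (hτ.nonneg _ hcx)).2
    have e : star (1 + c • x) * (1 + c • x)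
        = (1 + (star c • star x + c • x)) + star (c • x) * (c • x) := by
      rw [← star_smul, star_add, star_one]
      generalize c • x = z
      noncomm_ring
    rw [e, hτ.map_add _ (hM.add_mem _ hM.one_mem _ (hM.add_mem _ hscx _ hcx)) _
      (hM.mul_mem _ (hM.star_mem _ hcx) _ hcx), hτ.map_add _ hM.one_mem _
      (hM.add_mem _ hscx _ hcx), hτ.map_add _ hscx _ hcx, hτ.map_smul _ _ hsx,
      hτ.map_smul _ _ hx, hτ.map_one] at h1
    simp only [Complex.add_im, Complex.one_im] at h1 ⊢
    linarith
  have k1 := key 1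
  have k2 := key Complex.I
  simp at k1 k2
  apply Complex.ext <;> simp <;> linarith

lemma normSq2_nonneg (hτ : IsFaithfulTracialState M τ) {x : H →L[ℂ] H} (hx : x ∈ M) :
    0 ≤ normSq2 τ x :=
  (Complex.nonneg_iff.1 (hτ.nonneg x hx)).1

lemma normSq2_real_combination (hM : IsVonNeumannAlgebra M) (hτ : IsFaithfulTracialState M τ)
    {x y : H →L[ℂ] H} (hx : x ∈ M) (hy : y ∈ M) (s t : ℝ) :
    normSq2 τ ((s : ℂ) • x + (t : ℂ) • y)
      = s ^ 2 * normSq2 τ x + t ^ 2 * normSq2 τ y + 2 * s * t * (τ (star x * y)).re := by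
  have hsx := hM.star_mem _ hx
  have hsy := hM.star_mem _ hy
  have hxx := hM.mul_mem _ hsx _ hx
  have hyy := hM.mul_mem _ hsy _ hy
  have hxy := hM.mul_mem _ hsx _ hy
  have hyx := hM.mul_mem _ hsy _ hx
  have e : star ((s : ℂ) • x + (t : ℂ) • y) * ((s : ℂ) • x + (t : ℂ) • y)
      = ((s * s : ℝ) : ℂ) • (star x * x) + (((t * t : ℝ) : ℂ) • (star y * y)
        + (((s * t : ℝ) : ℂ) • (star x * y) + ((s * t : ℝ) : ℂ) • (star y * x))) := by
    simp only [star_add, star_smul, add_mul, mul_add, smul_mul_smul_comm, Complex.star_def,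
      Complex.conj_ofReal, Complex.ofReal_mul, mul_comm (t : ℂ) (s : ℂ)]
    abel
  have hc : τ (star y * x) = star (τ (star x * y)) := by
    rw [← hτ.map_star hM hxy, star_mul, star_star]
  have m1 := fun (c : ℂ) => hM.smul_mem c _ hxx
  have m2 := fun (c : ℂ) => hM.smul_mem c _ hyy
  have m3 := fun (c : ℂ) => hM.smul_mem c _ hxy
  have m4 := fun (c : ℂ) => hM.smul_mem c _ hyx
  rw [normSq2, e, hτ.map_add _ (m1 _) _ (hM.add_mem _ (m2 _) _ (hM.add_mem _ (m3 _) _ (m4 _))),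
    hτ.map_add _ (m2 _) _ (hM.add_mem _ (m3 _) _ (m4 _)), hτ.map_add _ (m3 _) _ (m4 _),
    hτ.map_smul _ _ hxx, hτ.map_smul _ _ hyy, hτ.map_smul _ _ hxy, hτ.map_smul _ _ hyx, hc]
  simp only [normSq2, Complex.add_re, Complex.re_ofReal_mul, Complex.star_def, Complex.conj_re]
  ring

lemma normSq2_add (hM : IsVonNeumannAlgebra M) (hτ : IsFaithfulTracialState M τ)
    {x y : H →L[ℂ] H} (hx : x ∈ M) (hy : y ∈ M) :
    normSq2 τ (x + y) = normSq2 τ x + normSq2 τ y + 2 * (τ (star x * y)).re := by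
  simpa using hτ.normSq2_real_combination hM hx hy 1 1

lemma normSq2_sub_le (hM : IsVonNeumannAlgebra M) (hτ : IsFaithfulTracialState M τ)
    {x y : H →L[ℂ] H} (hx : x ∈ M) (hy : y ∈ M) :
    normSq2 τ (x - y) ≤ 2 * normSq2 τ x + 2 * normSq2 τ y := by
  have h1 := hτ.normSq2_real_combination hM hx hy 1 (-1)
  have h2 := hτ.normSq2_add hM hx hy
  have h3 := hτ.normSq2_nonneg (hM.add_mem _ hx _ hy)
  have e : ((1 : ℝ) : ℂ) • x + ((-1 : ℝ) : ℂ) • y = x - y := by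
    simp [sub_eq_add_neg]
  rw [e] at h1
  linarith

lemma normSq2_le_add_sub (hM : IsVonNeumannAlgebra M) (hτ : IsFaithfulTracialState M τ)
    {x y : H →L[ℂ] H} (hx : x ∈ M) (hy : y ∈ M) {δ : ℝ} (hδ : 0 < δ) :
    normSq2 τ x ≤ (1 + δ) * normSq2 τ y + (1 + δ⁻¹) * normSq2 τ (x - y) := by
  have hd := hM.sub_mem hx hy
  have h1 := hτ.normSq2_real_combination hM hy hd δ (-1)
  have h2 := hτ.normSq2_add hM hy hd
  have h3 := hτ.normSq2_nonneg
    (hM.add_mem _ (hM.smul_mem (δ : ℂ) _ hy) _ (hM.smul_mem ((-1 : ℝ) : ℂ) _ hd))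
  rw [add_sub_cancel] at h2
  rw [h1] at h3
  have h4 : 0 ≤ δ⁻¹ * (δ ^ 2 * normSq2 τ y + (-1) ^ 2 * normSq2 τ (x - y)
      + 2 * δ * -1 * (τ (star y * (x - y))).re) := mul_nonneg (inv_nonneg.2 hδ.le) h3
  have h5 : δ⁻¹ * (δ ^ 2 * normSq2 τ y + (-1) ^ 2 * normSq2 τ (x - y)
      + 2 * δ * -1 * (τ (star y * (x - y))).re)
      = δ * normSq2 τ y + δ⁻¹ * normSq2 τ (x - y) - 2 * (τ (star y * (x - y))).re := by
    field_simp
    ring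
  rw [h5] at h4
  linarith

lemma normSq2_le_one (hM : IsVonNeumannAlgebra M) (hτ : IsFaithfulTracialState M τ)
    {x : H →L[ℂ] H} (hx : x ∈ M) (hx1 : ‖x‖ ≤ 1) : normSq2 τ x ≤ 1 := by
  obtain ⟨y, hy, hyx⟩ := hM.exists_star_mul_self_eq_one_sub hx hx1
  have h := hτ.normSq2_nonneg hy
  rw [normSq2, hyx, hτ.map_sub hM hM.one_mem (hM.mul_mem _ (hM.star_mem _ hx) _ hx), hτ.map_one,
    Complex.sub_re, Complex.one_re] at h
  exact sub_nonneg.1 h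

lemma normSq2_eq_one (hτ : IsFaithfulTracialState M τ) {v : H →L[ℂ] H} (hv : star v * v = 1) :
    normSq2 τ v = 1 := by
  rw [normSq2, hv, hτ.map_one, Complex.one_re]

lemma normSq2_mul_of_star_mul_eq_one (τ : (H →L[ℂ] H) → ℂ) {v : H →L[ℂ] H} (hv : star v * v = 1)
    (x : H →L[ℂ] H) : normSq2 τ (v * x) = normSq2 τ x := by
  rw [normSq2, star_mul, mul_assoc, ← mul_assoc (star v), hv, one_mul, normSq2]

lemma normSq2_mul_of_mul_star_eq_one (hM : IsVonNeumannAlgebra M)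
    (hτ : IsFaithfulTracialState M τ) {v x : H →L[ℂ] H} (hvM : v ∈ M) (hx : x ∈ M)
    (hv : v * star v = 1) : normSq2 τ (x * v) = normSq2 τ x := by
  have hsx := hM.star_mem _ hx
  rw [normSq2, star_mul, mul_assoc, hτ.tracial _ (hM.star_mem _ hvM) _
    (hM.mul_mem _ hsx _ (hM.mul_mem _ hx _ hvM)), mul_assoc, mul_assoc, hv, mul_one, normSq2]

end IsFaithfulTracialState

namespace IsCondExp

variable {B : Set (H →L[ℂ] H)} {E : (H →L[ℂ] H) → (H →L[ℂ] H)}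

lemma eq_of_forall_trace_eq_zero (hM : IsVonNeumannAlgebra M) (hτ : IsFaithfulTracialState M τ)
    (hB : IsVonNeumannAlgebra B) (hBM : B ⊆ M) (hE : IsCondExp M B τ E) {x e : H →L[ℂ] H}
    (hx : x ∈ M) (he : e ∈ B) (h : ∀ b ∈ B, τ ((x - e) * b) = 0) : E x = e := by
  have hz : E x - e ∈ B := hB.sub_mem (hE.1 x hx) he
  have hzs := hB.star_mem _ hz
  refine sub_eq_zero.1 (hτ.faithful _ (hBM hz) ?_)
  have e1 : (E x - e) * star (E x - e)
      = (x - e) * star (E x - e) - (x - E x) * star (E x - e) := by noncomm_ring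
  rw [hτ.tracial _ (hBM hzs) _ (hBM hz), e1,
    hτ.map_sub hM (hM.mul_mem _ (hM.sub_mem hx (hBM he)) _ (hBM hzs))
      (hM.mul_mem _ (hM.sub_mem hx (hBM (hE.1 x hx))) _ (hBM hzs)),
    h _ hzs, hE.2 x hx _ hzs, sub_zero]

lemma apply_of_mem (hM : IsVonNeumannAlgebra M) (hτ : IsFaithfulTracialState M τ)
    (hB : IsVonNeumannAlgebra B) (hBM : B ⊆ M) (hE : IsCondExp M B τ E) {b : H →L[ℂ] H}
    (hb : b ∈ B) : E b = b := by
  refine hE.eq_of_forall_trace_eq_zero hM hτ hB hBM (hBM hb) hb fun c _ => ?_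
  simpa using hτ.map_smul 0 1 hM.one_mem

lemma apply_mul (hM : IsVonNeumannAlgebra M) (hτ : IsFaithfulTracialState M τ)
    (hB : IsVonNeumannAlgebra B) (hBM : B ⊆ M) (hE : IsCondExp M B τ E) {x b : H →L[ℂ] H}
    (hx : x ∈ M) (hb : b ∈ B) : E (x * b) = E x * b := by
  refine hE.eq_of_forall_trace_eq_zero hM hτ hB hBM (hM.mul_mem _ hx _ (hBM hb))
    (hB.mul_mem _ (hE.1 x hx) _ hb) fun c hc => ?_
  rw [← sub_mul, mul_assoc]
  exact hE.2 x hx _ (hB.mul_mem _ hb _ hc)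

lemma normSq2_eq_add (hM : IsVonNeumannAlgebra M) (hτ : IsFaithfulTracialState M τ)
    (hB : IsVonNeumannAlgebra B) (hBM : B ⊆ M) (hE : IsCondExp M B τ E) {x : H →L[ℂ] H}
    (hx : x ∈ M) : normSq2 τ x = normSq2 τ (E x) + normSq2 τ (x - E x) := by
  have hEx := hE.1 x hx
  have hd := hM.sub_mem hx (hBM hEx)
  have h := hτ.normSq2_add hM (hBM hEx) hd
  rw [add_sub_cancel, hτ.tracial _ (hM.star_mem _ (hBM hEx)) _ hd,
    hE.2 x hx _ (hB.star_mem _ hEx)] at h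
  simpa using h

lemma normSq2_apply_le (hM : IsVonNeumannAlgebra M) (hτ : IsFaithfulTracialState M τ)
    (hB : IsVonNeumannAlgebra B) (hBM : B ⊆ M) (hE : IsCondExp M B τ E) {x : H →L[ℂ] H}
    (hx : x ∈ M) : normSq2 τ (E x) ≤ normSq2 τ x := by
  rw [hE.normSq2_eq_add hM hτ hB hBM hx]
  exact le_add_of_nonneg_right (hτ.normSq2_nonneg (hM.sub_mem hx (hBM (hE.1 x hx))))

lemma bddAbove_norm2_conjCondExp_sub (hM : IsVonNeumannAlgebra M)
    (hτ : IsFaithfulTracialState M τ) (hB : IsVonNeumannAlgebra B) (hBM : B ⊆ M)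
    (hE : IsCondExp M B τ E) {u : H →L[ℂ] H} (hu : u ∈ M) (huu : IsUnitary u) :
    BddAbove {r : ℝ | ∃ x ∈ M, ‖x‖ ≤ 1 ∧ r = norm2 τ (conjCondExp E u x - E x)} := by
  refine ⟨Real.sqrt 4, ?_⟩
  rintro _ ⟨x, hx, hx1, rfl⟩
  refine Real.sqrt_le_sqrt ?_
  have hsu := hM.star_mem _ hu
  have hsux := hM.mul_mem _ hsu _ hx
  have hv := hM.mul_mem _ hsux _ hu
  have hEv := hBM (hE.1 _ hv)
  have hq := hτ.normSq2_le_one hM hx hx1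
  have huE := hM.mul_mem _ hu _ hEv
  have h1 : normSq2 τ (conjCondExp E u x) ≤ normSq2 τ x := by
    calc normSq2 τ (conjCondExp E u x) = normSq2 τ (E (star u * x * u)) := by
          rw [conjCondExp, hτ.normSq2_mul_of_mul_star_eq_one hM hsu huE
            (by rw [star_star, huu.1]),
            IsFaithfulTracialState.normSq2_mul_of_star_mul_eq_one τ huu.1]
      _ ≤ normSq2 τ (star u * x * u) := hE.normSq2_apply_le hM hτ hB hBM hv
      _ = normSq2 τ x := by
          rw [hτ.normSq2_mul_of_mul_star_eq_one hM hu hsux huu.2,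
            IsFaithfulTracialState.normSq2_mul_of_star_mul_eq_one τ
              (by rw [star_star, huu.2])]
  have h2 := hE.normSq2_apply_le hM hτ hB hBM hx
  have h3 := hτ.normSq2_sub_le hM (x := conjCondExp E u x) (hM.mul_mem _ huE _ hsu)
    (hBM (hE.1 x hx))
  change normSq2 τ _ ≤ 4
  linarith

end IsCondExp

end Trace

lemma IsUnitary.norm_le_one {w : H →L[ℂ] H} (hw : IsUnitary w) : ‖w‖ ≤ 1 := by
  have h := CStarRing.norm_mem_unitary_mul (U := w) 1 ⟨hw.1, hw.2⟩
  rw [mul_one] at h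
  exact h.trans_le ContinuousLinearMap.norm_id_le

/-- If the triple `A ⊆ N ⊆ M` satisfies the relative WAHP, then for every
unitary `u ∈ M` one has `‖E_{uAu*} − E_A‖_{∞,2} ≥ ‖u − E_N(u)‖₂`. -/
theorem relative_WAHP_implies_singularity_inequality
    {H : Type*} [NormedAddCommGroup H] [InnerProductSpace ℂ H] [CompleteSpace H]
    (M N A : Set (H →L[ℂ] H)) (τ : (H →L[ℂ] H) → ℂ)
    (EA EN : (H →L[ℂ] H) → (H →L[ℂ] H))
    (hM : IsII1Factor M τ)
    (hA : IsVonNeumannAlgebra A) (hN : IsVonNeumannAlgebra N)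
    (hAN : A ⊆ N) (hNM : N ⊆ M)
    (hEA : IsCondExp M A τ EA) (hEN : IsCondExp M N τ EN)
    (hwahp : RelWAHP M N A τ EA EN) :
    ∀ u ∈ M, IsUnitary u →
      norm2 τ (u - EN u) ≤ normInfty2 M τ (fun x => conjCondExp EA u x - EA x) := by
  intro u hu huu
  have hMv := hM.vna
  have hτ := hM.trace
  have hAM : A ⊆ M := hAN.trans hNM
  have hsu := hMv.star_mem _ hu
  have hsuu : star (star u) * star u = 1 := by rw [star_star, huu.2]
  have hENu := hEN.1 u hu
  set c := normSq2 τ (EN u) with hc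
  have hc1 : 1 = c + normSq2 τ (u - EN u) := by
    rw [hc, ← hEN.normSq2_eq_add hMv hτ hN hNM hu, hτ.normSq2_eq_one huu.1]
  have hc0 : 0 ≤ normSq2 τ (u - EN u) := hτ.normSq2_nonneg (hMv.sub_mem hu (hNM hENu))
  set S := normInfty2 M τ (fun x => conjCondExp EA u x - EA x) with hS
  have hbdd := hEA.bddAbove_norm2_conjCondExp_sub hMv hτ hA hAM hu huu
  have hS0 : 0 ≤ S := (Real.sqrt_nonneg _).trans
    (le_csSup hbdd ⟨1, hMv.one_mem, IsUnitary.norm_le_one (by simp [IsUnitary]), rfl⟩)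
  refine Real.sqrt_le_iff.2 ⟨hS0, le_of_forall_pos_le_add fun η hη => ?_⟩
  change normSq2 τ (u - EN u) ≤ _
  obtain ⟨δ, hδ, hδ1, hδη⟩ : ∃ δ : ℝ, 0 < δ ∧ δ ≤ 1 ∧ 3 * δ ≤ η :=
    ⟨min 1 (η / 3), by positivity, min_le_left _ _, by linarith [min_le_right 1 (η / 3)]⟩
  obtain ⟨w, hwA, hw, hwx⟩ := hwahp 2 ![star u, u] (by simp [Fin.forall_fin_two, hu, hsu]) δ hδ
  have hlt := hwx 0 1
  simp only [Matrix.cons_val_zero, Matrix.cons_val_one] at hlt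
  set v := star u * w * u with hv
  set y := EN (star u) * w * EN u with hy
  have hwM := hAM hwA
  have hsuw := hMv.mul_mem _ hsu _ hwM
  have hvM : v ∈ M := hMv.mul_mem _ hsuw _ hu
  have hwEN : w * EN u ∈ N := hN.mul_mem _ (hAN hwA) _ hENu
  have hyN : y ∈ N := hN.mul_mem _ (hN.mul_mem _ (hEN.1 _ hsu) _ (hAN hwA)) _ hENu
  have hvA := hEA.1 v hvM
  have hyA := hEA.1 y (hNM hyN)
  have hqd : normSq2 τ (EA v - EA y) ≤ δ ^ 2 := (Real.sqrt_le_left hδ.le).1 hlt.le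
  have hqy : normSq2 τ (EA y) ≤ c := by
    calc normSq2 τ (EA y) ≤ normSq2 τ y := hEA.normSq2_apply_le hMv hτ hA hAM (hNM hyN)
      _ = normSq2 τ (EN (star u * (w * EN u))) := by
          rw [hEN.apply_mul hMv hτ hN hNM hsu hwEN, hy, mul_assoc]
      _ ≤ normSq2 τ (star u * (w * EN u)) :=
          hEN.normSq2_apply_le hMv hτ hN hNM (hMv.mul_mem _ hsu _ (hNM hwEN))
      _ = c := by
          rw [IsFaithfulTracialState.normSq2_mul_of_star_mul_eq_one τ hsuu,
            IsFaithfulTracialState.normSq2_mul_of_star_mul_eq_one τ hw.1]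
  have hqv : normSq2 τ v = 1 := by
    rw [hv, hτ.normSq2_mul_of_mul_star_eq_one hMv hu hsuw huu.2,
      IsFaithfulTracialState.normSq2_mul_of_star_mul_eq_one τ hsuu, hτ.normSq2_eq_one hw.1]
  have hpyth := hEA.normSq2_eq_add hMv hτ hA hAM hvM
  have hle := hτ.normSq2_le_add_sub hMv (hAM hvA) (hAM hyA) hδ
  have hΦ : conjCondExp EA u w - EA w = -u * (v - EA v) * star u := by
    have hw' : w = u * v * star u := by
      simp only [hv, ← mul_assoc, huu.2, one_mul]
      rw [mul_assoc, huu.2, mul_one]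
    rw [hEA.apply_of_mem hMv hτ hA hAM hwA, conjCondExp, ← hv]
    nth_rewrite 1 [hw']
    noncomm_ring
  have hqΦ : normSq2 τ (conjCondExp EA u w - EA w) = normSq2 τ (v - EA v) := by
    rw [hΦ, hτ.normSq2_mul_of_mul_star_eq_one hMv hsu
      (hMv.mul_mem _ (hMv.neg_mem hu) _ (hMv.sub_mem hvM (hAM hvA))) (by rw [star_star, huu.1]),
      IsFaithfulTracialState.normSq2_mul_of_star_mul_eq_one τ (by rw [star_neg, neg_mul_neg, huu.1])]
  have hΦS : normSq2 τ (v - EA v) ≤ S ^ 2 := by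
    rw [← hqΦ]
    exact (Real.sqrt_le_left hS0).1 (le_csSup hbdd ⟨w, hwM, hw.norm_le_one, rfl⟩)
  have h1 : (1 + δ) * normSq2 τ (EA y) ≤ (1 + δ) * c :=
    mul_le_mul_of_nonneg_left hqy (by positivity)
  have h2 : (1 + δ⁻¹) * normSq2 τ (EA v - EA y) ≤ (1 + δ⁻¹) * δ ^ 2 :=
    mul_le_mul_of_nonneg_left hqd (by positivity)
  have h3 : (1 + δ⁻¹) * δ ^ 2 = δ ^ 2 + δ := by field_simp
  nlinarith
end
end
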